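/- For every integer n ≥ 2, the k-vector subspace of L spanned by the set {π^n, ζ_A(1, n−1), ζ_A(2, n−2), …, ζ_A(n−1, 1)} has dimension at least n − ⌊(n−1)/(q−1)⌋. -/

import Mathlib

open Polynomial FunctionField

/-- The inclusion of `k = 𝔽_q(θ)` into its completion `k_∞ = 𝔽_q((1/θ))` at the
infinite place. -/
noncomputable def toKinfty (Fq : Type) [Field Fq] [DecidableEq (RatFunc Fq)] :
    RatFunc Fq →+* RatFunc.CompletionAtInfty Fq :=
  letI := RatFunc.inftyValued Fq
  UniformSpace.Completion.coeRingHom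

/-- The image of `θ` in `k_∞`. -/
noncomputable def thetaInfty (Fq : Type) [Field Fq] [DecidableEq (RatFunc Fq)] :
    RatFunc.CompletionAtInfty Fq :=
  toKinfty Fq (algebraMap (Polynomial Fq) (RatFunc Fq) X)

/-- The double zeta value `ζ_A(s₁, s₂) = Σ_{deg a₁ > deg a₂, both monic}
a₁^{-s₁} a₂^{-s₂} ∈ k_∞`. -/
noncomputable def doubleZeta (Fq : Type) [Field Fq] [Fintype Fq]
    [DecidableEq (RatFunc Fq)] (s₁ s₂ : ℕ) : RatFunc.CompletionAtInfty Fq :=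
  ∑' a : {g : Polynomial Fq × Polynomial Fq //
      g.1.Monic ∧ g.2.Monic ∧ g.2.degree < g.1.degree},
    toKinfty Fq
      (((algebraMap (Polynomial Fq) (RatFunc Fq) a.1.1) ^ s₁)⁻¹ *
        ((algebraMap (Polynomial Fq) (RatFunc Fq) a.1.2) ^ s₂)⁻¹)

/-- `ϖ = -θ^q ∏_{i=1}^∞ (1 - θ^{1-q^i})^{-(q-1)} ∈ k_∞`, which equals `π̃^{q-1}`
for a fundamental period `π̃` of the Carlitz module. -/
noncomputable def varpi (Fq : Type) [Field Fq] [Fintype Fq]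
    [DecidableEq (RatFunc Fq)] : RatFunc.CompletionAtInfty Fq :=
  -(thetaInfty Fq ^ Fintype.card Fq) *
    ∏' i : ℕ,
      ((1 - thetaInfty Fq ^ ((1 : ℤ) - (Fintype.card Fq : ℤ) ^ (i + 1)))⁻¹) ^
        (Fintype.card Fq - 1)

set_option linter.unusedSectionVars false

namespace DoubleZeta


section PowerSeriesBounds

variable {K : Type*} [NormedField K]

/-- `GaussBound ρ C f` says that the `ρ`-Gauss norm of the power series `f` is at most `C`. -/
def GaussBound (ρ C : ℝ) (f : PowerSeries K) : Prop :=
  ∀ m, ‖PowerSeries.coeff m f‖ * ρ ^ m ≤ C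

/-- The value at `x` of the power series `f`. -/
noncomputable def evalSeries (x : K) (f : PowerSeries K) : K :=
  ∑' m, PowerSeries.coeff m f * x ^ m

namespace GaussBound

variable {ρ C C' : ℝ} {f g : PowerSeries K}

lemma nonneg (h : GaussBound ρ C f) : 0 ≤ C := by
  have := h 0
  simp only [pow_zero, mul_one] at this
  exact (norm_nonneg _).trans this

lemma mono (h : GaussBound ρ C f) (hC : C ≤ C') : GaussBound ρ C' f :=
  fun m => (h m).trans hC

lemma mono_radius {ρ' : ℝ} (hρ' : 0 ≤ ρ') (hle : ρ' ≤ ρ) (h : GaussBound ρ C f) :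
    GaussBound ρ' C f :=
  fun m => (mul_le_mul_of_nonneg_left (pow_le_pow_left₀ hρ' hle m) (norm_nonneg _)).trans (h m)

lemma zero (hC : 0 ≤ C) : GaussBound ρ C (0 : PowerSeries K) := fun m => by simpa using hC

lemma const (a : K) : GaussBound ρ ‖a‖ (PowerSeries.C a) := fun m => by
  rw [PowerSeries.coeff_C]
  split_ifs with h
  · simp [h]
  · simp

lemma one : GaussBound ρ 1 (1 : PowerSeries K) := by
  simpa using const (ρ := ρ) (1 : K)

lemma neg (h : GaussBound ρ C f) : GaussBound ρ C (-f) := fun m => by simpa using h m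

lemma coeff_le (hρ : 0 < ρ) (h : GaussBound ρ C f) (m : ℕ) :
    ‖PowerSeries.coeff m f‖ ≤ C / ρ ^ m := by
  rw [le_div_iff₀ (pow_pos hρ m)]
  exact h m

variable [IsUltrametricDist K]

lemma add (hρ : 0 ≤ ρ) (hf : GaussBound ρ C f) (hg : GaussBound ρ C g) :
    GaussBound ρ C (f + g) := fun m => by
  rw [map_add]
  have hp : 0 ≤ ρ ^ m := pow_nonneg hρ m
  rcases le_total ‖PowerSeries.coeff m f‖ ‖PowerSeries.coeff m g‖ with h | h
  · exact (mul_le_mul_of_nonneg_right ((IsUltrametricDist.norm_add_le_max _ _).trans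
      (max_eq_right h).le) hp).trans (hg m)
  · exact (mul_le_mul_of_nonneg_right ((IsUltrametricDist.norm_add_le_max _ _).trans
      (max_eq_left h).le) hp).trans (hf m)

lemma sub (hρ : 0 ≤ ρ) (hf : GaussBound ρ C f) (hg : GaussBound ρ C g) :
    GaussBound ρ C (f - g) := by
  rw [sub_eq_add_neg]
  exact hf.add hρ hg.neg

lemma sum {ι : Type*} {s : Finset ι} {F : ι → PowerSeries K} (hρ : 0 ≤ ρ) (hC : 0 ≤ C)
    (h : ∀ i ∈ s, GaussBound ρ C (F i)) : GaussBound ρ C (∑ i ∈ s, F i) := by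
  classical
  induction s using Finset.induction_on with
  | empty => simpa using zero hC
  | insert a s ha ih =>
    rw [Finset.sum_insert ha]
    exact (h a (Finset.mem_insert_self a s)).add hρ
      (ih fun i hi => h i (Finset.mem_insert_of_mem hi))

lemma mul (hρ : 0 ≤ ρ) (hf : GaussBound ρ C f) (hg : GaussBound ρ C' g) :
    GaussBound ρ (C * C') (f * g) := fun m => by
  rw [PowerSeries.coeff_mul]
  have hne : (Finset.HasAntidiagonal.antidiagonal m).Nonempty := ⟨(0, m), by simp⟩
  obtain ⟨i, hi, hle⟩ := IsUltrametricDist.exists_norm_finsetSum_le_of_nonempty hne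
    fun p : ℕ × ℕ => PowerSeries.coeff p.1 f * PowerSeries.coeff p.2 g
  refine (mul_le_mul_of_nonneg_right hle (pow_nonneg hρ m)).trans ?_
  rw [← Finset.HasAntidiagonal.mem_antidiagonal.1 hi, norm_mul, pow_add, mul_mul_mul_comm]
  exact mul_le_mul (hf i.1) (hg i.2) (by positivity) hf.nonneg

lemma pow (hρ : 0 ≤ ρ) (hf : GaussBound ρ C f) (n : ℕ) : GaussBound ρ (C ^ n) (f ^ n) := by
  induction n with
  | zero => simpa using one
  | succ n ih =>
    rw [pow_succ, pow_succ]
    exact ih.mul hρ hf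

lemma polynomial {p : K[X]} {d : ℕ} {B : ℝ} (hρ : 1 ≤ ρ) (hB : 0 ≤ B) (hd : p.natDegree ≤ d)
    (h : ∀ i, ‖p.coeff i‖ ≤ B) : GaussBound ρ (B * ρ ^ d) (p : PowerSeries K) := fun m => by
  rw [Polynomial.coeff_coe]
  by_cases hm : m ≤ d
  · exact mul_le_mul (h m) (pow_le_pow_right₀ hρ hm) (by positivity) hB
  · rw [Polynomial.coeff_eq_zero_of_natDegree_lt (by omega)]
    simp only [norm_zero, zero_mul]
    positivity

lemma exists_of_polynomial (hρ : 1 ≤ ρ) (p : K[X]) : ∃ C, GaussBound ρ C (p : PowerSeries K) := by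
  refine ⟨_, polynomial (B := ∑ i ∈ p.support, ‖p.coeff i‖) hρ
    (Finset.sum_nonneg fun _ _ => norm_nonneg _) le_rfl fun i => ?_⟩
  by_cases hi : i ∈ p.support
  · exact Finset.single_le_sum (f := fun i => ‖p.coeff i‖) (fun _ _ => norm_nonneg _) hi
  · rw [Polynomial.notMem_support_iff.1 hi, norm_zero]
    exact Finset.sum_nonneg fun _ _ => norm_nonneg _

lemma X_sub_C (x : K) :
    GaussBound 1 (max 1 ‖x‖) (PowerSeries.X - PowerSeries.C x : PowerSeries K) := fun m => by
  rw [one_pow, mul_one, map_sub, PowerSeries.coeff_X, PowerSeries.coeff_C]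
  rcases m with _ | _ | m <;> simp

end GaussBound

section Eval

variable [CompleteSpace K] [IsUltrametricDist K] {ρ C C' : ℝ} {x : K} {f g : PowerSeries K}

lemma GaussBound.summable_norm (hf : GaussBound ρ C f) (hx : ‖x‖ < ρ) :
    Summable fun m => ‖PowerSeries.coeff m f * x ^ m‖ := by
  have hρ : 0 < ρ := (norm_nonneg x).trans_lt hx
  refine Summable.of_nonneg_of_le (fun _ => norm_nonneg _) (fun m => ?_)
    ((summable_geometric_of_lt_one (by positivity : 0 ≤ ‖x‖ / ρ)
      ((div_lt_one hρ).2 hx)).mul_left C)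
  rw [norm_mul, norm_pow, div_pow, mul_div_assoc', mul_div_right_comm]
  exact mul_le_mul_of_nonneg_right (hf.coeff_le hρ m) (by positivity)

lemma GaussBound.summable (hf : GaussBound ρ C f) (hx : ‖x‖ < ρ) :
    Summable fun m => PowerSeries.coeff m f * x ^ m :=
  (hf.summable_norm hx).of_norm

lemma evalSeries_add (hf : GaussBound ρ C f) (hg : GaussBound ρ C' g) (hx : ‖x‖ < ρ) :
    evalSeries x (f + g) = evalSeries x f + evalSeries x g := by
  unfold evalSeries
  rw [← (hf.summable hx).tsum_add (hg.summable hx)]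
  simp [add_mul]

lemma evalSeries_neg : evalSeries x (-f) = -evalSeries x f := by
  unfold evalSeries
  rw [← tsum_neg]
  simp

lemma evalSeries_sub (hf : GaussBound ρ C f) (hg : GaussBound ρ C' g) (hx : ‖x‖ < ρ) :
    evalSeries x (f - g) = evalSeries x f - evalSeries x g := by
  rw [sub_eq_add_neg, evalSeries_add hf hg.neg hx, evalSeries_neg, sub_eq_add_neg]

lemma evalSeries_mul (hf : GaussBound ρ C f) (hg : GaussBound ρ C' g) (hx : ‖x‖ < ρ) :
    evalSeries x (f * g) = evalSeries x f * evalSeries x g := by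
  unfold evalSeries
  rw [tsum_mul_tsum_eq_tsum_sum_antidiagonal_of_summable_norm (hf.summable_norm hx)
    (hg.summable_norm hx)]
  refine tsum_congr fun m => ?_
  rw [PowerSeries.coeff_mul, Finset.sum_mul]
  refine Finset.sum_congr rfl fun p hp => ?_
  rw [← Finset.HasAntidiagonal.mem_antidiagonal.1 hp, pow_add]
  ring

lemma evalSeries_coe (p : K[X]) : evalSeries x (p : PowerSeries K) = p.eval x := by
  unfold evalSeries
  rw [tsum_eq_sum (s := p.support) fun m hm => by
    rw [Polynomial.coeff_coe, Polynomial.notMem_support_iff.1 hm, zero_mul]]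
  rw [Polynomial.eval_eq_sum, Polynomial.sum]
  simp

lemma evalSeries_zero : evalSeries x (0 : PowerSeries K) = 0 := by
  simp [evalSeries]

lemma evalSeries_pow (hf : GaussBound ρ C f) (hx : ‖x‖ < ρ) (n : ℕ) :
    evalSeries x (f ^ n) = evalSeries x f ^ n := by
  have hρ : 0 ≤ ρ := ((norm_nonneg x).trans_lt hx).le
  induction n with
  | zero => simpa using evalSeries_coe (x := x) (1 : K[X])
  | succ n ih => rw [pow_succ, evalSeries_mul (hf.pow hρ n) hf hx, ih, pow_succ]

lemma evalSeries_sum {ι : Type*} {s : Finset ι} {F : ι → PowerSeries K} {C : ι → ℝ}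
    (h : ∀ i ∈ s, GaussBound ρ (C i) (F i)) (hx : ‖x‖ < ρ) :
    evalSeries x (∑ i ∈ s, F i) = ∑ i ∈ s, evalSeries x (F i) := by
  classical
  unfold evalSeries
  rw [← Summable.tsum_finsetSum fun i hi => (h i hi).summable hx]
  simp [Finset.sum_mul]

lemma GaussBound.norm_evalSeries_le (hf : GaussBound ρ C f) (hx : ‖x‖ ≤ ρ) :
    ‖evalSeries x f‖ ≤ C := by
  refine IsUltrametricDist.norm_tsum_le_of_forall_le_of_nonneg hf.nonneg fun m => ?_
  rw [norm_mul, norm_pow]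
  exact (mul_le_mul_of_nonneg_left (pow_le_pow_left₀ (norm_nonneg x) hx m)
    (norm_nonneg _)).trans (hf m)

/-- A power series vanishing at `x` is divisible by `t - x`. -/
lemma GaussBound.exists_eq_X_sub_C_mul (hf : GaussBound ρ C f) (hx : ‖x‖ < ρ)
    (h0 : evalSeries x f = 0) :
    ∃ g : PowerSeries K, f = (PowerSeries.X - PowerSeries.C x) * g ∧ GaussBound ρ (C / ρ) g := by
  have hρ : 0 < ρ := (norm_nonneg x).trans_lt hx
  have hs : ∀ i, Summable fun m => PowerSeries.coeff (i + m) f * x ^ m := fun i => by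
    by_cases hx0 : x = 0
    · refine summable_of_ne_finset_zero (s := {0}) fun m hm => ?_
      rw [hx0, zero_pow (by simpa using hm), mul_zero]
    · have := ((summable_nat_add_iff i).2 (hf.summable hx)).mul_right (x ^ i)⁻¹
      refine this.congr fun m => ?_
      rw [pow_add, add_comm m i]
      field_simp
  have hrec : ∀ i, ∑' m, PowerSeries.coeff (i + m) f * x ^ m =
      PowerSeries.coeff i f + x * ∑' m, PowerSeries.coeff (i + 1 + m) f * x ^ m := fun i => by
    rw [(hs i).tsum_eq_zero_add, ← tsum_mul_left]
    simp only [add_zero, pow_zero, mul_one]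
    congr 1
    refine tsum_congr fun m => ?_
    rw [pow_succ, show i + (m + 1) = i + 1 + m by ring]
    ring
  refine ⟨PowerSeries.mk fun i => ∑' m, PowerSeries.coeff (i + 1 + m) f * x ^ m, ?_, ?_⟩
  · ext i
    rw [sub_mul, map_sub, PowerSeries.coeff_C_mul, PowerSeries.coeff_mk]
    rcases i with _ | i
    · have := hrec 0
      simp only [zero_add] at this
      rw [show ∑' m, PowerSeries.coeff m f * x ^ m = 0 from h0] at this
      rw [PowerSeries.coeff_zero_X_mul]
      simp only [zero_add] at this ⊢
      linear_combination -this
    · rw [PowerSeries.coeff_succ_X_mul, PowerSeries.coeff_mk]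
      linear_combination -(hrec (i + 1))
  · intro i
    rw [PowerSeries.coeff_mk, ← le_div_iff₀ (pow_pos hρ i)]
    refine IsUltrametricDist.norm_tsum_le_of_forall_le_of_nonneg
      (by have := hf.nonneg; positivity) fun m => ?_
    rw [norm_mul, norm_pow]
    calc ‖PowerSeries.coeff (i + 1 + m) f‖ * ‖x‖ ^ m
        ≤ C / ρ ^ (i + 1 + m) * ρ ^ m :=
          mul_le_mul (hf.coeff_le hρ _) (pow_le_pow_left₀ (norm_nonneg x) hx.le m)
            (by positivity) (by have := hf.nonneg; positivity)
      _ = C / ρ / ρ ^ i := by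
          rw [pow_add, pow_add]
          field_simp

/-- Schwarz lemma: a power series bounded on a large disc and vanishing at many points is small
on the unit disc. -/
lemma GaussBound.schwarz (hf : GaussBound ρ C f) {y : ℕ → K} {N : ℕ}
    (hinj : Set.InjOn y (Set.Iio N)) (hy : ∀ i < N, ‖y i‖ < ρ)
    (h0 : ∀ i < N, evalSeries (y i) f = 0) (hρ : 1 ≤ ρ) :
    GaussBound 1 ((∏ i ∈ Finset.range N, max 1 ‖y i‖) * (C / ρ ^ N)) f := by
  have hρ0 : 0 ≤ ρ := zero_le_one.trans hρ
  have key : ∀ n ≤ N, ∃ g : PowerSeries K,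
      f = ((∏ i ∈ Finset.range n, (X - Polynomial.C (y i)) : K[X]) : PowerSeries K) * g ∧
        GaussBound ρ (C / ρ ^ n) g := by
    intro n hn
    induction n with
    | zero => exact ⟨f, by simp, by simpa using hf⟩
    | succ n ih =>
      obtain ⟨g, hg, hgb⟩ := ih (by omega)
      have hz : evalSeries (y n) g = 0 := by
        have h := h0 n (by omega)
        obtain ⟨B, hB⟩ := exists_of_polynomial hρ
          (∏ i ∈ Finset.range n, (X - Polynomial.C (y i)) : K[X])
        rw [hg, evalSeries_mul hB hgb (hy n (by omega)), evalSeries_coe, mul_eq_zero] at h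
        refine h.resolve_left ?_
        rw [Polynomial.eval_prod]
        refine Finset.prod_ne_zero_iff.2 ?_
        intro i hi
        have hi' : i < n := Finset.mem_range.1 hi
        simp only [eval_sub, eval_X, eval_C, sub_ne_zero]
        intro he
        exact hi'.ne' (hinj (Set.mem_Iio.2 (by omega)) (Set.mem_Iio.2 (by omega)) he)
      obtain ⟨g', hg', hgb'⟩ := hgb.exists_eq_X_sub_C_mul (hy n (by omega)) hz
      refine ⟨g', ?_, ?_⟩
      · rw [Finset.prod_range_succ, Polynomial.coe_mul, Polynomial.coe_sub, Polynomial.coe_X,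
          Polynomial.coe_C, mul_assoc, ← hg', ← hg]
      · rwa [pow_succ, ← div_div]
  have hprod : ∀ n, GaussBound 1 (∏ i ∈ Finset.range n, max 1 ‖y i‖)
      ((∏ i ∈ Finset.range n, (X - Polynomial.C (y i)) : K[X]) : PowerSeries K) := by
    intro n
    induction n with
    | zero => simpa using one
    | succ n ih =>
      rw [Finset.prod_range_succ, Finset.prod_range_succ, Polynomial.coe_mul, Polynomial.coe_sub,
        Polynomial.coe_X, Polynomial.coe_C]
      exact ih.mul zero_le_one (X_sub_C _)
  obtain ⟨g, hg, hgb⟩ := key N le_rfl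
  rw [hg]
  refine GaussBound.mul zero_le_one ?_ (hgb.mono_radius zero_le_one hρ)
  exact hprod N

/-- Completeness of the space of power series for the Gauss norm. -/
lemma exists_limit {F : ℕ → PowerSeries K} {ε : ℕ → ℝ} (hρ : 0 < ρ)
    (hF : ∀ N, GaussBound ρ (ε N) (F (N + 1) - F N)) (hanti : Antitone ε)
    (hε : Filter.Tendsto ε Filter.atTop (nhds 0)) :
    ∃ f : PowerSeries K, ∀ N, GaussBound ρ (ε N) (f - F N) := by
  have hMN : ∀ N k, GaussBound ρ (ε N) (F (N + k) - F N) := by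
    intro N k
    induction k with
    | zero => simpa using GaussBound.zero (hF N).nonneg
    | succ k ih =>
      have := ih.add hρ.le ((hF (N + k)).mono (hanti (Nat.le_add_right N k)))
      rwa [add_comm (F (N + k) - F N), sub_add_sub_cancel] at this
  have hlim : ∀ m, ∃ a, Filter.Tendsto (fun N => PowerSeries.coeff m (F N)) Filter.atTop
      (nhds a) := by
    intro m
    refine cauchySeq_tendsto_of_complete ?_
    refine cauchySeq_of_le_tendsto_0 (fun N => 2 * (ε N / ρ ^ m)) (fun a b N ha hb => ?_) ?_
    · obtain ⟨a, rfl⟩ := Nat.exists_eq_add_of_le ha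
      obtain ⟨b, rfl⟩ := Nat.exists_eq_add_of_le hb
      refine (dist_triangle_right _ _ (PowerSeries.coeff m (F N))).trans ?_
      rw [two_mul, dist_eq_norm, dist_eq_norm, ← map_sub, ← map_sub]
      exact add_le_add ((hMN N a).coeff_le hρ m) ((hMN N b).coeff_le hρ m)
    · simpa using (hε.div_const (ρ ^ m)).const_mul 2
  choose a ha using hlim
  refine ⟨PowerSeries.mk a, fun N m => ?_⟩
  rw [map_sub, PowerSeries.coeff_mk]
  have h1 : Filter.Tendsto (fun k => ‖PowerSeries.coeff m (F (k + N)) -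
      PowerSeries.coeff m (F N)‖ * ρ ^ m) Filter.atTop
      (nhds (‖a m - PowerSeries.coeff m (F N)‖ * ρ ^ m)) :=
    ((((ha m).comp (Filter.tendsto_add_atTop_nat N)).sub_const _).norm).mul_const _
  refine le_of_tendsto h1 (Filter.Eventually.of_forall fun k => ?_)
  rw [← map_sub, add_comm k N]
  exact hMN N k m

end Eval

end PowerSeriesBounds


section Twist

variable (Fq : Type*) [Field Fq] [Fintype Fq]

/-- The `r`-th power of the `q`-Frobenius of an `𝔽_q`-algebra. -/
noncomputable def frob {R : Type*} [CommRing R] [Algebra Fq R] (r : ℕ) : R →+* R :=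
  ((FiniteField.frobeniusAlgHom Fq R ^ r : R →ₐ[Fq] R) : R →+* R)

lemma frob_apply {R : Type*} [CommRing R] [Algebra Fq R] (r : ℕ) (x : R) :
    frob Fq r x = x ^ Fintype.card Fq ^ r := by
  unfold frob
  induction r generalizing x with
  | zero => simp
  | succ r ih =>
    have h := ih (x ^ Fintype.card Fq)
    simp only [RingHom.coe_coe] at h ⊢
    rw [pow_succ (FiniteField.frobeniusAlgHom Fq R), AlgHom.mul_apply]
    rw [FiniteField.coe_frobeniusAlgHom] 
    rw [h, ← pow_mul, ← pow_succ']

/-- Raising the coefficients of a polynomial to the `q^r`-th power. -/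
noncomputable def twP {R : Type*} [CommRing R] [Algebra Fq R] (r : ℕ) : R[X] →+* R[X] :=
  Polynomial.mapRingHom (frob Fq r)

/-- Raising the coefficients of a power series to the `q^r`-th power. -/
noncomputable def twS {R : Type*} [CommRing R] [Algebra Fq R] (r : ℕ) :
    PowerSeries R →+* PowerSeries R :=
  PowerSeries.map (frob Fq r)

variable {R : Type*} [CommRing R] [Algebra Fq R]

@[simp] lemma coeff_twP (r : ℕ) (p : R[X]) (m : ℕ) :
    (twP Fq r p).coeff m = p.coeff m ^ Fintype.card Fq ^ r := by
  simp [twP, frob_apply]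

@[simp] lemma coeff_twS (r : ℕ) (p : PowerSeries R) (m : ℕ) :
    PowerSeries.coeff m (twS Fq r p) = PowerSeries.coeff m p ^ Fintype.card Fq ^ r := by
  simp [twS, frob_apply]

lemma twP_X (r : ℕ) : twP Fq r (X : R[X]) = X := by simp [twP]

lemma twP_C (r : ℕ) (a : R) :
    twP Fq r (Polynomial.C a) = Polynomial.C (a ^ Fintype.card Fq ^ r) := by
  simp [twP, frob_apply]

lemma twP_zero_left (p : R[X]) : twP Fq 0 p = p := by ext; simp

lemma twS_zero_left (p : PowerSeries R) : twS Fq 0 p = p := by ext; simp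

lemma twP_twP (r s : ℕ) (p : R[X]) : twP Fq r (twP Fq s p) = twP Fq (r + s) p := by
  ext m
  simp [← pow_mul, pow_add, mul_comm]

lemma twS_twS (r s : ℕ) (p : PowerSeries R) : twS Fq r (twS Fq s p) = twS Fq (r + s) p := by
  ext m
  simp [← pow_mul, pow_add, mul_comm]

lemma natDegree_twP_le (r : ℕ) (p : R[X]) : (twP Fq r p).natDegree ≤ p.natDegree :=
  Polynomial.natDegree_map_le

lemma eval_twP (r : ℕ) (p : R[X]) (x : R) :
    (twP Fq r p).eval (x ^ Fintype.card Fq ^ r) = p.eval x ^ Fintype.card Fq ^ r := by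
  rw [← frob_apply Fq r x, ← frob_apply Fq r (p.eval x), twP, Polynomial.coe_mapRingHom,
    Polynomial.eval_map, Polynomial.eval₂_hom]

/-- The inclusion of polynomials over `R` into power series over an `R`-algebra. -/
noncomputable def toS {R K : Type*} [CommRing R] [CommRing K] (φ : R →+* K) :
    R[X] →+* PowerSeries K :=
  Polynomial.coeToPowerSeries.ringHom.comp (Polynomial.mapRingHom φ)

lemma toS_apply {R K : Type*} [CommRing R] [CommRing K] (φ : R →+* K) (p : R[X]) :
    toS φ p = ((p.map φ : K[X]) : PowerSeries K) := rfl

@[simp] lemma coeff_toS {R K : Type*} [CommRing R] [CommRing K] (φ : R →+* K) (p : R[X]) (m : ℕ) :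
    PowerSeries.coeff m (toS φ p) = φ (p.coeff m) := by
  simp [toS_apply]

lemma twS_toS {K : Type*} [CommRing K] [Algebra Fq K] (φ : R →+* K) (r : ℕ) (p : R[X]) :
    twS Fq r (toS φ p) = toS φ (twP Fq r p) := by
  ext m
  simp

variable {K : Type*} [NormedField K] [Algebra Fq K] {ρ C : ℝ} {f : PowerSeries K}

lemma card_pow_ne_zero (r : ℕ) : Fintype.card Fq ^ r ≠ 0 :=
  pow_ne_zero _ Fintype.card_ne_zero

lemma GaussBound.twS (hρ : 0 ≤ ρ) (hf : GaussBound ρ C f) (r : ℕ) :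
    GaussBound (ρ ^ Fintype.card Fq ^ r) (C ^ Fintype.card Fq ^ r) (twS Fq r f) := fun m => by
  rw [coeff_twS, norm_pow, ← pow_mul, mul_comm _ m, pow_mul, ← mul_pow]
  exact pow_le_pow_left₀ (by positivity) (hf m) _

variable [CompleteSpace K] [IsUltrametricDist K]

lemma evalSeries_twS (hf : GaussBound ρ C f) {x : K} (hx : ‖x‖ < ρ) (r : ℕ) :
    evalSeries (x ^ Fintype.card Fq ^ r) (DoubleZeta.twS Fq r f) =
      evalSeries x f ^ Fintype.card Fq ^ r := by
  unfold evalSeries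
  have hcont : Continuous (frob Fq r : K →+* K) := by
    have : (⇑(frob Fq r : K →+* K)) = fun x => x ^ Fintype.card Fq ^ r :=
      funext fun x => frob_apply Fq r x
    rw [this]
    exact continuous_pow _
  have := ((hf.summable hx).hasSum.map (frob Fq r : K →+* K) hcont).tsum_eq
  rw [← frob_apply Fq r (∑' m, PowerSeries.coeff m f * x ^ m), ← this]
  refine tsum_congr fun m => ?_
  simp only [Function.comp_apply, frob_apply, coeff_twS, mul_pow]
  rw [← pow_mul, ← pow_mul, mul_comm m]

lemma evalSeries_toS {R : Type*} [CommRing R] (φ : R →+* K) (p : R[X]) (x : R) :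
    evalSeries (φ x) (toS φ p) = φ (p.eval x) := by
  rw [toS_apply, evalSeries_coe, Polynomial.eval_map, Polynomial.eval₂_hom]

end Twist

section CoeffDegree

variable {Fq : Type*} [Field Fq]

/-- `CoeffDeg g p` says that the coefficients of `p ∈ 𝔽_q[θ][t]` have `θ`-degree at most `g`. -/
def CoeffDeg (g : ℕ) (p : Fq[X][X]) : Prop := ∀ m, (p.coeff m).natDegree ≤ g

namespace CoeffDeg

variable {g g' : ℕ} {p p' : Fq[X][X]}

lemma mono (h : CoeffDeg g p) (hg : g ≤ g') : CoeffDeg g' p := fun m => (h m).trans hg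

lemma zero : CoeffDeg g (0 : Fq[X][X]) := fun m => by simp

lemma one : CoeffDeg g (1 : Fq[X][X]) := fun m => by
  rw [Polynomial.coeff_one]
  split_ifs <;> simp

lemma neg (h : CoeffDeg g p) : CoeffDeg g (-p) := fun m => by simpa using h m

lemma add (h : CoeffDeg g p) (h' : CoeffDeg g p') : CoeffDeg g (p + p') := fun m => by
  rw [Polynomial.coeff_add]
  exact (Polynomial.natDegree_add_le _ _).trans (max_le (h m) (h' m))

lemma sum {ι : Type*} {s : Finset ι} {F : ι → Fq[X][X]} (h : ∀ i ∈ s, CoeffDeg g (F i)) :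
    CoeffDeg g (∑ i ∈ s, F i) := fun m => by
  rw [Polynomial.finsetSum_coeff]
  exact Polynomial.natDegree_sum_le_of_forall_le _ _ fun i hi => h i hi m

lemma mul (h : CoeffDeg g p) (h' : CoeffDeg g' p') : CoeffDeg (g + g') (p * p') := fun m => by
  rw [Polynomial.coeff_mul]
  exact Polynomial.natDegree_sum_le_of_forall_le _ _ fun i _ =>
    Polynomial.natDegree_mul_le.trans (add_le_add (h _) (h' _))

lemma prod {ι : Type*} {s : Finset ι} {F : ι → Fq[X][X]} (h : ∀ i ∈ s, CoeffDeg g (F i)) :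
    CoeffDeg (s.card * g) (∏ i ∈ s, F i) := by
  classical
  induction s using Finset.induction_on with
  | empty => simpa using one
  | insert a s ha ih =>
    rw [Finset.prod_insert ha, Finset.card_insert_of_notMem ha, add_mul, one_mul, add_comm]
    exact (h a (Finset.mem_insert_self a s)).mul
      (ih fun i hi => h i (Finset.mem_insert_of_mem hi))

lemma exists_bound {ι : Type*} [Finite ι] (F : ι → Fq[X][X]) : ∃ g, ∀ i, CoeffDeg g (F i) := by
  cases nonempty_fintype ι
  refine ⟨∑ i, ∑ m ∈ (F i).support, ((F i).coeff m).natDegree, fun i m => ?_⟩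
  by_cases hm : m ∈ (F i).support
  · exact (Finset.single_le_sum (f := fun m => ((F i).coeff m).natDegree)
      (fun _ _ => Nat.zero_le _) hm).trans
      (Finset.single_le_sum (f := fun i => ∑ m ∈ (F i).support, ((F i).coeff m).natDegree)
        (fun _ _ => Nat.zero_le _) (Finset.mem_univ i))
  · rw [Polynomial.notMem_support_iff.1 hm]
    simp

lemma twP [Fintype Fq] (h : CoeffDeg g p) (r : ℕ) :
    CoeffDeg (Fintype.card Fq ^ r * g) (twP Fq r p) := fun m => by
  rw [coeff_twP]
  exact Polynomial.natDegree_pow_le.trans (Nat.mul_le_mul_left _ (h m))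

lemma natDegree_eval_le (h : CoeffDeg g p) {d : ℕ} (hd : p.natDegree ≤ d) (x : Fq[X]) :
    (p.eval x).natDegree ≤ g + d * x.natDegree := by
  rw [Polynomial.eval_eq_sum_range]
  refine Polynomial.natDegree_sum_le_of_forall_le _ _ fun i hi => ?_
  refine Polynomial.natDegree_mul_le.trans (add_le_add (h i) ?_)
  refine Polynomial.natDegree_pow_le.trans (Nat.mul_le_mul_right _ ?_)
  exact (Nat.lt_succ_iff.1 (Finset.mem_range.1 hi)).trans hd

lemma det {I : Type*} [Fintype I] [DecidableEq I] {M : Matrix I I Fq[X][X]}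
    (h : ∀ i j, CoeffDeg g (M i j)) : CoeffDeg (Fintype.card I * g) M.det := by
  rw [Matrix.det_apply]
  refine sum fun s _ => ?_
  rcases Int.units_eq_one_or (Equiv.Perm.sign s) with hs | hs
  · rw [hs, one_smul]
    exact prod fun i _ => h _ _
  · rw [hs, Units.neg_smul, one_smul]
    exact (prod fun i _ => h _ _).neg

lemma adjugate {I : Type*} [Fintype I] [DecidableEq I] {M : Matrix I I Fq[X][X]}
    (h : ∀ i j, CoeffDeg g (M i j)) (i j : I) :
    CoeffDeg (Fintype.card I * g) (M.adjugate i j) := by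
  rw [Matrix.adjugate_apply]
  refine det fun a b => ?_
  rw [Matrix.updateRow_apply]
  split_ifs
  · rw [Pi.single_apply]
    split_ifs
    · exact one
    · exact zero
  · exact h a b

lemma gaussBound [Fintype Fq] {K : Type*} [NormedField K] [IsUltrametricDist K] {φ : Fq[X] →+* K}
    (hφ : ∀ a ≠ 0, ‖φ a‖ = (Fintype.card Fq : ℝ) ^ a.natDegree) (h : CoeffDeg g p)
    {d : ℕ} (hd : p.natDegree ≤ d) {ρ : ℝ} (hρ : 1 ≤ ρ) :
    GaussBound ρ ((Fintype.card Fq : ℝ) ^ g * ρ ^ d) (toS φ p) := by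
  rw [toS_apply]
  refine GaussBound.polynomial hρ (by positivity) (Polynomial.natDegree_map_le.trans hd) fun i => ?_
  rw [Polynomial.coeff_map]
  by_cases hi : p.coeff i = 0
  · rw [hi, map_zero, norm_zero]
    positivity
  · rw [hφ _ hi]
    exact pow_le_pow_right₀ (by exact_mod_cast Fintype.card_pos) (h i)

end CoeffDeg

end CoeffDegree


section Siegel

variable {Fq : Type*} [Field Fq]

/-- A function field Siegel lemma, obtained by counting dimensions over the constant field. -/
lemma exists_ne_zero_of_card_lt {I J : Type*} [Fintype I] [Fintype J] {D h B : ℕ}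
    (Λ : J → (I → Fq[X][X]) → Fq[X]) (hlin : ∀ j, IsLinearMap Fq (Λ j))
    (hdeg : ∀ P : I → Fq[X][X], (∀ i, (P i).natDegree ≤ D) → (∀ i, CoeffDeg h (P i)) →
      ∀ j, (Λ j P).natDegree < h + B)
    (hcard : Fintype.card J * (h + B) < Fintype.card I * (D * h)) :
    ∃ P : I → Fq[X][X], P ≠ 0 ∧ (∀ i, (P i).natDegree ≤ D) ∧ (∀ i, CoeffDeg h (P i)) ∧
      ∀ j, Λ j P = 0 := by
  classical
  let par : (I × Fin D × Fin h → Fq) →ₗ[Fq] (I → Fq[X][X]) :=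
    { toFun := fun c i => ∑ d : Fin D, ∑ e : Fin h, monomial d.1 (monomial e.1 (c (i, d, e)))
      map_add' := fun c c' => by
        ext1 i
        simp [Finset.sum_add_distrib]
      map_smul' := fun a c => by
        ext1 i
        simp only [Pi.smul_apply, RingHom.id_apply, Finset.smul_sum, Polynomial.smul_monomial] }
  have hcoeff : ∀ c i m, (par c i).coeff m =
      if hm : m < D then ∑ e : Fin h, monomial e.1 (c (i, ⟨m, hm⟩, e)) else 0 := by
    intro c i m
    simp only [par, LinearMap.coe_mk, AddHom.coe_mk, Polynomial.finsetSum_coeff,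
      Polynomial.coeff_monomial]
    split_ifs with hm
    · rw [Finset.sum_eq_single ⟨m, hm⟩]
      · simp
      · intro d _ hd
        have : (d : ℕ) ≠ m := fun hh => hd (Fin.ext hh)
        simp [this]
      · simp
    · refine Finset.sum_eq_zero fun d _ => ?_
      have : (d : ℕ) ≠ m := fun hh => hm (hh ▸ d.2)
      simp [this]
  have hpD : ∀ c i, (par c i).natDegree ≤ D := fun c i => by
    rw [Polynomial.natDegree_le_iff_coeff_eq_zero]
    intro m hm
    rw [hcoeff, dif_neg (by omega)]
  have hph : ∀ c i, CoeffDeg h (par c i) := fun c i m => by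
    rw [hcoeff]
    split_ifs
    · exact Polynomial.natDegree_sum_le_of_forall_le _ _ fun e _ =>
        (Polynomial.natDegree_monomial_le _).trans e.2.le
    · simp
  let eqs : (I → Fq[X][X]) →ₗ[Fq] (J × Fin (h + B) → Fq) :=
    LinearMap.pi fun je => (Polynomial.lcoeff Fq je.2.1).comp (IsLinearMap.mk' _ (hlin je.1))
  obtain ⟨c, hc, hc0⟩ : ∃ c, (eqs.comp par) c = 0 ∧ c ≠ 0 := by
    have hlt : Module.finrank Fq (J × Fin (h + B) → Fq) <
        Module.finrank Fq (I × Fin D × Fin h → Fq) := by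
      simpa using hcard
    have := LinearMap.ker_ne_bot_of_finrank_lt (f := eqs.comp par) hlt
    obtain ⟨c, hc, hc0⟩ := Submodule.exists_mem_ne_zero_of_ne_bot this
    exact ⟨c, hc, hc0⟩
  refine ⟨par c, ?_, hpD c, hph c, fun j => ?_⟩
  · intro h0
    apply hc0
    ext ⟨i, d, e⟩
    have h1 := hcoeff c i d.1
    rw [h0, dif_pos d.2] at h1
    have h2 := congrArg (fun p : Fq[X] => p.coeff e.1) h1
    simp only [Pi.zero_apply, Polynomial.coeff_zero, Polynomial.finsetSum_coeff,
      Polynomial.coeff_monomial] at h2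
    rw [Finset.sum_eq_single e] at h2
    · simpa using h2.symm
    · intro e' _ he'
      have : (e' : ℕ) ≠ e := fun hh => he' (Fin.ext hh)
      simp [this]
    · simp
  · ext m
    rw [Polynomial.coeff_zero]
    by_cases hm : m < h + B
    · have := congrFun hc (j, ⟨m, hm⟩)
      simpa [eqs] using this
    · exact Polynomial.coeff_eq_zero_of_natDegree_lt
        ((hdeg _ (hpD c) (hph c) j).trans_le (not_lt.1 hm))

end Siegel

section IterMat

variable {Fq : Type*} [Field Fq] [Fintype Fq] {I : Type*} [Fintype I] [DecidableEq I]

/-- The product `Θ^{(r+k-1)} ⋯ Θ^{(r+1)} Θ^{(r)}` of twists of `Θ`. -/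
noncomputable def iterMat (Θ : Matrix I I Fq[X][X]) (r : ℕ) : ℕ → Matrix I I Fq[X][X]
  | 0 => 1
  | k + 1 => Θ.map (twP Fq (r + k)) * iterMat Θ r k

variable {Θ : Matrix I I Fq[X][X]}

lemma iterMat_coeffDeg {κ : ℕ} (hκ : ∀ i j, CoeffDeg κ (Θ i j)) (r k : ℕ) (i j : I) :
    CoeffDeg (κ * Fintype.card Fq ^ (r + k)) (iterMat Θ r k i j) := by
  induction k generalizing i j with
  | zero =>
    rw [iterMat, Matrix.one_apply]
    split_ifs
    · exact CoeffDeg.one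
    · exact CoeffDeg.zero
  | succ k ih =>
    rw [iterMat, Matrix.mul_apply]
    refine CoeffDeg.sum fun a _ => ?_
    refine (((hκ i a).twP (r + k)).mul (ih a j)).mono ?_
    have : 2 ≤ Fintype.card Fq := Fintype.one_lt_card
    rw [mul_comm κ, ← add_mul, mul_comm κ, ← add_assoc, pow_succ, ← mul_two]
    gcongr

lemma iterMat_natDegree_le {τ : ℕ} (hτ : ∀ i j, (Θ i j).natDegree ≤ τ) (r k : ℕ) (i j : I) :
    (iterMat Θ r k i j).natDegree ≤ τ * k := by
  induction k generalizing i j with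
  | zero =>
    rw [iterMat, Matrix.one_apply]
    split_ifs <;> simp
  | succ k ih =>
    rw [iterMat, Matrix.mul_apply]
    refine Polynomial.natDegree_sum_le_of_forall_le _ _ fun a _ => ?_
    rw [mul_add, mul_one, add_comm (τ * k)]
    exact Polynomial.natDegree_mul_le.trans
      (add_le_add ((natDegree_twP_le Fq _ _).trans (hτ i a)) (ih a j))

lemma vecMul_iterMat_eval_eq_zero {ϑ : Fq[X]} (hϑ : 0 < ϑ.natDegree)
    (hinj : ∀ (r : ℕ) (x : Fq[X]), x ≠ ϑ ^ Fintype.card Fq ^ (r + 1) → ∀ v : I → Fq[X],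
      Matrix.vecMul v (Θ.map fun p => (twP Fq r p).eval x) = 0 → v = 0)
    (r k : ℕ) (v : I → Fq[X])
    (hv : Matrix.vecMul v ((iterMat Θ r k).map fun p => p.eval (ϑ ^ Fintype.card Fq ^ r)) = 0) :
    v = 0 := by
  induction k generalizing v with
  | zero =>
    simpa [iterMat, Matrix.map_one] using hv
  | succ k ih =>
    rw [iterMat, show (fun p : Fq[X][X] => p.eval (ϑ ^ Fintype.card Fq ^ r)) =
      ⇑(Polynomial.evalRingHom (ϑ ^ Fintype.card Fq ^ r)) from rfl, Matrix.map_mul,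
      ← Matrix.vecMul_vecMul] at hv
    have h1 := ih _ hv
    rw [Matrix.map_map] at h1
    refine hinj (r + k) (ϑ ^ Fintype.card Fq ^ r) (fun h => ?_) v h1
    have h2 := congrArg Polynomial.natDegree h
    rw [Polynomial.natDegree_pow, Polynomial.natDegree_pow] at h2
    have h3 := Nat.pow_right_injective (Fintype.one_lt_card (α := Fq))
      (Nat.eq_of_mul_eq_mul_right hϑ h2)
    omega

lemma twS_eq_iterMat {K : Type*} [CommRing K] [Algebra Fq K] {φ : Fq[X] →+* K}
    {ψ : I → PowerSeries K} (hrel : ∀ i, twS Fq 1 (ψ i) = ∑ j, toS φ (Θ i j) * ψ j)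
    (r k : ℕ) (i : I) :
    twS Fq (r + k) (ψ i) = ∑ j, toS φ (iterMat Θ r k i j) * twS Fq r (ψ j) := by
  induction k generalizing i with
  | zero =>
    rw [Finset.sum_eq_single i]
    · simp [iterMat]
    · intro j _ hj
      simp [iterMat, Matrix.one_apply_ne hj.symm]
    · simp
  | succ k ih =>
    rw [← add_assoc, ← twS_twS, hrel, map_sum]
    simp only [map_mul, twS_toS, iterMat, Matrix.mul_apply, Matrix.map_apply, map_sum]
    simp only [ih, Finset.mul_sum, Finset.sum_mul]
    rw [Finset.sum_comm]
    simp only [mul_assoc]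

end IterMat


lemma exists_stable_of_not_linearIndependent {F V : Type*} [Field F] [AddCommGroup V] [Module F V]
    [Module.Finite F V] {σ : F →+* F} (T : V →ₛₗ[σ] V) (v : V) (hv : v ≠ 0)
    (h : ¬ LinearIndependent F fun a : Fin (Module.finrank F V) => T^[a.1] v) :
    ∃ W : Submodule F V, W ≠ ⊤ ∧ v ∈ W ∧ ∀ x ∈ W, T x ∈ W := by
  classical
  have hex : ∃ n, ¬ LinearIndependent F fun a : Fin n => T^[a.1] v := ⟨_, h⟩
  have hspec := Nat.find_spec hex
  have hmin := fun m => Nat.find_min hex (m := m)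
  have hle : Nat.find hex ≤ Module.finrank F V := Nat.find_min' hex h
  generalize Nat.find hex = n at hspec hmin hle
  rcases n with _ | n
  · exact absurd (linearIndependent_empty_type) hspec
  have hn := not_not.1 (hmin n (Nat.lt_succ_self n))
  rw [linearIndependent_finSucc'] at hspec
  have hmem : T^[n] v ∈ Submodule.span F (Set.range fun a : Fin n => T^[a.1] v) := by
    by_contra hcon
    exact hspec ⟨hn, hcon⟩
  refine ⟨Submodule.span F (Set.range fun a : Fin n => T^[a.1] v), ?_, ?_, ?_⟩
  · intro htop
    have h1 := finrank_range_le_card (R := F) fun a : Fin n => T^[a.1] v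
    rw [Set.finrank, htop, finrank_top, Fintype.card_fin] at h1
    omega
  · rcases n with _ | n
    · simp at hmem
      exact absurd hmem hv
    · exact Submodule.subset_span ⟨0, rfl⟩
  · intro x hx
    induction hx using Submodule.span_induction with
    | mem x hx =>
      obtain ⟨a, rfl⟩ := hx
      change T (T^[a.1] v) ∈ _
      rw [← Function.iterate_succ_apply' T]
      by_cases ha : a.1 + 1 < n
      · exact Submodule.subset_span ⟨⟨a.1 + 1, ha⟩, rfl⟩
      · have : a.1 + 1 = n := by omega
        rw [Nat.succ_eq_add_one, this]
        exact hmem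
    | zero => simp
    | add x y _ _ hx hy => rw [map_add]; exact Submodule.add_mem _ hx hy
    | smul c x _ hx => rw [LinearMap.map_smulₛₗ]; exact Submodule.smul_mem _ _ hx

/-- The semilinear map `x ↦ x^σ M` on row vectors. -/
def semiMap {F I : Type*} [Field F] [Fintype I] (σ : F →+* F) (M : Matrix I I F) :
    (I → F) →ₛₗ[σ] (I → F) where
  toFun x := Matrix.vecMul (fun a => σ (x a)) M
  map_add' x y := by
    rw [← Matrix.add_vecMul]
    congr 1
    ext
    simp
  map_smul' c x := by
    rw [← Matrix.smul_vecMul]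
    congr 1
    ext
    simp

/-- If `det · f` has small coefficients, with `det` integral and nonzero, then so does the
leading coefficient of `f`. -/
lemma eq_zero_of_gaussBound_mul {Fq : Type*} [Field Fq] [Fintype Fq] {K : Type*} [NormedField K]
    {φ : Fq[X] →+* K} (hφ : ∀ a ≠ 0, ‖φ a‖ = (Fintype.card Fq : ℝ) ^ a.natDegree)
    {δ : Fq[X][X]} {f : PowerSeries K} {ε : ℝ} {m : ℕ}
    (hm : ∀ i < m, PowerSeries.coeff i f = 0)
    (hε : ε < ‖PowerSeries.coeff m f‖) (h : GaussBound 1 ε (toS φ δ * f)) : δ = 0 := by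
  by_contra hδ
  set d := δ.natTrailingDegree
  have h1 : PowerSeries.coeff (d + m) (toS φ δ * f) = φ (δ.coeff d) * PowerSeries.coeff m f := by
    rw [PowerSeries.coeff_mul, Finset.sum_eq_single (d, m)]
    · simp
    · rintro ⟨a, b⟩ hab hne
      rw [Finset.HasAntidiagonal.mem_antidiagonal] at hab
      simp only at hab ⊢
      by_cases ha : a < d
      · rw [coeff_toS, Polynomial.coeff_eq_zero_of_lt_natTrailingDegree ha, map_zero, zero_mul]
      · have hb : b < m := by
          rcases lt_or_eq_of_le (show b ≤ m by omega) with hb | hb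
          · exact hb
          · exact absurd (Prod.ext (by simp only; omega) hb) hne
        rw [hm b hb, mul_zero]
    · intro hh
      exact absurd (by simp) hh
  have h2 := h (d + m)
  have hd : δ.coeff d ≠ 0 := Polynomial.trailingCoeff_nonzero_iff_nonzero.2 hδ
  rw [h1, norm_mul, one_pow, mul_one, hφ _ hd] at h2
  have h3 : (1 : ℝ) ≤ (Fintype.card Fq : ℝ) ^ (δ.coeff d).natDegree :=
    one_le_pow₀ (by exact_mod_cast Fintype.card_pos)
  nlinarith [norm_nonneg (PowerSeries.coeff m f)]


section Auxiliary

variable {Fq : Type*} [Field Fq] [Fintype Fq] {K : Type*} [NormedField K] [CompleteSpace K]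
  [IsUltrametricDist K] [Algebra Fq K] {φ : Fq[X] →+* K}
  {I : Type*} [Fintype I] [DecidableEq I] {Θ : Matrix I I Fq[X][X]} {ψ : I → PowerSeries K}

lemma sum_card_pow_le (N : ℕ) :
    ∑ r ∈ Finset.range N, Fintype.card Fq ^ r ≤ Fintype.card Fq ^ N := by
  have : 2 ≤ Fintype.card Fq := Fintype.one_lt_card
  induction N with
  | zero => simp
  | succ N ih =>
    rw [Finset.sum_range_succ, pow_succ]
    nlinarith [pow_pos (Fintype.card_pos (α := Fq)) N]

lemma exists_vanishing_form (i0 : I) {ϑ : Fq[X]} (hϑ : 0 < ϑ.natDegree)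
    (hinj : ∀ (r : ℕ) (x : Fq[X]), x ≠ ϑ ^ Fintype.card Fq ^ (r + 1) → ∀ v : I → Fq[X],
      Matrix.vecMul v (Θ.map fun p => (twP Fq r p).eval x) = 0 → v = 0)
    {κ τ B : ℕ} (hκ : ∀ i j, CoeffDeg κ (Θ i j)) (hτ : ∀ i j, (Θ i j).natDegree ≤ τ)
    (hB : 1 + κ + ϑ.natDegree * (1 + 2 * τ) = B)
    {l D N M h : ℕ} (hl : Fintype.card I = l + 1) (D' : ℕ) (hD' : 0 < D')
    (hD : D = (2 * l + 1) * D') (hN : N = 2 * (l + 1) * D') (hM : M = 2 * N)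
    (hh : h = 2 * (l + 1) * (B * Fintype.card Fq ^ M)) :
    ∃ P : I → Fq[X][X], P ≠ 0 ∧ (∀ i, (P i).natDegree ≤ D) ∧ (∀ i, CoeffDeg h (P i)) ∧
      (∀ r < N, ∀ c ≠ i0,
        (∑ a, P a * iterMat Θ r (M - r) a c).eval (ϑ ^ Fintype.card Fq ^ r) = 0) ∧
      ∃ r < N, (∑ a, P a * iterMat Θ r (M - r) a i0).eval (ϑ ^ Fintype.card Fq ^ r) ≠ 0 := by
  set q := Fintype.card Fq with hq
  have hq2 : 2 ≤ q := Fintype.one_lt_card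
  have hqpos : ∀ n, 0 < q ^ n := fun n => pow_pos (by omega) n
  obtain ⟨P, hP0, hPD, hPh, hPΛ⟩ := exists_ne_zero_of_card_lt (I := I)
    (J := Fin N × {c : I // c ≠ i0}) (D := D) (h := h) (B := B * q ^ M)
    (fun j P => (∑ a, P a * iterMat Θ j.1 (M - j.1) a j.2).eval (ϑ ^ q ^ j.1.1))
    (fun j => ⟨fun P P' => by simp [add_mul, Finset.sum_add_distrib],
      fun c P => by simp [← Finset.smul_sum]⟩)
    (fun P hPD hPh j => by
      obtain ⟨⟨r, hr⟩, c, hc⟩ := j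
      have hcd : CoeffDeg (h + κ * q ^ M) (∑ a, P a * iterMat Θ r (M - r) a c) :=
        CoeffDeg.sum fun a _ => (hPh a).mul (by
          have := iterMat_coeffDeg hκ r (M - r) a c
          rwa [Nat.add_sub_cancel' (by omega)] at this)
      have hnd : (∑ a, P a * iterMat Θ r (M - r) a c).natDegree ≤ (1 + 2 * τ) * N :=
        Polynomial.natDegree_sum_le_of_forall_le _ _ fun a _ => by
          refine Polynomial.natDegree_mul_le.trans ((add_le_add (hPD a)
            (iterMat_natDegree_le hτ r (M - r) a c)).trans ?_)
          have h1 : D ≤ N := by rw [hD, hN]; gcongr; omega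
          have h2 : τ * (M - r) ≤ τ * (2 * N) := by gcongr; omega
          nlinarith
      have h3 := hcd.natDegree_eval_le hnd (ϑ ^ q ^ r)
      simp only
      refine h3.trans_lt ?_
      rw [Polynomial.natDegree_pow]
      have h4 : N * q ^ r ≤ q ^ M := by
        rw [hM, two_mul, pow_add]
        exact Nat.mul_le_mul (Nat.lt_pow_self (by omega)).le
          (Nat.pow_le_pow_right (by omega) hr.le)
      have h5 : (1 + 2 * τ) * N * (q ^ r * ϑ.natDegree) ≤ ϑ.natDegree * (1 + 2 * τ) * q ^ M := by
        calc (1 + 2 * τ) * N * (q ^ r * ϑ.natDegree)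
            = ϑ.natDegree * (1 + 2 * τ) * (N * q ^ r) := by ring
          _ ≤ _ := by gcongr
      rw [← hB]
      have h6 := hqpos M
      nlinarith)
    (by
      have hcJ : Fintype.card (Fin N × {c : I // c ≠ i0}) = N * l := by
        rw [Fintype.card_prod, Fintype.card_fin, Fintype.card_subtype_compl, hl]
        simp
      rw [hcJ, hl, hh, hD, hN]
      have hBq : 0 < B * q ^ M := Nat.mul_pos (by omega) (hqpos M)
      generalize B * q ^ M = b at hBq
      have : (l + 1) * ((2 * l + 1) * D' * (2 * (l + 1) * b)) =
        2 * (l + 1) * D' * l * (2 * (l + 1) * b + b) + 2 * (l + 1) * D' * b := by ring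
      rw [this]
      have : 0 < 2 * (l + 1) * D' * b := by positivity
      omega)
  have hoff : ∀ r < N, ∀ c ≠ i0,
      (∑ a, P a * iterMat Θ r (M - r) a c).eval (ϑ ^ q ^ r) = 0 :=
    fun r hr c hc => hPΛ (⟨r, hr⟩, ⟨c, hc⟩)
  refine ⟨P, hP0, hPD, hPh, hoff, ?_⟩
  by_contra hcon
  push Not at hcon
  apply hP0
  ext1 i
  refine Polynomial.eq_zero_of_natDegree_lt_card_of_eval_eq_zero (P i)
    (f := fun r : Fin N => ϑ ^ q ^ r.1) ?_ ?_ ?_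
  · intro r r' hrr
    have h2 := congrArg Polynomial.natDegree hrr
    simp only [Polynomial.natDegree_pow] at h2
    exact Fin.ext (Nat.pow_right_injective hq2 (Nat.eq_of_mul_eq_mul_right hϑ h2))
  · intro r
    have := vecMul_iterMat_eval_eq_zero hϑ hinj r (M - r) (fun a => (P a).eval (ϑ ^ q ^ r.1)) ?_
    · exact congrFun this i
    · ext1 c
      have hsum : Matrix.vecMul (fun a => (P a).eval (ϑ ^ q ^ r.1))
          ((iterMat Θ r (M - r)).map fun p => p.eval (ϑ ^ q ^ r.1)) c =
          (∑ a, P a * iterMat Θ r (M - r) a c).eval (ϑ ^ q ^ r.1) := by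
        rw [Polynomial.eval_finsetSum]
        simp only [Polynomial.eval_mul]
        rfl
      refine hsum.trans ?_
      by_cases hc : c = i0
      · rw [hc]
        exact hcon r r.2
      · exact hoff r r.2 c hc
  · rw [Fintype.card_fin]
    refine (hPD i).trans_lt ?_
    rw [hD, hN]
    gcongr
    omega

lemma exists_small_form (hφ : ∀ a ≠ 0, ‖φ a‖ = (Fintype.card Fq : ℝ) ^ a.natDegree)
    (i0 : I) {ϑ : Fq[X]} (hϑ : 0 < ϑ.natDegree) {ρ C : ℝ} (hψ : ∀ i, GaussBound ρ C (ψ i))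
    (hρ : ‖φ ϑ‖ < ρ) (hrel : ∀ i, twS Fq 1 (ψ i) = ∑ j, toS φ (Θ i j) * ψ j)
    (h0 : evalSeries (φ ϑ) (ψ i0) = 0)
    (hinj : ∀ (r : ℕ) (x : Fq[X]), x ≠ ϑ ^ Fintype.card Fq ^ (r + 1) → ∀ v : I → Fq[X],
      Matrix.vecMul v (Θ.map fun p => (twP Fq r p).eval x) = 0 → v = 0)
    {κ : ℕ} (hκ : ∀ i j, CoeffDeg κ (Θ i j)) :
    ∃ (g : ℕ) (C' : ℝ), 0 < C' ∧ ∀ D' > 0, ∃ (M r : ℕ) (G : I → Fq[X][X]), r ≤ M ∧ G i0 ≠ 0 ∧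
      (∀ i, CoeffDeg (g * Fintype.card Fq ^ M) (G i)) ∧
      GaussBound 1 ((C' / ρ ^ D') ^ Fintype.card Fq ^ M) (∑ i, toS φ (G i) * twS Fq r (ψ i)) := by
  have : Nonempty I := ⟨i0⟩
  obtain ⟨l, hl⟩ : ∃ l, Fintype.card I = l + 1 :=
    Nat.exists_eq_succ_of_ne_zero Fintype.card_ne_zero
  set q := Fintype.card Fq with hq
  have hq2 : 2 ≤ q := Fintype.one_lt_card
  have hq1 : (1 : ℝ) ≤ q := by exact_mod_cast (by omega : 1 ≤ q)
  have hϑ0 : ϑ ≠ 0 := fun h => by simp [h] at hϑ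
  have hQ1 : 1 ≤ ‖φ ϑ‖ := by rw [hφ _ hϑ0]; exact one_le_pow₀ hq1
  have hρ1 : 1 ≤ ρ := hQ1.trans hρ.le
  set τ := Finset.univ.sup fun p : I × I => (Θ p.1 p.2).natDegree
  have hτ : ∀ i j, (Θ i j).natDegree ≤ τ := fun i j =>
    Finset.le_sup (f := fun p : I × I => (Θ p.1 p.2).natDegree) (Finset.mem_univ (i, j))
  set C₁ := max 1 C
  have hC₁ : 0 < C₁ := zero_lt_one.trans_le (le_max_left 1 C)
  have hψ' : ∀ i, GaussBound ρ C₁ (ψ i) := fun i => (hψ i).mono (le_max_right 1 C)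
  set B := 1 + κ + ϑ.natDegree * (1 + 2 * τ) with hB
  refine ⟨2 * (l + 1) * B + κ, ‖φ ϑ‖ * (q : ℝ) ^ (2 * (l + 1) * B) * C₁, by positivity,
    fun D' hD' => ?_⟩
  set D := (2 * l + 1) * D' with hD
  set N := 2 * (l + 1) * D' with hN
  set M := 2 * N with hM
  set h := 2 * (l + 1) * (B * q ^ M) with hh
  obtain ⟨P, hP0, hPD, hPh, hoff, r, hr, hrne⟩ :=
    exists_vanishing_form i0 hϑ hinj hκ hτ hB.symm hl D' hD' hD hN hM hh
  set G : ℕ → I → Fq[X][X] := fun r c => ∑ a, P a * iterMat Θ r (M - r) a c with hG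
  have hE : ∀ r ≤ M, ∑ i, toS φ (P i) * twS Fq M (ψ i) = ∑ c, toS φ (G r c) * twS Fq r (ψ c) := by
    intro r hrM
    have h1 := twS_eq_iterMat hrel r (M - r)
    rw [Nat.add_sub_cancel' hrM] at h1
    simp only [h1, hG, map_sum, map_mul, Finset.mul_sum, Finset.sum_mul]
    rw [Finset.sum_comm]
    simp only [mul_assoc]
  refine ⟨M, r, G r, by omega, ?_, fun c => ?_, ?_⟩
  · intro h
    apply hrne
    change (G r i0).eval _ = 0
    rw [h, Polynomial.eval_zero]
  · have : (2 * (l + 1) * B + κ) * q ^ M = h + κ * q ^ M := by rw [hh]; ring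
    rw [this]
    refine CoeffDeg.sum fun a _ => (hPh a).mul ?_
    have := iterMat_coeffDeg hκ r (M - r) a c
    rwa [Nat.add_sub_cancel' (by omega)] at this
  rw [← hE r (by omega)]
  have hR1 : 1 ≤ ρ ^ q ^ M := one_le_pow₀ hρ1
  have hEb : GaussBound (ρ ^ q ^ M) ((q : ℝ) ^ h * (ρ ^ q ^ M) ^ D * C₁ ^ q ^ M)
      (∑ i, toS φ (P i) * twS Fq M (ψ i)) :=
    GaussBound.sum (by positivity) (by positivity) fun i _ =>
      ((hPh i).gaussBound hφ (hPD i) hR1).mul (by positivity)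
        ((hψ' i).twS Fq (by positivity) M)
  have hlt : ∀ i ≤ M, ‖φ ϑ ^ q ^ i‖ < ρ ^ q ^ i := fun i _ => by
    rw [norm_pow]
    exact pow_lt_pow_left₀ hρ (norm_nonneg _) (pow_ne_zero _ (by omega))
  have hmonoρ : ∀ i ≤ M, ρ ^ q ^ i ≤ ρ ^ q ^ M := fun i hi =>
    pow_le_pow_right₀ hρ1 (Nat.pow_le_pow_right (by omega) hi)
  have hsch := hEb.schwarz (y := fun i => φ ϑ ^ q ^ i) (N := N) ?_ ?_ ?_ hR1
  · refine hsch.mono ?_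
    have h1 : ∏ i ∈ Finset.range N, max 1 ‖φ ϑ ^ q ^ i‖ ≤ ‖φ ϑ‖ ^ q ^ M := by
      calc ∏ i ∈ Finset.range N, max 1 ‖φ ϑ ^ q ^ i‖
          = ∏ i ∈ Finset.range N, ‖φ ϑ‖ ^ q ^ i := by
            refine Finset.prod_congr rfl fun i _ => ?_
            rw [norm_pow, max_eq_right (one_le_pow₀ hQ1)]
        _ = ‖φ ϑ‖ ^ ∑ i ∈ Finset.range N, q ^ i := Finset.prod_pow_eq_pow_sum _ _ _
        _ ≤ ‖φ ϑ‖ ^ q ^ M := pow_le_pow_right₀ hQ1 ((sum_card_pow_le N).trans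
            (Nat.pow_le_pow_right (by omega) (by omega)))
    refine (mul_le_mul_of_nonneg_right h1 (by positivity)).trans (le_of_eq ?_)
    have h2 : (ρ ^ q ^ M) ^ N = (ρ ^ q ^ M) ^ D * (ρ ^ D') ^ q ^ M := by
      rw [← pow_mul ρ D', mul_comm D', pow_mul ρ, ← pow_add]
      congr 1
      rw [hD, hN]
      ring
    have h3 : (q : ℝ) ^ h = ((q : ℝ) ^ (2 * (l + 1) * B)) ^ q ^ M := by
      rw [← pow_mul, hh]
      congr 1
      ring
    have hρ0 : ρ ≠ 0 := by positivity
    rw [h2, h3, div_pow, mul_pow, mul_pow]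
    field_simp
  · intro i _ j _ hij
    simp only at hij
    rw [← map_pow, ← map_pow] at hij
    have h2 := congrArg norm hij
    rw [hφ _ (pow_ne_zero _ hϑ0), hφ _ (pow_ne_zero _ hϑ0)] at h2
    have h3 := pow_right_injective₀ (a := (q : ℝ)) (by positivity)
      (by exact_mod_cast (by omega : q ≠ 1)) h2
    rw [Polynomial.natDegree_pow, Polynomial.natDegree_pow] at h3
    exact Nat.pow_right_injective hq2 (Nat.eq_of_mul_eq_mul_right hϑ h3)
  · intro i hi
    exact (hlt i (by omega)).trans_le (hmonoρ i (by omega))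
  · intro i hi
    rw [hE i (by omega)]
    have hb : ∀ c, ∃ C₂, GaussBound (ρ ^ q ^ i) C₂ (toS φ (G i c)) := fun c => by
      rw [toS_apply]
      exact GaussBound.exists_of_polynomial (one_le_pow₀ hρ1) _
    choose C₂ hC₂ using hb
    have hb' : ∀ c, GaussBound (ρ ^ q ^ i) (C₁ ^ q ^ i) (twS Fq i (ψ c)) := fun c =>
      (hψ' c).twS Fq (by positivity) i
    rw [evalSeries_sum (fun c _ => (hC₂ c).mul (by positivity) (hb' c)) (hlt i (by omega))]
    refine Finset.sum_eq_zero fun c _ => ?_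
    rw [evalSeries_mul (hC₂ c) (hb' c) (hlt i (by omega))]
    by_cases hc : c = i0
    · rw [hc, evalSeries_twS Fq (hψ' i0) hρ, h0, zero_pow (pow_ne_zero _ (by omega)), mul_zero]
    · rw [← map_pow, evalSeries_toS, hG]
      simp only
      rw [hoff i hi c hc, map_zero, zero_mul]

end Auxiliary


section Stable

variable {Fq : Type*} [Field Fq] [Fintype Fq] {K : Type*} [NormedField K] [CompleteSpace K]
  [IsUltrametricDist K] [Algebra Fq K] {φ : Fq[X] →+* K}
  {I : Type*} [Fintype I] [DecidableEq I] {Θ : Matrix I I Fq[X][X]} {ψ : I → PowerSeries K}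

/-- The map `x ↦ x^{(1)} Θ^{(r)}` on row vectors over `𝔽_q[θ][t]`. -/
noncomputable def polyMap (Θ : Matrix I I Fq[X][X]) (r : ℕ) (x : I → Fq[X][X]) : I → Fq[X][X] :=
  fun j => ∑ a, twP Fq 1 (x a) * twP Fq r (Θ a j)

lemma polyMap_iterate_coeffDeg {κ g M r : ℕ} (hκ : ∀ i j, CoeffDeg κ (Θ i j)) (hr : r ≤ M)
    {G : I → Fq[X][X]} (hG : ∀ i, CoeffDeg (g * Fintype.card Fq ^ M) (G i)) (a : ℕ) (i : I) :
    CoeffDeg ((Fintype.card Fq + κ) ^ a * (g + 1) * Fintype.card Fq ^ M)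
      ((polyMap Θ r)^[a] G i) := by
  induction a generalizing i with
  | zero =>
    refine (hG i).mono ?_
    rw [pow_zero, one_mul]
    gcongr
    omega
  | succ a ih =>
    rw [Function.iterate_succ_apply']
    refine CoeffDeg.sum fun b _ => (((ih b).twP 1).mul ((hκ b i).twP r)).mono ?_
    have h1 : Fintype.card Fq ^ r ≤ Fintype.card Fq ^ M :=
      Nat.pow_le_pow_right Fintype.card_pos hr
    have h2 : 1 ≤ (Fintype.card Fq + κ) ^ a * (g + 1) :=
      Nat.mul_pos (pow_pos (Nat.add_pos_left Fintype.card_pos κ) a) (Nat.succ_pos g)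
    have h3 : Fintype.card Fq ^ r ≤
        (Fintype.card Fq + κ) ^ a * (g + 1) * Fintype.card Fq ^ M :=
      h1.trans (Nat.le_mul_of_pos_left _ h2)
    calc _ ≤ Fintype.card Fq ^ 1 * ((Fintype.card Fq + κ) ^ a * (g + 1) * Fintype.card Fq ^ M) +
          (Fintype.card Fq + κ) ^ a * (g + 1) * Fintype.card Fq ^ M * κ := by gcongr
      _ = _ := by ring

lemma polyMap_iterate_form (hrel : ∀ i, twS Fq 1 (ψ i) = ∑ j, toS φ (Θ i j) * ψ j) (r : ℕ)
    (G : I → Fq[X][X]) (a : ℕ) :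
    ∑ i, toS φ ((polyMap Θ r)^[a] G i) * twS Fq r (ψ i) =
      twS Fq a (∑ i, toS φ (G i) * twS Fq r (ψ i)) := by
  induction a with
  | zero => rw [twS_zero_left]; rfl
  | succ a ih =>
    rw [add_comm a 1, ← twS_twS, ← ih, map_sum]
    have h1 : ∀ i, twS Fq 1 (twS Fq r (ψ i)) =
        ∑ j, toS φ (twP Fq r (Θ i j)) * twS Fq r (ψ j) := fun i => by
      rw [twS_twS, add_comm 1 r, ← twS_twS, hrel, map_sum]
      simp only [map_mul, twS_toS]
    simp only [map_mul, h1, twS_toS, add_comm 1 a, Function.iterate_succ_apply', polyMap, map_sum,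
      Finset.sum_mul, Finset.mul_sum]
    rw [Finset.sum_comm]
    simp only [mul_assoc]

lemma polyMap_iterate_semiMap {F : Type*} [Field F] (j : Fq[X][X] →+* F) (σ : F →+* F)
    (hσ : ∀ p, σ (j p) = j (twP Fq 1 p)) (r : ℕ) (G : I → Fq[X][X]) (a : ℕ) :
    (semiMap σ (Θ.map fun p => j (twP Fq r p)))^[a] (fun i => j (G i)) =
      fun i => j ((polyMap Θ r)^[a] G i) := by
  induction a with
  | zero => rfl
  | succ a ih =>
    rw [Function.iterate_succ_apply', ih, Function.iterate_succ_apply']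
    ext i
    simp only [semiMap, LinearMap.coe_mk, AddHom.coe_mk, Matrix.vecMul, dotProduct, hσ,
      Matrix.map_apply, polyMap, map_sum, map_mul]

/-- The main transcendence argument: a nontrivial solution `ψ` of a Frobenius system one of whose
coordinates vanishes at `ϑ` forces a proper subspace stable under some twist of the system. -/
theorem exists_stable_subspace
    (hφ : ∀ a ≠ 0, ‖φ a‖ = (Fintype.card Fq : ℝ) ^ a.natDegree)
    {F : Type*} [Field F] (j : Fq[X][X] →+* F) (hj : Function.Injective j) (σ : F →+* F)
    (hσ : ∀ p, σ (j p) = j (twP Fq 1 p))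
    (i0 : I) {ϑ : Fq[X]} (hϑ : 0 < ϑ.natDegree) {ρ C : ℝ} (hψ : ∀ i, GaussBound ρ C (ψ i))
    (hρ : ‖φ ϑ‖ < ρ) (hrel : ∀ i, twS Fq 1 (ψ i) = ∑ j, toS φ (Θ i j) * ψ j)
    (h0 : evalSeries (φ ϑ) (ψ i0) = 0) (hne : ∃ i, ψ i ≠ 0)
    (hinj : ∀ (r : ℕ) (x : Fq[X]), x ≠ ϑ ^ Fintype.card Fq ^ (r + 1) → ∀ v : I → Fq[X],
      Matrix.vecMul v (Θ.map fun p => (twP Fq r p).eval x) = 0 → v = 0) :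
    ∃ (r : ℕ) (G : I → Fq[X][X]) (W : Submodule F (I → F)), G i0 ≠ 0 ∧ W ≠ ⊤ ∧
      (fun i => j (G i)) ∈ W ∧ ∀ x ∈ W, semiMap σ (Θ.map fun p => j (twP Fq r p)) x ∈ W := by
  obtain ⟨κ, hκ'⟩ := CoeffDeg.exists_bound fun p : I × I => Θ p.1 p.2
  have hκ : ∀ i j, CoeffDeg κ (Θ i j) := fun i j => hκ' (i, j)
  obtain ⟨g, C', hC', hform⟩ := exists_small_form hφ i0 hϑ hψ hρ hrel h0 hinj hκ
  set q := Fintype.card Fq with hq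
  have hq2 : 2 ≤ q := Fintype.one_lt_card
  have hq1 : (1 : ℝ) ≤ q := by exact_mod_cast (by omega : 1 ≤ q)
  have hϑ0 : ϑ ≠ 0 := fun h => by simp [h] at hϑ
  have hρ1 : 1 < ρ := lt_of_le_of_lt (by rw [hφ _ hϑ0]; exact one_le_pow₀ hq1) hρ
  obtain ⟨b, hb⟩ := hne
  obtain ⟨m, hm, hmlow⟩ : ∃ m, PowerSeries.coeff m (ψ b) ≠ 0 ∧
      ∀ i < m, PowerSeries.coeff i (ψ b) = 0 := by
    classical
    have hex : ∃ m, PowerSeries.coeff m (ψ b) ≠ 0 := by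
      by_contra hcon
      push Not at hcon
      exact hb (PowerSeries.ext fun n => by simpa using hcon n)
    exact ⟨Nat.find hex, Nat.find_spec hex, fun i hi => not_not.1 (Nat.find_min hex hi)⟩
  set c := min 1 ‖PowerSeries.coeff m (ψ b)‖
  have hc0 : 0 < c := lt_min zero_lt_one (norm_pos_iff.2 hm)
  have hc1 : c ≤ 1 := min_le_left _ _
  set γ := Fintype.card I * ((q + κ) ^ Fintype.card I * (g + 1)) with hγ
  obtain ⟨D', hD'pos, hD'⟩ : ∃ D' > 0, (q : ℝ) ^ γ * (C' / ρ ^ D') < c := by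
    have ht : Filter.Tendsto (fun D' : ℕ => (q : ℝ) ^ γ * (C' / ρ ^ D')) Filter.atTop (nhds 0) := by
      simpa using ((tendsto_pow_atTop_atTop_of_one_lt hρ1).const_div_atTop C').const_mul
        ((q : ℝ) ^ γ)
    obtain ⟨D', h1, h2⟩ := ((ht.eventually_lt_const hc0).and (Filter.eventually_gt_atTop 0)).exists
    exact ⟨D', h2, h1⟩
  obtain ⟨M, r, G, hrM, hGne, hGdeg, hGsmall⟩ := hform D' hD'pos
  set ε := C' / ρ ^ D'
  have hε0 : 0 ≤ ε := by positivity
  have hqγ : 1 ≤ (q : ℝ) ^ γ := one_le_pow₀ hq1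
  have hε1 : ε ≤ 1 := by nlinarith
  set e := Fintype.equivFin I
  set N : Matrix I I Fq[X][X] := Matrix.of fun i k => (polyMap Θ r)^[(e i).1] G k with hN
  have hNdeg : ∀ i k, CoeffDeg ((q + κ) ^ Fintype.card I * (g + 1) * q ^ M) (N i k) := fun i k => by
    refine (polyMap_iterate_coeffDeg hκ hrM hGdeg (e i).1 k).mono ?_
    gcongr
    · omega
    · exact (e i).2.le
  have hdet : N.det = 0 := by
    have hcr : toS φ N.det * twS Fq r (ψ b) =
        ∑ i, toS φ (N.adjugate b i) * twS Fq (e i).1 (∑ k, toS φ (G k) * twS Fq r (ψ k)) := by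
      simp only [← polyMap_iterate_form hrel]
      have h1 : ∀ k, ∑ i, N.adjugate b i * N i k = if b = k then N.det else 0 := fun k => by
        have := congrFun (congrFun (Matrix.adjugate_mul N) b) k
        rw [Matrix.mul_apply, Matrix.smul_apply, Matrix.one_apply] at this
        rw [this]
        simp
      have h2 : ∀ k, ∑ i, toS φ (N.adjugate b i) * toS φ (N i k) =
          if b = k then toS φ N.det else 0 := fun k => by
        simp only [← map_mul, ← map_sum, h1]
        split_ifs <;> simp
      calc toS φ N.det * twS Fq r (ψ b)
          = ∑ k, (∑ i, toS φ (N.adjugate b i) * toS φ (N i k)) * twS Fq r (ψ k) := by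
            simp only [h2, ite_mul, zero_mul, Finset.sum_ite_eq, Finset.mem_univ, if_true]
        _ = _ := by
            simp only [Finset.sum_mul, Finset.mul_sum]
            rw [Finset.sum_comm]
            simp only [mul_assoc]
            rfl
    refine eq_zero_of_gaussBound_mul hφ (f := twS Fq r (ψ b)) (m := m)
      (ε := ((q : ℝ) ^ γ * ε) ^ q ^ M) ?_ ?_ ?_
    · intro i hi
      rw [coeff_twS, hmlow i hi, zero_pow (card_pow_ne_zero Fq r)]
    · rw [coeff_twS, norm_pow]
      calc ((q : ℝ) ^ γ * ε) ^ q ^ M < c ^ q ^ M :=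
            pow_lt_pow_left₀ hD' (by positivity) (pow_ne_zero _ (by omega))
        _ ≤ c ^ q ^ r := pow_le_pow_of_le_one hc0.le hc1 (Nat.pow_le_pow_right (by omega) hrM)
        _ ≤ _ := pow_le_pow_left₀ hc0.le (min_le_right _ _) _
    · rw [hcr]
      refine GaussBound.sum zero_le_one (by positivity) fun i _ => ?_
      have h1 := (CoeffDeg.adjugate hNdeg b i).gaussBound hφ le_rfl le_rfl
      have h2 := hGsmall.twS Fq zero_le_one (e i).1
      rw [one_pow] at h2
      refine (h1.mul zero_le_one h2).mono ?_
      rw [one_pow, mul_one, mul_pow, ← pow_mul, ← pow_mul, ← mul_assoc (Fintype.card I), ← hγ]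
      refine mul_le_mul_of_nonneg_left ?_ (by positivity)
      exact pow_le_pow_of_le_one hε0 hε1
        (Nat.le_mul_of_pos_right _ (pow_pos (by omega) _))
  obtain ⟨W, hW, hGW, hstab⟩ := exists_stable_of_not_linearIndependent
    (semiMap σ (Θ.map fun p => j (twP Fq r p))) (fun i => j (G i))
    (fun h => hGne (hj (by rw [map_zero]; exact congrFun h i0))) (by
      intro hli
      rw [Module.finrank_fintype_fun_eq_card] at hli
      have h1 : LinearIndependent F (N.map j).row := by
        have h2 := hli.comp e e.injective
        simp only [polyMap_iterate_semiMap j σ hσ] at h2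
        exact h2
      rw [Matrix.linearIndependent_rows_iff_isUnit, Matrix.isUnit_iff_isUnit_det] at h1
      have h3 : (N.map j).det = j N.det := (RingHom.map_det j N).symm
      rw [h3, hdet, map_zero] at h1
      exact not_isUnit_zero h1)
  exact ⟨r, G, W, hGne, hW, hGW, hstab⟩

end Stable


section Triangular

variable {R S : Type*} [CommRing R] [Fintype S] [DecidableEq S]

/-- The matrix of the Frobenius system satisfied by `(Y, (x_s)_s)`. -/
def thetaTwo (τ : R) (n : ℕ) (wt : S → ℕ) (B : S → R) : Matrix (Option S) (Option S) R
  | none, none => τ ^ n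
  | none, some s => -(τ ^ n * B s)
  | some _, none => 0
  | some s, some s' => if s = s' then τ ^ wt s else 0

/-- The matrix of the Frobenius system satisfied by `(1, U, (u_s)_s)`. -/
def thetaOne (τ : R) (n : ℕ) (wt : S → ℕ) (B H : S → R) :
    Matrix (Option (Option S)) (Option (Option S)) R
  | none, none => 1
  | none, some _ => 0
  | some a, some a' => thetaTwo τ n wt B a a'
  | some none, none => τ ^ n * ∑ s, B s * H s
  | some (some s), none => -(τ ^ wt s * H s)

lemma thetaTwo_map {R' : Type*} [CommRing R'] (f : R →+* R') (τ : R) (n : ℕ) (wt : S → ℕ)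
    (B : S → R) :
    (thetaTwo τ n wt B).map f = thetaTwo (f τ) n wt fun s => f (B s) := by
  ext a b
  rcases a with _ | s <;> rcases b with _ | s' <;> simp [thetaTwo, apply_ite f]

lemma thetaOne_map {R' : Type*} [CommRing R'] (f : R →+* R') (τ : R) (n : ℕ) (wt : S → ℕ)
    (B H : S → R) :
    (thetaOne τ n wt B H).map f =
      thetaOne (f τ) n wt (fun s => f (B s)) fun s => f (H s) := by
  ext a b
  rcases a with _ | a <;> rcases b with _ | b
  · simp [thetaOne]
  · simp [thetaOne]
  · rcases a with _ | s <;> simp [thetaOne]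
  · exact congrFun (congrFun (thetaTwo_map f τ n wt B) a) b

lemma thetaTwo_vecMul_none (τ : R) (n : ℕ) (wt : S → ℕ) (B : S → R) (v : Option S → R) :
    Matrix.vecMul v (thetaTwo τ n wt B) none = v none * τ ^ n := by
  simp [Matrix.vecMul, dotProduct, Fintype.sum_option, thetaTwo]

lemma thetaTwo_vecMul_some (τ : R) (n : ℕ) (wt : S → ℕ) (B : S → R) (v : Option S → R) (s : S) :
    Matrix.vecMul v (thetaTwo τ n wt B) (some s) =
      v (some s) * τ ^ wt s - v none * (τ ^ n * B s) := by
  simp [Matrix.vecMul, dotProduct, Fintype.sum_option, thetaTwo]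
  ring

lemma thetaOne_vecMul_some (τ : R) (n : ℕ) (wt : S → ℕ) (B H : S → R)
    (v : Option (Option S) → R) (a : Option S) :
    Matrix.vecMul v (thetaOne τ n wt B H) (some a) =
      Matrix.vecMul (fun a => v (some a)) (thetaTwo τ n wt B) a := by
  simp [Matrix.vecMul, dotProduct, Fintype.sum_option, thetaOne]

lemma thetaOne_vecMul_none (τ : R) (n : ℕ) (wt : S → ℕ) (B H : S → R)
    (v : Option (Option S) → R) :
    Matrix.vecMul v (thetaOne τ n wt B H) none =
      v none + v (some none) * (τ ^ n * ∑ s, B s * H s) -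
        ∑ s, v (some (some s)) * (τ ^ wt s * H s) := by
  simp [Matrix.vecMul, dotProduct, Fintype.sum_option, thetaOne]
  ring

variable [IsDomain R]

lemma thetaTwo_vecMul_injective {τ : R} (hτ : τ ≠ 0) {n : ℕ} {wt : S → ℕ} {B : S → R}
    {v : Option S → R} (h : Matrix.vecMul v (thetaTwo τ n wt B) = 0) : v = 0 := by
  have h0 : v none = 0 := by
    have := congrFun h none
    rw [thetaTwo_vecMul_none] at this
    exact (mul_eq_zero.1 this).resolve_right (pow_ne_zero _ hτ)
  ext a
  rcases a with _ | s
  · exact h0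
  · have := congrFun h (some s)
    rw [thetaTwo_vecMul_some, h0, zero_mul, sub_zero] at this
    exact (mul_eq_zero.1 this).resolve_right (pow_ne_zero _ hτ)

lemma thetaOne_vecMul_injective {τ : R} (hτ : τ ≠ 0) {n : ℕ} {wt : S → ℕ} {B H : S → R}
    {v : Option (Option S) → R} (h : Matrix.vecMul v (thetaOne τ n wt B H) = 0) : v = 0 := by
  have h1 : (fun a => v (some a)) = 0 := by
    refine thetaTwo_vecMul_injective hτ (n := n) (wt := wt) (B := B) ?_
    ext a
    rw [← thetaOne_vecMul_some τ n wt B H v a, h]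
    rfl
  have h1' : ∀ a, v (some a) = 0 := fun a => congrFun h1 a
  ext a
  rcases a with _ | a
  · have := congrFun h none
    rw [thetaOne_vecMul_none] at this
    simpa [h1'] using this
  · exact h1' a

end Triangular

section Weights

variable {F S : Type*} [Field F] [Fintype S] [DecidableEq S]

/-- A stable subspace with nonzero projection to the top weight is everything, as soon as the
relevant extensions of weights are nontrivial. -/
lemma eq_top_of_thetaTwo_stable {σ : F →+* F} {τ : F} {n : ℕ} {wt : S → ℕ} {B : S → F}
    (hwt : Function.Injective wt) (hwtn : ∀ s, wt s < n) (hτ : τ ≠ 0)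
    (hdeg : ∀ (i j : ℕ) (f : F), i ≠ j → τ ^ i * σ f = τ ^ j * f → f = 0)
    (hbad : ∀ (s : S) (f : F), σ f ≠ τ ^ (n - wt s) * (f - B s))
    {W : Submodule F (Option S → F)} (hW : ∀ x ∈ W, semiMap σ (thetaTwo τ n wt B) x ∈ W)
    {x : Option S → F} (hx : x ∈ W) (hx0 : x none ≠ 0) : W = ⊤ := by
  classical
  have hTn : ∀ x, semiMap σ (thetaTwo τ n wt B) x none = σ (x none) * τ ^ n := fun x =>
    thetaTwo_vecMul_none τ n wt B _
  have hTs : ∀ x s, semiMap σ (thetaTwo τ n wt B) x (some s) =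
      σ (x (some s)) * τ ^ wt s - σ (x none) * (τ ^ n * B s) := fun x s =>
    thetaTwo_vecMul_some τ n wt B _ s
  obtain ⟨z, hzW, hz1⟩ : ∃ z ∈ W, z none = 1 :=
    ⟨(x none)⁻¹ • x, W.smul_mem _ hx, by simp [hx0]⟩
  obtain ⟨y, hyW, hyn, hys⟩ : ∃ y ∈ W, y none = 0 ∧ ∀ s, y (some s) ≠ 0 := by
    refine ⟨semiMap σ (thetaTwo τ n wt B) z - τ ^ n • z, W.sub_mem (hW z hzW) (W.smul_mem _ hzW),
      ?_, fun s hs => hbad s (-z (some s)) ?_⟩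
    · simp [hTn, hz1]
    · simp only [Pi.sub_apply, hTs, hz1, map_one, one_mul, Pi.smul_apply, smul_eq_mul] at hs
      have h1 : τ ^ n = τ ^ (n - wt s) * τ ^ wt s := by
        rw [← pow_add, Nat.sub_add_cancel (hwtn s).le]
      have h2 : τ ^ wt s ≠ 0 := pow_ne_zero _ hτ
      refine mul_right_cancel₀ h2 ?_
      rw [map_neg]
      rw [h1] at hs
      linear_combination -hs
  have hsingle : ∀ s : S, Pi.single (some s) (1 : F) ∈ W := by
    intro s
    have hex : ∃ m, ∃ z ∈ W, z none = 0 ∧ z (some s) = 1 ∧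
        (Finset.univ.filter fun s' : S => z (some s') ≠ 0).card = m :=
      ⟨_, (y (some s))⁻¹ • y, W.smul_mem _ hyW, by simp [hyn], by simp [hys s], rfl⟩
    obtain ⟨z, hzW, hzn, hzs, hcard⟩ := Nat.find_spec hex
    have hmin := fun m => Nat.find_min hex (m := m)
    rw [← hcard] at hmin
    have hz : z = Pi.single (some s) 1 := by
      ext a
      rcases a with _ | s'
      · simp [hzn]
      by_cases hss : s' = s
      · rw [hss, hzs]
        simp
      rw [Pi.single_eq_of_ne (by simpa using hss)]
      by_contra hne
      set v := semiMap σ (thetaTwo τ n wt B) z - τ ^ wt s • z with hv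
      have hvW : v ∈ W := W.sub_mem (hW z hzW) (W.smul_mem _ hzW)
      have hvn : v none = 0 := by simp [hv, hTn, hzn]
      have hvs : ∀ a, v (some a) = σ (z (some a)) * τ ^ wt a - τ ^ wt s * z (some a) := fun a => by
        simp [hv, hTs, hzn]
      have hvss : v (some s) = 0 := by simp [hvs, hzs]
      have hvs' : v (some s') ≠ 0 := by
        intro h0
        rw [hvs] at h0
        exact hne (hdeg (wt s') (wt s) _ (fun h => hss (hwt h)) (by linear_combination h0))
      refine hmin _ ?_ ⟨z - (z (some s') / v (some s')) • v,
        W.sub_mem hzW (W.smul_mem _ hvW), by simp [hzn, hvn], by simp [hzs, hvss], rfl⟩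
      refine Finset.card_lt_card ?_
      rw [Finset.ssubset_iff_of_subset]
      · exact ⟨s', by simp [hne], by simp [hvs']⟩
      · intro a ha
        simp only [Finset.mem_filter, Finset.mem_univ, true_and] at ha ⊢
        intro h0
        apply ha
        simp [hvs, h0]
    rw [← hz]
    exact hzW
  have hnone : Pi.single none (1 : F) ∈ W := by
    have : Pi.single none (1 : F) = z - ∑ s : S, z (some s) • Pi.single (some s) (1 : F) := by
      ext a
      rcases a with _ | s
      · simp [hz1]
      · simp [Finset.sum_apply, Pi.single_apply]
    rw [this]
    exact W.sub_mem hzW (W.sum_mem fun s _ => W.smul_mem _ (hsingle s))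
  rw [eq_top_iff]
  intro w _
  rw [pi_eq_sum_univ' w]
  refine W.sum_mem fun a _ => W.smul_mem _ ?_
  rcases a with _ | s
  · convert hnone using 1
  · convert hsingle s using 1

end Weights


section Rational

variable {Fq : Type*} [Field Fq] [Fintype Fq] {k : Type*} [Field k] [Algebra Fq k]

lemma natDegree_twP (r : ℕ) (p : k[X]) : (twP Fq r p).natDegree = p.natDegree :=
  Polynomial.natDegree_map _

lemma twP_ne_zero (r : ℕ) {p : k[X]} (hp : p ≠ 0) : twP Fq r p ≠ 0 :=
  (Polynomial.map_ne_zero_iff (frob Fq r : k →+* k).injective).2 hp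

lemma twP_fixed {p : k[X]} (hp : twP Fq 1 p = p) (r : ℕ) : twP Fq r p = p := by
  induction r with
  | zero => exact twP_zero_left Fq p
  | succ r ih => rw [← twP_twP, hp, ih]

lemma eval_ne_zero_of_twP_fixed {Q : k[X]} (hQ : Q ≠ 0) (h : twP Fq 1 Q = Q) {x : k}
    (hx : Function.Injective fun r : ℕ => x ^ Fintype.card Fq ^ r) : Q.eval x ≠ 0 := by
  intro h0
  refine hQ (Polynomial.eq_zero_of_infinite_isRoot Q
    ((Set.infinite_range_of_injective hx).mono ?_))
  rintro _ ⟨r, rfl⟩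
  change Q.eval (x ^ Fintype.card Fq ^ r) = 0
  nth_rw 1 [← twP_fixed h r]
  rw [eval_twP, h0, zero_pow (card_pow_ne_zero Fq r)]

variable {F : Type*} [Field F] [Algebra k[X] F] [IsFractionRing k[X] F] {σ : F →+* F}

lemma exists_monic_fraction (f : F) : ∃ P Q : k[X], IsCoprime P Q ∧ Q.Monic ∧
    f * algebraMap k[X] F Q = algebraMap k[X] F P := by
  obtain ⟨a, b, hab, rfl⟩ := IsFractionRing.exists_reduced_fraction (A := k[X]) f
  have hb : (b : k[X]) ≠ 0 := nonZeroDivisors.coe_ne_zero b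
  have hl : ((b : k[X]).leadingCoeff)⁻¹ ≠ 0 := inv_ne_zero (leadingCoeff_ne_zero.2 hb)
  have hu : IsUnit (C ((b : k[X]).leadingCoeff)⁻¹) := Polynomial.isUnit_C.2 hl.isUnit
  refine ⟨a * C ((b : k[X]).leadingCoeff)⁻¹, b * C ((b : k[X]).leadingCoeff)⁻¹, ?_,
    monic_mul_leadingCoeff_inv hb, ?_⟩
  · exact (isCoprime_mul_unit_right hu _ _).2 hab.isCoprime
  · rw [map_mul, ← mul_assoc, IsLocalization.mk'_spec, map_mul]

/-- A rational solution of a first order Frobenius equation has a Frobenius-fixed denominator, and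
its numerator vanishes at `ϑ`. -/
lemma exists_fraction_of_frobenius_eq
    (hσ : ∀ p, σ (algebraMap k[X] F p) = algebraMap k[X] F (twP Fq 1 p)) {ϑ : k} {i : ℕ}
    (hi : i ≠ 0) {B : k[X]} {f : F}
    (hf : σ f = algebraMap k[X] F (X - C (ϑ ^ Fintype.card Fq)) ^ i * (f - algebraMap k[X] F B)) :
    ∃ P Q : k[X], Q ≠ 0 ∧ twP Fq 1 Q = Q ∧ f * algebraMap k[X] F Q = algebraMap k[X] F P ∧
      twP Fq 1 P = (X - C (ϑ ^ Fintype.card Fq)) ^ i * (P - Q * B) ∧ P.eval ϑ = 0 := by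
  obtain ⟨P, Q, hPQ, hQ, hfPQ⟩ := exists_monic_fraction (k := k) f
  have hinj : Function.Injective (algebraMap k[X] F) := IsFractionRing.injective k[X] F
  have h1 : twP Fq 1 P * Q = (X - C (ϑ ^ Fintype.card Fq)) ^ i * (P - Q * B) * twP Fq 1 Q := by
    apply hinj
    have := congrArg σ hfPQ
    rw [map_mul, hσ, hσ] at this
    simp only [map_mul, map_sub, map_pow] at hf ⊢
    rw [← this, hf, ← hfPQ]
    ring
  have hcop : IsCoprime (twP Fq 1 P) (twP Fq 1 Q) := hPQ.map _
  have hdvd : twP Fq 1 Q ∣ Q := hcop.symm.dvd_of_dvd_mul_left ⟨_, h1.trans (mul_comm _ _)⟩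
  have hQfix : twP Fq 1 Q = Q :=
    eq_of_dvd_of_natDegree_le_of_leadingCoeff hdvd (natDegree_twP 1 Q).ge
      (((hQ.map (frob Fq 1)).leadingCoeff).trans hQ.leadingCoeff.symm)
  rw [hQfix] at h1
  have h2 := mul_right_cancel₀ hQ.ne_zero h1
  refine ⟨P, Q, hQ.ne_zero, hQfix, hfPQ, h2, ?_⟩
  have h3 := eval_twP Fq 1 P ϑ
  rw [h2, pow_one] at h3
  simp only [eval_mul, eval_pow, eval_sub, eval_X, eval_C, sub_self, zero_pow hi, zero_mul] at h3
  exact eq_zero_of_pow_eq_zero h3.symm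

lemma eq_zero_of_pow_mul_frobenius_eq
    (hσ : ∀ p, σ (algebraMap k[X] F p) = algebraMap k[X] F (twP Fq 1 p)) (c : k) {i i' : ℕ}
    (hi : i ≠ i') {f : F}
    (hf : algebraMap k[X] F (X - C c) ^ i * σ f = algebraMap k[X] F (X - C c) ^ i' * f) :
    f = 0 := by
  obtain ⟨P, Q, -, hQ, hfPQ⟩ := exists_monic_fraction (k := k) f
  have hinj : Function.Injective (algebraMap k[X] F) := IsFractionRing.injective k[X] F
  have h1 : (X - C c) ^ i * (twP Fq 1 P * Q) = (X - C c) ^ i' * (P * twP Fq 1 Q) := by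
    apply hinj
    have := congrArg σ hfPQ
    rw [map_mul, hσ, hσ] at this
    simp only [map_mul, map_sub, map_pow] at hf ⊢
    rw [← this, ← hfPQ]
    linear_combination hf * algebraMap k[X] F Q * algebraMap k[X] F (twP Fq 1 Q)
  have hQ' := hQ.ne_zero
  by_cases hP : P = 0
  · rw [hP, map_zero] at hfPQ
    exact (mul_eq_zero.1 hfPQ).resolve_right ((map_ne_zero_iff _ hinj).2 hQ')
  have h2 := congrArg natDegree h1
  have hX : ∀ i, (X - C c) ^ i ≠ 0 := fun i => pow_ne_zero _ (X_sub_C_ne_zero c)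
  rw [natDegree_mul (hX _) (mul_ne_zero (twP_ne_zero 1 hP) hQ'),
    natDegree_mul (twP_ne_zero 1 hP) hQ', natDegree_mul (hX _) (mul_ne_zero hP (twP_ne_zero 1 hQ')),
    natDegree_mul hP (twP_ne_zero 1 hQ'), natDegree_twP, natDegree_twP, natDegree_pow,
    natDegree_pow, natDegree_X_sub_C] at h2
  omega

variable {K : Type*} [NormedField K] [CompleteSpace K] [IsUltrametricDist K] [Algebra Fq K]

lemma eq_zero_of_twS_eq_mul {w : PowerSeries K} {c : K} {i : ℕ}
    (hc : ∀ y : K, y ≠ 0 → y ^ (Fintype.card Fq - 1) ≠ (-c) ^ i)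
    (hw : twS Fq 1 w = (PowerSeries.X - PowerSeries.C c) ^ i * w) : w = 0 := by
  by_contra hne
  set m := w.order.toNat with hm
  have hwm : PowerSeries.coeff m w ≠ 0 := PowerSeries.coeff_order hne
  have hdvd : ∃ v, w = PowerSeries.X ^ m * v := PowerSeries.X_pow_order_dvd
  obtain ⟨v, hv⟩ := hdvd
  have h1 := congrArg (PowerSeries.coeff m) hw
  have hv0 : PowerSeries.coeff m w = PowerSeries.constantCoeff v := by
    rw [hv, PowerSeries.coeff_X_pow_mul', if_pos le_rfl, Nat.sub_self,
      PowerSeries.coeff_zero_eq_constantCoeff_apply]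
  rw [coeff_twS, pow_one] at h1
  have h2 : PowerSeries.coeff m ((PowerSeries.X - PowerSeries.C c) ^ i * w) =
      (-c) ^ i * PowerSeries.coeff m w := by
    rw [hv0, hv, mul_left_comm, PowerSeries.coeff_X_pow_mul', if_pos le_rfl, Nat.sub_self,
      PowerSeries.coeff_zero_eq_constantCoeff_apply]
    simp
  rw [h2] at h1
  refine hc _ hwm (mul_right_cancel₀ hwm ?_)
  rw [← pow_succ, Nat.sub_add_cancel Fintype.card_pos, h1]

/-- If a Frobenius equation has a power series solution with nonzero value at `ϑ`, then it has no
rational solution. -/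
lemma frobenius_ne_of_evalSeries_ne_zero
    (hσ : ∀ p, σ (algebraMap k[X] F p) = algebraMap k[X] F (twP Fq 1 p)) (φ : k →+* K) {ϑ : k}
    (hϑ : Function.Injective fun r : ℕ => ϑ ^ Fintype.card Fq ^ r) {i : ℕ} (hi : i ≠ 0)
    (hroot : ∀ y : K, y ≠ 0 → y ^ (Fintype.card Fq - 1) ≠ (-φ (ϑ ^ Fintype.card Fq)) ^ i)
    {b H : k[X]} (hb : b ≠ 0) (hbfix : twP Fq 1 b = b) {u : PowerSeries K} {ρ M : ℝ}
    (hu : GaussBound ρ M u) (hρ : ‖φ ϑ‖ < ρ) (hρ1 : 1 ≤ ρ)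
    (hrel : twS Fq 1 u = toS φ (X - C (ϑ ^ Fintype.card Fq)) ^ i * (u - toS φ H))
    (hev : evalSeries (φ ϑ) u ≠ 0) (f : F) :
    σ f ≠ algebraMap k[X] F (X - C (ϑ ^ Fintype.card Fq)) ^ i *
      (f - algebraMap k[X] F (b * H)) := by
  intro hf
  obtain ⟨P, Q, hQ, hQfix, -, hP, hP0⟩ := exists_fraction_of_frobenius_eq hσ hi hf
  have hτ : toS φ (X - C (ϑ ^ Fintype.card Fq)) =
      PowerSeries.X - PowerSeries.C (φ (ϑ ^ Fintype.card Fq)) := by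
    simp [toS_apply]
  have hw : toS φ P - toS φ (Q * b) * u = 0 := by
    refine eq_zero_of_twS_eq_mul (Fq := Fq) hroot ?_
    rw [map_sub, map_mul, twS_toS, twS_toS, map_mul (twP Fq 1), hQfix, hbfix, hrel, hP, ← hτ]
    simp only [map_mul, map_sub, map_pow]
    ring
  obtain ⟨M₁, hM₁⟩ := GaussBound.exists_of_polynomial hρ1 ((Q * b).map φ)
  have h1 := congrArg (evalSeries (φ ϑ)) (sub_eq_zero.1 hw)
  rw [evalSeries_toS, hP0, map_zero, toS_apply, evalSeries_mul hM₁ hu hρ, ← toS_apply,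
    evalSeries_toS] at h1
  refine (mul_ne_zero ((map_ne_zero φ).2 ?_) hev) h1.symm
  exact eval_ne_zero_of_twP_fixed (Fq := Fq) (mul_ne_zero hQ hb) (by rw [map_mul, hQfix, hbfix]) hϑ

end Rational


section Descend

variable {F S : Type*} [Field F] [Fintype S] [DecidableEq S]

/-- A proper stable subspace for the inhomogeneous system produces rational solutions of it. -/
lemma exists_rational_solution {σ : F →+* F} {τ : F} {n : ℕ} {wt : S → ℕ} {B H : S → F}
    (hwt : Function.Injective wt) (hwtn : ∀ s, wt s < n) (hτ : τ ≠ 0)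
    (hdeg : ∀ (i j : ℕ) (f : F), i ≠ j → τ ^ i * σ f = τ ^ j * f → f = 0)
    (hbad : ∀ (s : S) (f : F), σ f ≠ τ ^ (n - wt s) * (f - B s))
    {W : Submodule F (Option (Option S) → F)} (hWtop : W ≠ ⊤)
    (hW : ∀ x ∈ W, semiMap σ (thetaOne τ n wt B H) x ∈ W)
    {x : Option (Option S) → F} (hx : x ∈ W) (hx0 : x (some none) ≠ 0) :
    ∃ (f : S → F) (f₀ : F), (∀ s, σ (f s) = τ ^ wt s * (f s + H s)) ∧
      σ f₀ = τ ^ n * (f₀ - ∑ s, B s * (H s + f s)) := by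
  have hT : ∀ (x : Option (Option S) → F) (a : Option S),
      semiMap σ (thetaOne τ n wt B H) x (some a) =
        semiMap σ (thetaTwo τ n wt B) (fun a => x (some a)) a := fun x a =>
    thetaOne_vecMul_some τ n wt B H _ a
  have hT0 : ∀ x : Option (Option S) → F, semiMap σ (thetaOne τ n wt B H) x none =
      σ (x none) + σ (x (some none)) * (τ ^ n * ∑ s, B s * H s) -
        ∑ s, σ (x (some (some s))) * (τ ^ wt s * H s) := fun x =>
    thetaOne_vecMul_none τ n wt B H _
  have hTn : ∀ x, semiMap σ (thetaTwo τ n wt B) x none = σ (x none) * τ ^ n := fun x =>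
    thetaTwo_vecMul_none τ n wt B _
  have hTs : ∀ x s, semiMap σ (thetaTwo τ n wt B) x (some s) =
      σ (x (some s)) * τ ^ wt s - σ (x none) * (τ ^ n * B s) := fun x s =>
    thetaTwo_vecMul_some τ n wt B _ s
  have hbar : W.map (LinearMap.funLeft F F some) = ⊤ := by
    refine eq_top_of_thetaTwo_stable hwt hwtn hτ hdeg hbad ?_ (Submodule.mem_map_of_mem hx) hx0
    rintro _ ⟨y, hy, rfl⟩
    exact ⟨_, hW y hy, by ext a; exact hT y a⟩
  have hlift : ∀ v : Option S → F, ∃ w ∈ W, ∀ a, w (some a) = v a := by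
    intro v
    obtain ⟨w, hw, hwv⟩ : v ∈ W.map (LinearMap.funLeft F F some) := hbar ▸ Submodule.mem_top
    exact ⟨w, hw, fun a => congrFun hwv a⟩
  have hzero : ∀ w ∈ W, (∀ a, w (some a) = 0) → w none = 0 := by
    intro w hw hw0
    by_contra hne
    refine hWtop (eq_top_iff.2 fun v _ => ?_)
    obtain ⟨w', hw', hv⟩ := hlift fun a => v (some a)
    have : v = w' + ((v none - w' none) / w none) • w := by
      ext a
      rcases a with _ | a
      · simp [hne]
      · simp [hv, hw0]
    rw [this]
    exact W.add_mem hw' (W.smul_mem _ hw)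
  choose w hwW hw using hlift
  have h1 : ∀ s, σ (w (Pi.single (some s) 1) none) =
      τ ^ wt s * (w (Pi.single (some s) 1) none + H s) := by
    intro s
    have := hzero _ (W.sub_mem (hW _ (hwW (Pi.single (some s) 1)))
      (W.smul_mem (τ ^ wt s) (hwW (Pi.single (some s) 1)))) ?_
    · simp only [Pi.sub_apply, hT0, hw, Pi.smul_apply, smul_eq_mul, Pi.single_apply, apply_ite σ,
        map_one, map_zero, ite_mul, one_mul, zero_mul, Option.some.injEq, Finset.sum_ite_eq',
        Finset.mem_univ, if_true, reduceCtorEq, if_false] at this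
      linear_combination this
    · intro a
      rcases a with _ | s'
      · simp [hT, hTn, hw]
      · simp only [Pi.sub_apply, hT, hTs, hw, Pi.smul_apply, smul_eq_mul, Pi.single_apply,
          apply_ite σ, map_one, map_zero, Option.some.injEq, reduceCtorEq, if_false]
        by_cases h : s' = s
        · simp [h]
        · simp [h]
  refine ⟨fun s => w (Pi.single (some s) 1) none, w (Pi.single none 1) none, h1, ?_⟩
  have := hzero _ (W.add_mem (W.sub_mem (hW _ (hwW (Pi.single none 1)))
      (W.smul_mem (τ ^ n) (hwW (Pi.single none 1))))
      (W.sum_mem (t := Finset.univ) fun s _ =>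
        W.smul_mem (τ ^ n * B s) (hwW (Pi.single (some s) 1)))) ?_
  · simp only [Pi.sub_apply, Pi.add_apply, Finset.sum_apply, hT0, hw, Pi.smul_apply, smul_eq_mul,
      Pi.single_apply, map_one, map_zero, one_mul, zero_mul,
      if_true, reduceCtorEq, if_false, Finset.sum_const_zero] at this
    simp only [mul_add, Finset.sum_add_distrib]
    have h2 : ∑ s, τ ^ n * B s * w (Pi.single (some s) 1) none =
        τ ^ n * ∑ s, B s * w (Pi.single (some s) 1) none := by
      rw [Finset.mul_sum]
      exact Finset.sum_congr rfl fun s _ => by ring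
    rw [h2] at this
    linear_combination this
  · intro a
    rcases a with _ | s'
    · simp [hT, hTn, hw]
    · simp [hT, hTs, hw, Pi.single_apply]

end Descend

section Denominator

variable {Fq : Type*} [Field Fq] [Fintype Fq] {k : Type*} [Field k] [Algebra Fq k]
  {F : Type*} [Field F] [Algebra k[X] F] [IsFractionRing k[X] F] {σ : F →+* F}
  {S : Type*} [Fintype S]

/-- The denominators of rational solutions of the inhomogeneous system can be cleared by a single
Frobenius-fixed polynomial. -/
lemma exists_common_denominator
    (hσ : ∀ p, σ (algebraMap k[X] F p) = algebraMap k[X] F (twP Fq 1 p)) {ϑ : k} {n : ℕ}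
    (hn : n ≠ 0) {wt : S → ℕ} (hwt : ∀ s, wt s ≠ 0) {B H : S → k[X]} {f : S → F} {f₀ : F}
    (hf : ∀ s, σ (f s) = algebraMap k[X] F (X - C (ϑ ^ Fintype.card Fq)) ^ wt s *
      (f s + algebraMap k[X] F (H s)))
    (hf₀ : σ f₀ = algebraMap k[X] F (X - C (ϑ ^ Fintype.card Fq)) ^ n *
      (f₀ - ∑ s, algebraMap k[X] F (B s) * (algebraMap k[X] F (H s) + f s))) :
    ∃ (Q : k[X]) (p : S → k[X]) (p₀ : k[X]), Q ≠ 0 ∧ twP Fq 1 Q = Q ∧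
      (∀ s, twP Fq 1 (p s) = (X - C (ϑ ^ Fintype.card Fq)) ^ wt s * (p s + Q * H s)) ∧
      twP Fq 1 p₀ = (X - C (ϑ ^ Fintype.card Fq)) ^ n * (p₀ - ∑ s, B s * (Q * H s + p s)) := by
  classical
  set τ := X - C (ϑ ^ Fintype.card Fq) with hτ
  have hinj : Function.Injective (algebraMap k[X] F) := IsFractionRing.injective k[X] F
  have h1 : ∀ s, ∃ P Q : k[X], Q ≠ 0 ∧ twP Fq 1 Q = Q ∧
      f s * algebraMap k[X] F Q = algebraMap k[X] F P := by
    intro s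
    obtain ⟨P, Q, hQ, hQfix, hfPQ, -⟩ := exists_fraction_of_frobenius_eq (B := -H s) hσ (hwt s)
      (by rw [hf s, map_neg, sub_neg_eq_add])
    exact ⟨P, Q, hQ, hQfix, hfPQ⟩
  choose P Q hQ hQfix hfPQ using h1
  set Q₁ := ∏ s, Q s with hQ₁
  have hQ₁fix : twP Fq 1 Q₁ = Q₁ := by rw [hQ₁, map_prod]; simp [hQfix]
  have h2 : ∀ s, ∃ P' : k[X], f s * algebraMap k[X] F Q₁ = algebraMap k[X] F P' := by
    intro s
    obtain ⟨R, hR⟩ : Q s ∣ Q₁ := Finset.dvd_prod_of_mem _ (Finset.mem_univ s)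
    exact ⟨P s * R, by rw [hR, map_mul, ← mul_assoc, hfPQ, map_mul]⟩
  choose P' hP' using h2
  obtain ⟨P₀, Q₀, hQ₀, hQ₀fix, hf₀PQ, hP₀, -⟩ := exists_fraction_of_frobenius_eq
    (f := f₀ * algebraMap k[X] F Q₁) (B := ∑ s, B s * (Q₁ * H s + P' s)) hσ hn (by
      rw [map_mul, hσ, hQ₁fix, hf₀, map_sum]
      simp only [map_mul, map_add, ← hP']
      rw [mul_assoc, sub_mul, Finset.sum_mul]
      congr 2
      exact Finset.sum_congr rfl fun s _ => by ring)
  refine ⟨Q₁ * Q₀, fun s => P' s * Q₀, P₀, mul_ne_zero (Finset.prod_ne_zero_iff.2 fun s _ => hQ s)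
    hQ₀, by rw [map_mul, hQ₁fix, hQ₀fix], fun s => ?_, ?_⟩
  · apply hinj
    rw [← hσ, map_mul, ← hP', map_mul, map_mul, hσ, hσ, hQ₁fix, hQ₀fix, hf s]
    simp only [map_mul, map_add, map_pow, ← hP']
    ring
  · rw [hP₀, Finset.mul_sum]
    congr 2
    exact Finset.sum_congr rfl fun s _ => by ring

end Denominator


section Embedding

variable (Fq : Type*) [Field Fq] (k : Type*) [Field k] [Algebra Fq[X] k]

/-- The inclusion of `𝔽_q[θ][t]` into `k[t]`. -/
noncomputable def embP : Fq[X][X] →+* k[X] := Polynomial.mapRingHom (algebraMap Fq[X] k)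

lemma embP_X_sub_C (a : Fq[X]) : embP Fq k (X - C a) = X - C (algebraMap Fq[X] k a) := by
  simp [embP]

lemma embP_twP [Fintype Fq] [Algebra Fq k] (r : ℕ) (p : Fq[X][X]) :
    embP Fq k (twP Fq r p) = twP Fq r (embP Fq k p) := by
  ext m
  simp [embP]

lemma toS_embP {K : Type*} [CommRing K] (φ : k →+* K) (p : Fq[X][X]) :
    toS φ (embP Fq k p) = toS (φ.comp (algebraMap Fq[X] k)) p := by
  ext m
  simp [embP]

lemma embP_injective (h : Function.Injective (algebraMap Fq[X] k)) :
    Function.Injective (embP Fq k) :=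
  Polynomial.map_injective _ h

end Embedding

section Stages

variable {Fq : Type*} [Field Fq] [Fintype Fq] {k : Type*} [Field k] [Algebra Fq k]
  [Algebra Fq[X] k] {F : Type*} [Field F] [Algebra k[X] F] [IsFractionRing k[X] F] {σ : F →+* F}
  {K : Type*} [NormedField K] [CompleteSpace K] [IsUltrametricDist K] [Algebra Fq K]
  {φ : k →+* K} {S : Type*} [Fintype S] [DecidableEq S]

lemma algebraMap_injective_of_norm
    (hφ : ∀ a ≠ 0, ‖φ (algebraMap Fq[X] k a)‖ = (Fintype.card Fq : ℝ) ^ a.natDegree) :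
    Function.Injective (algebraMap Fq[X] k) := by
  rw [injective_iff_map_eq_zero]
  intro a ha
  by_contra h
  have h1 := hφ a h
  rw [ha, map_zero, norm_zero] at h1
  exact pow_ne_zero _ (Nat.cast_ne_zero.2 Fintype.card_ne_zero) h1.symm

lemma pow_card_injective {ϑ : Fq[X]} (hϑ : 0 < ϑ.natDegree) :
    Function.Injective fun r : ℕ => ϑ ^ Fintype.card Fq ^ r := by
  intro r s h
  have h1 := congrArg natDegree h
  simp only [natDegree_pow] at h1
  exact Nat.pow_right_injective Fintype.one_lt_card (Nat.eq_of_mul_eq_mul_right hϑ h1)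

lemma pow_card_injective_algebraMap (hinj : Function.Injective (algebraMap Fq[X] k)) {ϑ : Fq[X]}
    (hϑ : 0 < ϑ.natDegree) :
    Function.Injective fun r : ℕ => algebraMap Fq[X] k ϑ ^ Fintype.card Fq ^ r := by
  intro r s h
  refine pow_card_injective hϑ (hinj ?_)
  simpa using h

/-- A nontrivial solution of the homogeneous system cannot have a zero at `ϑ` in its top weight
coordinate. -/
theorem false_of_homogeneous_system
    (hφ : ∀ a ≠ 0, ‖φ (algebraMap Fq[X] k a)‖ = (Fintype.card Fq : ℝ) ^ a.natDegree)
    (hσ : ∀ p, σ (algebraMap k[X] F p) = algebraMap k[X] F (twP Fq 1 p))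
    {ϑ : Fq[X]} (hϑ : 0 < ϑ.natDegree) {n : ℕ} {wt : S → ℕ} (hwt : Function.Injective wt)
    (hwtn : ∀ s, wt s < n) {B : S → Fq[X][X]}
    (hbad : ∀ (r : ℕ) (s : S) (f : F), σ f ≠
      algebraMap k[X] F (embP Fq k (X - C (ϑ ^ Fintype.card Fq ^ (r + 1)))) ^ (n - wt s) *
        (f - algebraMap k[X] F (embP Fq k (twP Fq r (B s)))))
    {Y : PowerSeries K} {x : S → PowerSeries K} {ρ M : ℝ} (hY : GaussBound ρ M Y)
    (hx : ∀ s, GaussBound ρ M (x s)) (hρ : ‖φ (algebraMap Fq[X] k ϑ)‖ < ρ)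
    (hYrel : twS Fq 1 Y = toS φ (embP Fq k (X - C (ϑ ^ Fintype.card Fq))) ^ n *
      (Y - ∑ s, toS φ (embP Fq k (B s)) * x s))
    (hxrel : ∀ s, twS Fq 1 (x s) =
      toS φ (embP Fq k (X - C (ϑ ^ Fintype.card Fq))) ^ wt s * x s)
    (h0 : evalSeries (φ (algebraMap Fq[X] k ϑ)) Y = 0) (hne : ∃ s, x s ≠ 0) : False := by
  have hinjA := algebraMap_injective_of_norm hφ
  have hinjF : Function.Injective (algebraMap k[X] F) := IsFractionRing.injective k[X] F
  set j : Fq[X][X] →+* F := (algebraMap k[X] F).comp (embP Fq k) with hj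
  have hjinj : Function.Injective j := hinjF.comp (embP_injective Fq k hinjA)
  have hτr : ∀ r, twP Fq r (X - C (ϑ ^ Fintype.card Fq) : Fq[X][X]) =
      X - C (ϑ ^ Fintype.card Fq ^ (r + 1)) := by
    intro r
    rw [map_sub, twP_X, twP_C, ← pow_mul, pow_succ']
  obtain ⟨r, G, W, hG, hWtop, hGW, hstab⟩ := exists_stable_subspace
    (φ := φ.comp (algebraMap Fq[X] k)) (Θ := thetaTwo (X - C (ϑ ^ Fintype.card Fq)) n wt B)
    (ψ := fun a : Option S => a.elim Y x) hφ j hjinj σ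
    (fun p => by simp only [hj, RingHom.comp_apply, hσ, embP_twP]) none hϑ (ρ := ρ) (C := M)
    (by rintro (_ | s); exacts [hY, hx s]) hρ
    (by
      rintro (_ | s)
      · simp only [Option.elim, hYrel, Fintype.sum_option, thetaTwo, toS_embP, map_mul, map_neg,
          map_pow, neg_mul, Finset.sum_neg_distrib, mul_sub, Finset.mul_sum, mul_assoc]
        rw [sub_eq_add_neg]
      · simp [hxrel, Fintype.sum_option, thetaTwo, toS_embP, apply_ite (toS _)])
    h0 (by obtain ⟨s, hs⟩ := hne; exact ⟨some s, hs⟩)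
    (by
      intro r x hx v hv
      change Matrix.vecMul v ((thetaTwo (X - C (ϑ ^ Fintype.card Fq)) n wt B).map
        ((Polynomial.evalRingHom x).comp (twP Fq r))) = 0 at hv
      rw [thetaTwo_map] at hv
      refine thetaTwo_vecMul_injective ?_ hv
      rw [RingHom.comp_apply, hτr]
      simpa [sub_eq_zero] using hx)
  have hmap : (thetaTwo (X - C (ϑ ^ Fintype.card Fq)) n wt B).map (fun p => j (twP Fq r p)) =
      thetaTwo (j (X - C (ϑ ^ Fintype.card Fq ^ (r + 1)))) n wt fun s => j (twP Fq r (B s)) := by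
    rw [← hτr]
    exact thetaTwo_map (j.comp (twP Fq r)) _ _ _ _
  rw [hmap] at hstab
  refine hWtop (eq_top_of_thetaTwo_stable hwt hwtn ?_ ?_ ?_ hstab hGW ?_)
  · rw [map_ne_zero_iff _ hjinj]
    exact X_sub_C_ne_zero _
  · intro i i' f hi hf
    rw [hj, RingHom.comp_apply, embP_X_sub_C] at hf
    exact eq_zero_of_pow_mul_frobenius_eq hσ _ hi hf
  · exact hbad r
  · exact (map_ne_zero_iff _ hjinj).2 hG

/-- The inhomogeneous system cannot have a zero at `ϑ` in its top weight coordinate. -/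
theorem false_of_inhomogeneous_system
    (hφ : ∀ a ≠ 0, ‖φ (algebraMap Fq[X] k a)‖ = (Fintype.card Fq : ℝ) ^ a.natDegree)
    (hσ : ∀ p, σ (algebraMap k[X] F p) = algebraMap k[X] F (twP Fq 1 p))
    {ϑ : Fq[X]} (hϑ : 0 < ϑ.natDegree) [Nonempty S] {n : ℕ} {wt : S → ℕ}
    (hwt : Function.Injective wt) (hwt0 : ∀ s, wt s ≠ 0)
    (hwtn : ∀ s, wt s < n) {B H : S → Fq[X][X]}
    (hbad : ∀ (r : ℕ) (s : S) (f : F), σ f ≠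
      algebraMap k[X] F (embP Fq k (X - C (ϑ ^ Fintype.card Fq ^ (r + 1)))) ^ (n - wt s) *
        (f - algebraMap k[X] F (embP Fq k (twP Fq r (B s)))))
    {U : PowerSeries K} {u : S → PowerSeries K} {ρ M : ℝ} (hU : GaussBound ρ M U)
    (hu : ∀ s, GaussBound ρ M (u s)) (hρ : ‖φ (algebraMap Fq[X] k ϑ)‖ < ρ)
    (hUrel : twS Fq 1 U = toS φ (embP Fq k (X - C (ϑ ^ Fintype.card Fq))) ^ n *
      (U - ∑ s, toS φ (embP Fq k (B s)) * (u s - toS φ (embP Fq k (H s)))))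
    (hurel : ∀ s, twS Fq 1 (u s) = toS φ (embP Fq k (X - C (ϑ ^ Fintype.card Fq))) ^ wt s *
      (u s - toS φ (embP Fq k (H s))))
    (h0 : evalSeries (φ (algebraMap Fq[X] k ϑ)) U = 0)
    (hune : ∀ s, evalSeries (φ (algebraMap Fq[X] k ϑ)) (u s) ≠ 0) : False := by
  have hinjA := algebraMap_injective_of_norm hφ
  have hinjF : Function.Injective (algebraMap k[X] F) := IsFractionRing.injective k[X] F
  have hϑ0 : ϑ ≠ 0 := fun h => by simp [h] at hϑ
  have hρ1 : 1 ≤ ρ := le_trans (by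
    rw [hφ _ hϑ0]; exact one_le_pow₀ (by exact_mod_cast Fintype.card_pos)) hρ.le
  set j : Fq[X][X] →+* F := (algebraMap k[X] F).comp (embP Fq k) with hj
  have hjinj : Function.Injective j := hinjF.comp (embP_injective Fq k hinjA)
  have hτr : ∀ r, twP Fq r (X - C (ϑ ^ Fintype.card Fq) : Fq[X][X]) =
      X - C (ϑ ^ Fintype.card Fq ^ (r + 1)) := by
    intro r
    rw [map_sub, twP_X, twP_C, ← pow_mul, pow_succ']
  obtain ⟨r, G, W, hG, hWtop, hGW, hstab⟩ := exists_stable_subspace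
    (φ := φ.comp (algebraMap Fq[X] k)) (Θ := thetaOne (X - C (ϑ ^ Fintype.card Fq)) n wt B H)
    (ψ := fun a : Option (Option S) => a.elim 1 fun a => a.elim U u) hφ j hjinj σ
    (fun p => by simp only [hj, RingHom.comp_apply, hσ, embP_twP]) (some none) hϑ (ρ := ρ)
    (C := max 1 M)
    (by
      rintro (_ | _ | s)
      exacts [GaussBound.one.mono (le_max_left _ _), hU.mono (le_max_right _ _),
        (hu s).mono (le_max_right _ _)]) hρ
    (by
      rintro (_ | _ | s)
      · simp [Fintype.sum_option, thetaOne]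
      · simp only [Option.elim, hUrel, Fintype.sum_option, thetaOne, thetaTwo, toS_embP, map_mul,
          map_neg, map_pow, map_sum, mul_one]
        simp only [mul_sub, Finset.sum_sub_distrib, neg_mul, Finset.sum_neg_distrib,
          Finset.mul_sum, mul_assoc]
        ring
      · simp [hurel, Fintype.sum_option, thetaOne, thetaTwo, toS_embP, apply_ite (toS _)]
        ring)
    h0 ⟨none, one_ne_zero⟩
    (by
      intro r x hx v hv
      change Matrix.vecMul v ((thetaOne (X - C (ϑ ^ Fintype.card Fq)) n wt B H).map
        ((Polynomial.evalRingHom x).comp (twP Fq r))) = 0 at hv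
      rw [thetaOne_map] at hv
      refine thetaOne_vecMul_injective ?_ hv
      rw [RingHom.comp_apply, hτr]
      simpa [sub_eq_zero] using hx)
  have hmap : (thetaOne (X - C (ϑ ^ Fintype.card Fq)) n wt B H).map (fun p => j (twP Fq r p)) =
      thetaOne (j (X - C (ϑ ^ Fintype.card Fq ^ (r + 1)))) n wt (fun s => j (twP Fq r (B s)))
        fun s => j (twP Fq r (H s)) := by
    rw [← hτr]
    exact thetaOne_map (j.comp (twP Fq r)) _ _ _ _ _
  rw [hmap] at hstab
  obtain ⟨ϑr, hϑr⟩ : ∃ x, x = ϑ ^ Fintype.card Fq ^ r := ⟨_, rfl⟩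
  have hϑrq : ∀ r', ϑr ^ Fintype.card Fq ^ (r' + 1) = ϑ ^ Fintype.card Fq ^ (r' + r + 1) := by
    intro r'
    rw [hϑr, ← pow_mul, ← pow_add]
    congr 2
    omega
  have hϑrq1 : ϑr ^ Fintype.card Fq = ϑ ^ Fintype.card Fq ^ (r + 1) := by
    rw [hϑr, ← pow_mul, pow_succ]
  have hϑr0 : 0 < ϑr.natDegree := by
    rw [hϑr, natDegree_pow]
    exact Nat.mul_pos (pow_pos Fintype.card_pos r) hϑ
  obtain ⟨f, f₀, hf, hf₀⟩ := exists_rational_solution hwt hwtn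
    ((map_ne_zero_iff _ hjinj).2 (X_sub_C_ne_zero _)) (by
      intro i i' f hi hf
      rw [hj, RingHom.comp_apply, embP_X_sub_C] at hf
      exact eq_zero_of_pow_mul_frobenius_eq hσ _ hi hf)
    (hbad r) hWtop hstab hGW ((map_ne_zero_iff _ hjinj).2 hG)
  simp only [hj, RingHom.comp_apply, embP_X_sub_C, ← hϑrq1] at hf hf₀
  simp only [map_pow _ ϑr] at hf hf₀
  have hn : n ≠ 0 := by
    obtain ⟨s⟩ := ‹Nonempty S›
    exact (hwtn s).ne_bot
  obtain ⟨Q, p, p₀, hQ, hQfix, hp, hp₀⟩ := exists_common_denominator hσ hn hwt0 hf hf₀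
  have hτk : X - C (algebraMap Fq[X] k ϑr ^ Fintype.card Fq) =
      embP Fq k (X - C (ϑr ^ Fintype.card Fq)) := by
    rw [embP_X_sub_C]
    congr 2
    exact (map_pow _ _ _).symm
  have hroot : ∀ (P R : k[X]) (i : ℕ), i ≠ 0 →
      twP Fq 1 P = (X - C (algebraMap Fq[X] k ϑr ^ Fintype.card Fq)) ^ i * R →
      P.eval (algebraMap Fq[X] k ϑr) = 0 := by
    intro P R i hi hP
    have h3 := eval_twP Fq 1 P (algebraMap Fq[X] k ϑr)
    rw [hP, pow_one] at h3
    simp only [eval_mul, eval_pow, eval_sub, eval_X, eval_C, sub_self, zero_pow hi, zero_mul] at h3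
    exact eq_zero_of_pow_eq_zero h3.symm
  have hp0 := fun s => hroot _ _ _ (hwt0 s) (hp s)
  have hp₀0 := hroot _ _ _ hn hp₀
  have hρ0 : 0 ≤ ρ := zero_le_one.trans hρ1
  have hρr1 : 1 ≤ ρ ^ Fintype.card Fq ^ r := one_le_pow₀ hρ1
  have hρr0 : 0 ≤ ρ ^ Fintype.card Fq ^ r := zero_le_one.trans hρr1
  have hϑρ : ‖φ (algebraMap Fq[X] k ϑr)‖ < ρ ^ Fintype.card Fq ^ r := by
    rw [hϑr, map_pow, map_pow, norm_pow]
    exact pow_lt_pow_left₀ hρ (norm_nonneg _) (card_pow_ne_zero Fq r)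
  have hpoly : ∀ P : k[X], ∃ C, GaussBound (ρ ^ Fintype.card Fq ^ r) C (toS φ P) := fun P =>
    GaussBound.exists_of_polynomial hρr1 (P.map φ)
  choose cst hcst using hpoly
  have hev : ∀ (P : k[X]) (v : PowerSeries K), GaussBound ρ M v →
      evalSeries (φ (algebraMap Fq[X] k ϑr)) (toS φ Q * twS Fq r v + toS φ P) =
        φ (Q.eval (algebraMap Fq[X] k ϑr)) *
          evalSeries (φ (algebraMap Fq[X] k ϑ)) v ^ Fintype.card Fq ^ r +
        φ (P.eval (algebraMap Fq[X] k ϑr)) := by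
    intro P v hv
    have hv' := hv.twS Fq hρ0 r
    rw [evalSeries_add ((hcst Q).mul hρr0 hv') (hcst P) hϑρ,
      evalSeries_mul (hcst Q) hv' hϑρ, evalSeries_toS, evalSeries_toS]
    congr 2
    rw [← evalSeries_twS Fq hv hρ, hϑr, map_pow, map_pow]
  have htw : ∀ v : PowerSeries K, twS Fq 1 (twS Fq r v) = twS Fq r (twS Fq 1 v) := fun v => by
    rw [twS_twS, twS_twS, add_comm]
  have hτS : twS Fq r (toS φ (embP Fq k (X - C (ϑ ^ Fintype.card Fq)))) =
      toS φ (embP Fq k (X - C (ϑr ^ Fintype.card Fq))) := by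
    rw [twS_toS, ← embP_twP, hτr, hϑrq1]
  set D := max (cst Q * M ^ Fintype.card Fq ^ r) (cst p₀ + ∑ s, cst (p s)) with hD
  have hcst0 : ∀ P, 0 ≤ cst P := fun P => (hcst P).nonneg
  refine false_of_homogeneous_system (S := S) hφ hσ hϑr0 hwt hwtn
    (B := fun s => twP Fq r (B s)) ?_
    (Y := toS φ Q * twS Fq r U + toS φ p₀) (x := fun s => toS φ Q * twS Fq r (u s) + toS φ (p s))
    (ρ := ρ ^ Fintype.card Fq ^ r) (M := D) ?_ ?_ hϑρ ?_ ?_ ?_ ?_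
  · intro r' s f
    rw [hϑrq, twP_twP]
    exact hbad (r' + r) s f
  · refine GaussBound.add hρr0 (((hcst Q).mul hρr0 (hU.twS Fq hρ0 r)).mono (le_max_left _ _))
      ((hcst p₀).mono (le_trans ?_ (le_max_right _ _)))
    exact le_add_of_nonneg_right (Finset.sum_nonneg fun s _ => hcst0 _)
  · intro s
    refine GaussBound.add hρr0 (((hcst Q).mul hρr0 ((hu s).twS Fq hρ0 r)).mono (le_max_left _ _))
      ((hcst (p s)).mono (le_trans ?_ (le_max_right _ _)))
    exact (Finset.single_le_sum (f := fun s => cst (p s)) (fun s _ => hcst0 _)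
      (Finset.mem_univ s)).trans (le_add_of_nonneg_left (hcst0 _))
  · rw [map_add, map_mul, twS_toS, twS_toS, hQfix, htw, hUrel, hp₀, hτk]
    simp only [map_mul (twS Fq r), map_sub (twS Fq r), map_pow (twS Fq r), map_sum (twS Fq r),
      map_mul (toS φ), map_sub (toS φ), map_pow (toS φ), map_sum (toS φ), map_add (toS φ), hτS,
      twS_toS, ← embP_twP]
    generalize toS φ (embP Fq k (X - C (ϑr ^ Fintype.card Fq))) = τ
    have hsum : ∑ s, toS φ (embP Fq k (twP Fq r (B s))) *
          (toS φ Q * twS Fq r (u s) + toS φ (p s)) =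
        toS φ Q * ∑ s, toS φ (embP Fq k (twP Fq r (B s))) *
            (twS Fq r (u s) - toS φ (embP Fq k (twP Fq r (H s)))) +
          ∑ s, toS φ (embP Fq k (twP Fq r (B s))) *
            (toS φ Q * toS φ (embP Fq k (twP Fq r (H s))) + toS φ (p s)) := by
      rw [Finset.mul_sum, ← Finset.sum_add_distrib]
      exact Finset.sum_congr rfl fun s _ => by ring
    rw [hsum]
    ring
  · intro s
    rw [map_add, map_mul, twS_toS, twS_toS, hQfix, htw, hurel, hp, hτk]
    simp only [map_mul (twS Fq r), map_sub (twS Fq r), map_pow (twS Fq r), map_mul (toS φ),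
      map_pow (toS φ), map_add (toS φ), hτS, twS_toS, ← embP_twP]
    ring
  · rw [hev _ _ hU, h0, hp₀0, zero_pow (card_pow_ne_zero Fq r)]
    simp
  · obtain ⟨s⟩ := ‹Nonempty S›
    refine ⟨s, fun h => ?_⟩
    have h1 := hev (p s) (u s) (hu s)
    rw [h, evalSeries_zero, hp0, map_zero, add_zero] at h1
    refine mul_ne_zero ((map_ne_zero φ).2 ?_) (pow_ne_zero _ (hune s)) h1.symm
    exact eval_ne_zero_of_twP_fixed hQ hQfix (pow_card_injective_algebraMap hinjA hϑr0)

end Stages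


section Newton

variable {E : Type*} [Field E]

/-- The generating series of the negative power sums of the roots is the logarithmic derivative. -/
lemma mk_sum_inv_pow_mul {ι : Type*} [DecidableEq ι] (s : Finset ι) (z : ι → E)
    (hz : ∀ a ∈ s, z a ≠ 0) (c : E) :
    (PowerSeries.mk fun m => ∑ a ∈ s, (z a ^ (m + 1))⁻¹) *
        ((C c * ∏ a ∈ s, (X - C (z a)) : E[X]) : PowerSeries E) =
      -((derivative (C c * ∏ a ∈ s, (X - C (z a))) : E[X]) : PowerSeries E) := by
  have hgeo : ∀ a ∈ s, (PowerSeries.mk fun m => (z a ^ (m + 1))⁻¹) *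
      ((X - C (z a) : E[X]) : PowerSeries E) = -1 := by
    intro a ha
    have h := hz a ha
    ext m
    rw [Polynomial.coe_sub, Polynomial.coe_X, Polynomial.coe_C, mul_sub, map_sub,
      PowerSeries.coeff_mul_C, PowerSeries.coeff_mk]
    rcases m with _ | m
    · simp [h]
    · rw [PowerSeries.coeff_succ_mul_X, PowerSeries.coeff_mk]
      simp only [map_neg, PowerSeries.coeff_one, Nat.succ_ne_zero, if_false, neg_zero]
      field_simp
      ring
  have hsum : (PowerSeries.mk fun m => ∑ a ∈ s, (z a ^ (m + 1))⁻¹) =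
      ∑ a ∈ s, PowerSeries.mk fun m => (z a ^ (m + 1))⁻¹ := by
    ext m
    simp
  have hcoe : ∀ f : ι → E[X], ((∑ a ∈ s, f a : E[X]) : PowerSeries E) =
      ∑ a ∈ s, (f a : PowerSeries E) := fun f =>
    map_sum Polynomial.coeToPowerSeries.ringHom f s
  rw [derivative_C_mul, derivative_prod_finset, hsum, Finset.sum_mul, Finset.mul_sum, hcoe,
    ← Finset.sum_neg_distrib]
  refine Finset.sum_congr rfl fun a ha => ?_
  rw [← Finset.mul_prod_erase s _ ha, Polynomial.coe_mul,
    Polynomial.coe_mul, derivative_X_sub_C, mul_one, Polynomial.coe_mul]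
  linear_combination (((C c : E[X]) : PowerSeries E) *
    ((∏ b ∈ s.erase a, (X - C (z b)) : E[X]) : PowerSeries E)) * hgeo a ha

end Newton

section Monic

variable (Fq : Type*) [Field Fq] [Fintype Fq]

lemma finite_monic_natDegree (d : ℕ) : {a : Fq[X] | a.Monic ∧ a.natDegree = d}.Finite := by
  have : Finite (degreeLT Fq d) := Finite.of_equiv _ (degreeLTEquiv Fq d).toEquiv.symm
  exact Finite.of_equiv _ (monicEquivDegreeLT d).symm

/-- The monic polynomials of degree `d` over a finite field. -/
noncomputable def monics (d : ℕ) : Finset Fq[X] := (finite_monic_natDegree Fq d).toFinset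

variable {Fq}

lemma mem_monics {d : ℕ} {a : Fq[X]} : a ∈ monics Fq d ↔ a.Monic ∧ a.natDegree = d := by
  simp [monics]

lemma ne_zero_of_mem_monics {d : ℕ} {a : Fq[X]} (ha : a ∈ monics Fq d) : a ≠ 0 :=
  (mem_monics.1 ha).1.ne_zero

variable (Fq) in
lemma card_monics (d : ℕ) : (monics Fq d).card = Fintype.card Fq ^ d := by
  rw [monics, ← Set.ncard_eq_toFinset_card _ (finite_monic_natDegree Fq d)]
  change Nat.card {a : Fq[X] // a.Monic ∧ a.natDegree = d} = _
  rw [Nat.card_congr ((monicEquivDegreeLT d).trans (degreeLTEquiv Fq d).toEquiv)]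
  simp

lemma pow_card_eq_eval₂ (i : ℕ) (a : Fq[X]) :
    a ^ Fintype.card Fq ^ i = eval₂ C (X ^ Fintype.card Fq ^ i) a := by
  have h : ∀ i, a ^ Fintype.card Fq ^ i = expand Fq (Fintype.card Fq ^ i) a := by
    intro i
    induction i with
    | zero => simp
    | succ i ih => rw [pow_succ, pow_mul, ih, ← FiniteField.expand_card, expand_expand, mul_comm]
  rw [h, expand_eq_comp_X_pow, comp]

end Monic

section PowerSums

variable {Fq : Type*} [Field Fq] [Fintype Fq] {E : Type*} [Field E] [Algebra Fq E]
  (φ : Fq[X] →+* E)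

/-- The power sum `S_d(s) = ∑ a^{-s}` over monic polynomials of degree `d`. -/
noncomputable def powerSum (d s : ℕ) : E := ∑ a ∈ monics Fq d, (φ a ^ s)⁻¹

/-- The nodes `θ^{q^i}`. -/
noncomputable def node (i : ℕ) : E := φ X ^ Fintype.card Fq ^ i

/-- The coefficients of the polynomial whose roots are the monic polynomials of degree `d`. -/
noncomputable def lagr (i d : ℕ) : E :=
  if i ≤ d then (∏ j ∈ (Finset.range (d + 1)).erase i, (node φ i - node φ j))⁻¹ else 0

variable {φ}

lemma node_injective (hφ : Function.Injective φ) : Function.Injective (node φ) := by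
  intro i j h
  refine pow_card_injective (Fq := Fq) (ϑ := X) (by simp) (hφ ?_)
  simpa [node] using h

lemma sum_lagr_mul (hφ : Function.Injective φ) {d : ℕ} {a : Fq[X]} (ha : a ∈ monics Fq d) :
    ∑ i ∈ Finset.range (d + 1), lagr φ i d * φ a ^ Fintype.card Fq ^ i = 1 := by
  obtain ⟨ham, had⟩ := mem_monics.1 ha
  have hinj : Function.Injective (φ.comp C) := (φ.comp C).injective
  have h := Lagrange.coeff_eq_sum (s := Finset.range (d + 1)) (v := node φ)
    (P := a.map (φ.comp C)) ((node_injective hφ).injOn) (by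
      rw [degree_map_eq_of_injective hinj, degree_eq_natDegree ham.ne_zero, had, Finset.card_range]
      exact_mod_cast Nat.lt_succ_self d)
  rw [Finset.card_range, Nat.add_sub_cancel, coeff_map, ← had, coeff_natDegree,
    ham.leadingCoeff, map_one, had] at h
  rw [h]
  refine Finset.sum_congr rfl fun i hi => ?_
  rw [lagr, if_pos (Nat.lt_succ_iff.1 (Finset.mem_range.1 hi)), div_eq_inv_mul, ← map_pow,
    pow_card_eq_eval₂, hom_eval₂, eval_map, node, map_pow]

lemma mk_powerSum_mul (hφ : Function.Injective φ) (d : ℕ) :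
    (PowerSeries.mk fun m => powerSum φ d (m + 1)) *
      ((1 - ∑ i ∈ Finset.range (d + 1), C (lagr φ i d) * X ^ Fintype.card Fq ^ i : E[X]) :
        PowerSeries E) = PowerSeries.C (lagr φ 0 d) := by
  classical
  set f : E[X] := 1 - ∑ i ∈ Finset.range (d + 1), C (lagr φ i d) * X ^ Fintype.card Fq ^ i with hf
  have hq : 1 < Fintype.card Fq := Fintype.one_lt_card
  have hdeg : f.natDegree ≤ Fintype.card Fq ^ d := by
    refine (natDegree_sub_le _ _).trans (max_le (by simp) ?_)
    refine natDegree_sum_le_of_forall_le _ _ fun i hi => ?_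
    refine (natDegree_C_mul_X_pow_le _ _).trans (Nat.pow_le_pow_right hq.le ?_)
    exact Nat.lt_succ_iff.1 (Finset.mem_range.1 hi)
  have hdvd : ∏ a ∈ monics Fq d, (X - C (φ a)) ∣ f := by
    refine Finset.prod_dvd_of_coprime ?_ fun a ha => ?_
    · intro a _ b _ hab
      exact isCoprime_X_sub_C_of_isUnit_sub (sub_ne_zero.2 (hφ.ne hab)).isUnit
    · rw [dvd_iff_isRoot, IsRoot.def, hf]
      simp only [eval_sub, eval_one, eval_finsetSum, eval_mul, eval_C, eval_pow, eval_X]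
      rw [sum_lagr_mul hφ ha, sub_self]
  have hfac : f = C f.leadingCoeff * ∏ a ∈ monics Fq d, (X - C (φ a)) := by
    refine eq_leadingCoeff_mul_of_monic_of_dvd_of_natDegree_le
      (monic_prod_of_monic _ _ fun a _ => monic_X_sub_C _) hdvd ?_
    rw [natDegree_prod_of_monic _ _ fun a _ => monic_X_sub_C _]
    simpa [card_monics] using hdeg
  have hder : derivative f = -C (lagr φ 0 d) := by
    rw [hf, derivative_sub, derivative_one, zero_sub, derivative_sum, Finset.sum_range_succ',
      Finset.sum_eq_zero]
    · simp
    · intro i _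
      rw [derivative_C_mul_X_pow]
      have : ((Fintype.card Fq ^ (i + 1) : ℕ) : E) = 0 := by
        have h0 : ((Fintype.card Fq : ℕ) : Fq) = 0 := FiniteField.cast_card_eq_zero Fq
        have h1 : ((Fintype.card Fq : ℕ) : E) = 0 := by
          rw [← map_natCast (algebraMap Fq E), h0, map_zero]
        rw [Nat.cast_pow, h1, zero_pow (Nat.succ_ne_zero i)]
      rw [this]
      simp
  have hmain := mk_sum_inv_pow_mul (monics Fq d) (fun a => φ a)
    (fun a ha => (map_ne_zero_iff φ hφ).2 (ne_zero_of_mem_monics ha)) f.leadingCoeff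
  rw [← hfac, hder] at hmain
  simpa [powerSum] using hmain

lemma powerSum_one (hφ : Function.Injective φ) (d : ℕ) : powerSum φ d 1 = lagr φ 0 d := by
  have h := congrArg PowerSeries.constantCoeff (mk_powerSum_mul hφ d)
  rw [map_mul, PowerSeries.constantCoeff_C, ← PowerSeries.coeff_zero_eq_constantCoeff_apply,
    ← PowerSeries.coeff_zero_eq_constantCoeff_apply, PowerSeries.coeff_mk, Polynomial.coeff_coe,
    coeff_sub, finsetSum_coeff] at h
  simpa [coeff_X_pow, (card_pow_ne_zero Fq _).symm] using h

lemma powerSum_succ (hφ : Function.Injective φ) (d : ℕ) {m : ℕ} (hm : m ≠ 0) :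
    powerSum φ d (m + 1) = ∑ i ∈ (Finset.range m).filter (fun i => Fintype.card Fq ^ i ≤ m),
      lagr φ i d * powerSum φ d (m + 1 - Fintype.card Fq ^ i) := by
  have hq : 1 < Fintype.card Fq := Fintype.one_lt_card
  have h := congrArg (PowerSeries.coeff m) (mk_powerSum_mul hφ d)
  have hcoe : ((1 - ∑ i ∈ Finset.range (d + 1), C (lagr φ i d) * X ^ Fintype.card Fq ^ i : E[X]) :
      PowerSeries E) = 1 - ∑ i ∈ Finset.range (d + 1),
        PowerSeries.C (lagr φ i d) * PowerSeries.X ^ Fintype.card Fq ^ i := by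
    rw [← Polynomial.coeToPowerSeries.ringHom_apply, map_sub, map_one, map_sum]
    simp
  rw [hcoe, mul_sub, mul_one, map_sub, PowerSeries.coeff_mk, PowerSeries.coeff_C, if_neg hm,
    sub_eq_zero] at h
  rw [h, Finset.mul_sum, map_sum]
  have hterm : ∀ i, PowerSeries.coeff m ((PowerSeries.mk fun m => powerSum φ d (m + 1)) *
      (PowerSeries.C (lagr φ i d) * PowerSeries.X ^ Fintype.card Fq ^ i)) =
      if Fintype.card Fq ^ i ≤ m then
        lagr φ i d * powerSum φ d (m + 1 - Fintype.card Fq ^ i) else 0 := by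
    intro i
    rw [mul_left_comm, PowerSeries.coeff_C_mul, PowerSeries.coeff_mul_X_pow']
    split_ifs with hi
    · rw [PowerSeries.coeff_mk, Nat.sub_add_comm hi]
    · rw [mul_zero]
  simp only [hterm]
  rw [← Finset.sum_filter]
  refine Finset.sum_congr_of_eq_on_inter ?_ ?_ ?_
  · intro i hi hni
    simp only [Finset.mem_filter, Finset.mem_range, not_and] at hi hni
    have : i < Fintype.card Fq ^ i := Nat.lt_pow_self hq
    exact absurd hi.2 (hni (by omega))
  · intro i hi hni
    simp only [Finset.mem_filter, Finset.mem_range, not_and] at hi hni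
    have : ¬ i < d + 1 := fun h => hni h hi.2
    rw [lagr, if_neg (by omega), zero_mul]
  · intro i _ _
    rfl

end PowerSums


section Representation

variable {Fq : Type*} [Field Fq] [Fintype Fq]

/-- The polynomial `∏_{m=1}^i (t^{q^i} - θ^{q^m})`. -/
noncomputable def gPoly (Fq : Type*) [Field Fq] [Fintype Fq] (i : ℕ) : Fq[X][X] :=
  ∏ m ∈ Finset.range i, (X ^ Fintype.card Fq ^ i - C (X ^ Fintype.card Fq ^ (m + 1)))

/-- The polynomial `∏_{j<i} (θ^{q^i} - θ^{q^j})`. -/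
noncomputable def dPoly (Fq : Type*) [Field Fq] [Fintype Fq] (i : ℕ) : Fq[X] :=
  ∏ j ∈ Finset.range i, (X ^ Fintype.card Fq ^ i - X ^ Fintype.card Fq ^ j)

lemma dPoly_ne_zero (i : ℕ) : dPoly Fq i ≠ 0 := by
  refine Finset.prod_ne_zero_iff.2 fun j hj => sub_ne_zero.2 fun h => ?_
  have := pow_card_injective (Fq := Fq) (ϑ := X) (by simp) h
  simp only [Finset.mem_range] at hj
  omega

lemma coeffDeg_X_pow_sub_C (e m : ℕ) :
    CoeffDeg m (X ^ e - C (X ^ m) : Fq[X][X]) := fun j => by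
  rw [coeff_sub, coeff_X_pow, coeff_C]
  refine (natDegree_sub_le _ _).trans (max_le ?_ ?_) <;> split_ifs <;> simp

lemma coeffDeg_gPoly (i : ℕ) :
    CoeffDeg (∑ m ∈ Finset.range i, Fintype.card Fq ^ (m + 1)) (gPoly Fq i) := by
  unfold gPoly
  generalize Fintype.card Fq ^ i = e
  induction i with
  | zero => simpa using CoeffDeg.one
  | succ i ih =>
    rw [Finset.prod_range_succ, Finset.sum_range_succ]
    exact ih.mul (coeffDeg_X_pow_sub_C _ _)

lemma geom_sum_identity (q d : ℕ) (hq : 1 ≤ q) :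
    (q - 1) * ∑ m ∈ Finset.range d, q ^ (m + 1) + q = q ^ (d + 1) := by
  obtain ⟨r, rfl⟩ := Nat.exists_eq_add_of_le hq
  rw [Nat.add_sub_cancel_left]
  induction d with
  | zero => simp
  | succ d ih =>
    rw [Finset.sum_range_succ, pow_succ _ (d + 1), mul_add]
    linarith

lemma coeffDeg_map_C (γ : Fq[X]) : CoeffDeg 0 (γ.map C : Fq[X][X]) := fun m => by simp

lemma twP_map_C (d : ℕ) (γ : Fq[X]) : twP Fq d (γ.map C : Fq[X][X]) = γ.map C := by
  ext1 m
  rw [coeff_twP, coeff_map, ← C_pow, FiniteField.pow_card_pow]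

lemma eval_X_map_C (γ : Fq[X]) : (γ.map C : Fq[X][X]).eval X = γ := by
  rw [eval_map, eval₂_C_X]

variable {E : Type*} [Field E] [Algebra Fq E] (φ : Fq[X] →+* E)

/-- `∏_{j=1}^d (θ - θ^{q^j})`. -/
noncomputable def ell (d : ℕ) : E := ∏ j ∈ Finset.range d, (node φ 0 - node φ (j + 1))

/-- `RepBy φ γ w f` says that `γ f(d) ℓ_d^w` is the value at `t = θ` of the `d`-th twist of
a fixed polynomial whose coefficients have small degree. -/
def RepBy (γ : Fq[X]) (w : ℕ) (f : ℕ → E) : Prop :=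
  ∃ (g : ℕ) (H : Fq[X][X]), CoeffDeg g H ∧
    (Fintype.card Fq - 1) * g < w * Fintype.card Fq ∧
      ∀ d, φ γ * f d * ell φ d ^ w = φ ((twP Fq d H).eval X)

variable {φ}

lemma ell_ne_zero (hφ : Function.Injective φ) (d : ℕ) : ell φ d ≠ 0 := by
  refine Finset.prod_ne_zero_iff.2 fun j _ => sub_ne_zero.2 fun h => ?_
  have := node_injective hφ h
  omega

lemma node_pow (i j : ℕ) : node φ j ^ Fintype.card Fq ^ i = node φ (i + j) := by
  rw [node, node, ← pow_mul, ← pow_add, add_comm]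

lemma ell_pow_card (d i : ℕ) :
    ell φ d ^ Fintype.card Fq ^ i = ∏ j ∈ Finset.range d, (node φ i - node φ (i + (j + 1))) := by
  rw [← frob_apply Fq i (ell φ d), ell, map_prod]
  refine Finset.prod_congr rfl fun j _ => ?_
  rw [map_sub, frob_apply, frob_apply, node_pow, node_pow, add_zero]

lemma map_eval_gPoly (i d : ℕ) : φ ((twP Fq d (gPoly Fq i)).eval X) =
    ∏ m ∈ Finset.range i, (node φ i - node φ (d + (m + 1))) := by
  rw [gPoly, map_prod, eval_prod, map_prod]
  refine Finset.prod_congr rfl fun m _ => ?_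
  rw [map_sub, map_pow, twP_X, twP_C, eval_sub, eval_C, eval_pow, eval_X, map_sub, map_pow, map_pow,
    map_pow, ← node, ← node, node_pow]

lemma lagr_mul (hφ : Function.Injective φ) (i d : ℕ) :
    lagr φ i d * φ (dPoly Fq i) * ell φ d ^ Fintype.card Fq ^ i =
      φ ((twP Fq d (gPoly Fq i)).eval X) := by
  rw [map_eval_gPoly, ell_pow_card]
  by_cases hid : i ≤ d
  · obtain ⟨e, rfl⟩ := Nat.exists_eq_add_of_le hid
    have hD : φ (dPoly Fq i) = ∏ j ∈ Finset.range i, (node φ i - node φ j) := by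
      rw [dPoly, map_prod]
      simp [node]
    have hsplit : ∏ j ∈ (Finset.range (i + e + 1)).erase i, (node φ i - node φ j) =
        (∏ j ∈ Finset.range i, (node φ i - node φ j)) *
          ∏ j ∈ Finset.range e, (node φ i - node φ (i + (j + 1))) := by
      have hset : (Finset.range (i + e + 1)).erase i = Finset.range i ∪
          (Finset.range e).image (fun j => i + (j + 1)) := by
        ext j
        simp only [Finset.mem_erase, Finset.mem_range, Finset.mem_union, Finset.mem_image]
        constructor
        · intro h
          rcases lt_or_gt_of_ne h.1 with h' | h'
          · exact Or.inl h'
          · exact Or.inr ⟨j - i - 1, by omega, by omega⟩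
        · rintro (h | ⟨a, ha, rfl⟩) <;> omega
      rw [hset, Finset.prod_union, Finset.prod_image]
      · intro a _ b _ hab
        simpa using hab
      · rw [Finset.disjoint_left]
        intro j hj hj'
        simp only [Finset.mem_range, Finset.mem_image] at hj hj'
        obtain ⟨a, _, rfl⟩ := hj'
        omega
    have hne : ∀ a b, a ≠ b → node φ a - node φ b ≠ 0 := fun a b hab =>
      sub_ne_zero.2 ((node_injective hφ).ne hab)
    rw [lagr, if_pos hid, hsplit, hD, add_comm i e, Finset.prod_range_add]
    have h1 : ∏ j ∈ Finset.range i, (node φ i - node φ j) ≠ 0 :=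
      Finset.prod_ne_zero_iff.2 fun j hj => hne _ _ (by simp at hj; omega)
    have h2 : ∏ j ∈ Finset.range e, (node φ i - node φ (i + (j + 1))) ≠ 0 :=
      Finset.prod_ne_zero_iff.2 fun j hj => hne _ _ (by omega)
    rw [mul_inv]
    field_simp
    refine Finset.prod_congr rfl fun m _ => ?_
    rw [show i + (e + m + 1) = e + i + (m + 1) by omega]
  · rw [lagr, if_neg hid, zero_mul, zero_mul, eq_comm]
    refine Finset.prod_eq_zero (i := i - d - 1) (by simp; omega) ?_
    rw [show d + (i - d - 1 + 1) = i by omega, sub_self]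

namespace RepBy

variable {γ δ : Fq[X]} {w : ℕ} {f : ℕ → E}

lemma mul_left (h : RepBy φ γ w f) (δ : Fq[X]) : RepBy φ (γ * δ) w f := by
  obtain ⟨g, H, hH, hg, h⟩ := h
  refine ⟨g, H * δ.map C, by simpa using hH.mul (coeffDeg_map_C δ), hg, fun d => ?_⟩
  rw [map_mul (twP Fq d), twP_map_C, eval_mul, eval_X_map_C, map_mul, map_mul, ← h]
  ring

lemma of_dvd (h : RepBy φ γ w f) (hd : γ ∣ δ) : RepBy φ δ w f := by
  obtain ⟨c, rfl⟩ := hd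
  exact h.mul_left c

lemma zero (hw : w ≠ 0) : RepBy φ γ w fun _ => 0 :=
  ⟨0, 0, CoeffDeg.zero, by
    have : 0 < Fintype.card Fq := Fintype.card_pos
    positivity, fun d => by simp⟩

lemma add {f' : ℕ → E} (h : RepBy φ γ w f) (h' : RepBy φ γ w f') :
    RepBy φ γ w fun d => f d + f' d := by
  obtain ⟨g, H, hH, hg, h⟩ := h
  obtain ⟨g', H', hH', hg', h'⟩ := h'
  refine ⟨max g g', H + H', (hH.mono (le_max_left _ _)).add (hH'.mono (le_max_right _ _)), ?_,
    fun d => ?_⟩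
  · rcases max_choice g g' with hm | hm <;> rwa [hm]
  · rw [map_add, eval_add, map_add, ← h, ← h']
    ring

lemma sum {ι : Type*} {s : Finset ι} {F : ι → ℕ → E} (hw : w ≠ 0)
    (h : ∀ i ∈ s, RepBy φ γ w (F i)) : RepBy φ γ w fun d => ∑ i ∈ s, F i d := by
  classical
  induction s using Finset.induction_on with
  | empty => simpa using zero hw
  | insert a s ha ih =>
    simp only [Finset.sum_insert ha]
    exact (h a (Finset.mem_insert_self _ _)).add
      (ih fun i hi => h i (Finset.mem_insert_of_mem hi))

lemma lagr_mul (hφ : Function.Injective φ) (h : RepBy φ γ w f) (i : ℕ) :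
    RepBy φ (dPoly Fq i * γ) (Fintype.card Fq ^ i + w) fun d => lagr φ i d * f d := by
  obtain ⟨g, H, hH, hg, h⟩ := h
  refine ⟨_, gPoly Fq i * H, (coeffDeg_gPoly i).mul hH, ?_, fun d => ?_⟩
  · have := geom_sum_identity (Fintype.card Fq) i Fintype.card_pos
    rw [mul_add, add_mul, ← pow_succ]
    omega
  · rw [map_mul (twP Fq d), eval_mul, map_mul, map_mul, ← h, ← DoubleZeta.lagr_mul hφ, pow_add]
    ring

end RepBy

lemma exists_repBy_powerSum (hφ : Function.Injective φ) {s : ℕ} (hs : s ≠ 0) :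
    ∃ γ : Fq[X], γ ≠ 0 ∧ RepBy φ γ s fun d => powerSum φ d s := by
  induction s using Nat.strong_induction_on with
  | _ s ih =>
  obtain ⟨m, rfl⟩ := Nat.exists_eq_succ_of_ne_zero hs
  rcases Nat.eq_zero_or_pos m with rfl | hm
  · refine ⟨1, one_ne_zero, 0, 1, CoeffDeg.one, by
      have : 0 < Fintype.card Fq := Fintype.card_pos
      simpa, fun d => ?_⟩
    have h := DoubleZeta.lagr_mul hφ 0 d
    simp only [powerSum_one hφ]
    simpa [gPoly, dPoly] using h
  · choose! γ hγ hrep using ih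
    set I := (Finset.range m).filter (fun i => Fintype.card Fq ^ i ≤ m) with hI
    have hIlt : ∀ i ∈ I, m + 1 - Fintype.card Fq ^ i < m + 1 ∧
        m + 1 - Fintype.card Fq ^ i ≠ 0 := fun i hi => by
      have := (Finset.mem_filter.1 hi).2
      have := Nat.pos_of_ne_zero (card_pow_ne_zero Fq i)
      omega
    refine ⟨∏ i ∈ I, (dPoly Fq i * γ (m + 1 - Fintype.card Fq ^ i)),
      Finset.prod_ne_zero_iff.2 fun i hi => mul_ne_zero (dPoly_ne_zero i)
        (hγ _ (hIlt i hi).1 (hIlt i hi).2), ?_⟩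
    simp only [Nat.succ_eq_add_one, powerSum_succ hφ _ hm.ne']
    refine RepBy.sum (Nat.succ_ne_zero m) fun i hi => ?_
    have h := (hrep _ (hIlt i hi).1 (hIlt i hi).2).lagr_mul hφ i
    have hle := (Finset.mem_filter.1 hi).2
    rw [show Fintype.card Fq ^ i + (m + 1 - Fintype.card Fq ^ i) = m + 1 by omega] at h
    exact h.of_dvd (Finset.dvd_prod_of_mem
      (fun i => dPoly Fq i * γ (m + 1 - Fintype.card Fq ^ i)) hi)

/-- A common denominator for all power sums of weight less than `n`. -/
lemma exists_common_repBy (hφ : Function.Injective φ) (n : ℕ) :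
    ∃ Γ : Fq[X], Γ ≠ 0 ∧ ∀ s ≠ 0, s < n → RepBy φ Γ s fun d => powerSum φ d s := by
  choose! γ hγ hrep using fun (s : ℕ) (hs : s ≠ 0) => exists_repBy_powerSum hφ hs
  refine ⟨∏ s ∈ (Finset.range n).filter (· ≠ 0), γ s,
    Finset.prod_ne_zero_iff.2 fun s hs => hγ s (Finset.mem_filter.1 hs).2, fun s hs hsn => ?_⟩
  exact (hrep s hs).of_dvd (Finset.dvd_prod_of_mem γ (by simp [hs, hsn]))

end Representation


section LinearFactor

variable {K : Type*} [NormedField K]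

/-- The inverse of `t - a`, expanded at `t = 0`. -/
noncomputable def linv (a : K) : PowerSeries K := PowerSeries.mk fun m => -(a ^ (m + 1))⁻¹

lemma X_sub_C_mul_linv {a : K} (ha : a ≠ 0) :
    (PowerSeries.X - PowerSeries.C a) * linv a = 1 := by
  ext m
  rw [linv, sub_mul, map_sub, PowerSeries.coeff_C_mul, PowerSeries.coeff_mk]
  rcases m with _ | m
  · simp [ha]
  · rw [PowerSeries.coeff_succ_X_mul, PowerSeries.coeff_mk, PowerSeries.coeff_one]
    simp only [Nat.succ_ne_zero, if_false]
    field_simp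
    ring

lemma twS_linv (Fq : Type*) [Field Fq] [Fintype Fq] [Algebra Fq K] (r : ℕ) (a : K) :
    twS Fq r (linv a) = linv (a ^ Fintype.card Fq ^ r) := by
  ext m
  rw [coeff_twS, linv, linv, PowerSeries.coeff_mk, PowerSeries.coeff_mk, ← frob_apply, map_neg,
    map_inv₀, map_pow, frob_apply]

lemma gaussBound_linv {a : K} (ha : a ≠ 0) {ρ : ℝ} (hρ : 0 ≤ ρ) (hle : ρ ≤ ‖a‖) :
    GaussBound ρ ‖a‖⁻¹ (linv a) := fun m => by
  have h0 : 0 < ‖a‖ := norm_pos_iff.2 ha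
  rw [linv, PowerSeries.coeff_mk, norm_neg, norm_inv, norm_pow, inv_mul_le_iff₀ (by positivity),
    pow_succ, mul_assoc, mul_inv_cancel₀ h0.ne', mul_one]
  exact pow_le_pow_left₀ hρ hle m

variable [CompleteSpace K] [IsUltrametricDist K]

lemma evalSeries_linv {a x : K} (hx : ‖x‖ < ‖a‖) : evalSeries x (linv a) = (x - a)⁻¹ := by
  have ha : a ≠ 0 := norm_pos_iff.1 ((norm_nonneg x).trans_lt hx)
  have hcoe : ((X - C a : K[X]) : PowerSeries K) = PowerSeries.X - PowerSeries.C a := by simp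
  obtain ⟨B, hB⟩ := GaussBound.exists_of_polynomial (ρ := max 1 ‖a‖) (le_max_left _ _) (X - C a)
  have hB' := hB.mono_radius (norm_nonneg a) (le_max_right _ _)
  have h := evalSeries_mul hB' (gaussBound_linv ha (norm_nonneg a) le_rfl) hx
  rw [evalSeries_coe, hcoe, X_sub_C_mul_linv ha] at h
  have h1 : evalSeries x (1 : PowerSeries K) = 1 := by
    simpa using evalSeries_coe (x := x) (1 : K[X])
  rw [h1] at h
  exact eq_inv_of_mul_eq_one_right (by simpa using h.symm)

end LinearFactor

section Limits

variable {K : Type*} [NormedField K] [IsUltrametricDist K] {ρ : ℝ}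

lemma eq_zero_of_gaussBound_tendsto (hρ : 0 < ρ) {f : PowerSeries K} {δ : ℕ → ℝ}
    (h : ∀ N, GaussBound ρ (δ N) f) (hδ : Filter.Tendsto δ Filter.atTop (nhds 0)) : f = 0 := by
  ext m
  have hle : ‖PowerSeries.coeff m f‖ * ρ ^ m ≤ 0 :=
    ge_of_tendsto' hδ fun N => h N m
  have : ‖PowerSeries.coeff m f‖ ≤ 0 := by
    by_contra hc
    exact absurd hle (not_le.2 (mul_pos (not_le.1 hc) (pow_pos hρ m)))
  simpa using this

/-- `u` is the sum of the series of power series `∑ T d`, with geometric convergence. -/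
def SumsTo (ρ C β : ℝ) (T : ℕ → PowerSeries K) (u : PowerSeries K) : Prop :=
  ∀ N, GaussBound ρ (C * β ^ N) (u - ∑ d ∈ Finset.range N, T d)

lemma SumsTo.gaussBound {C β : ℝ} {T : ℕ → PowerSeries K} {u : PowerSeries K}
    (h : SumsTo ρ C β T u) : GaussBound ρ C u := by simpa using h 0

lemma SumsTo.zero {C β : ℝ} (hC : 0 ≤ C) (hβ : 0 ≤ β) :
    SumsTo ρ C β (fun _ => (0 : PowerSeries K)) 0 := fun N => by
  simpa using GaussBound.zero (K := K) (ρ := ρ) (by positivity : 0 ≤ C * β ^ N)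

variable [CompleteSpace K]

lemma exists_sumsTo {C β : ℝ} {T : ℕ → PowerSeries K} (hρ : 0 < ρ) (hC : 0 ≤ C) (hβ : 0 ≤ β)
    (hβ1 : β < 1) (hT : ∀ d, GaussBound ρ (C * β ^ d) (T d)) : ∃ u, SumsTo ρ C β T u := by
  refine exists_limit hρ (fun N => by simpa [Finset.sum_range_succ] using hT N) ?_ ?_
  · exact fun a b hab => mul_le_mul_of_nonneg_left (pow_le_pow_of_le_one hβ hβ1.le hab) hC
  · simpa using (tendsto_pow_atTop_nhds_zero_of_lt_one hβ hβ1).const_mul C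

lemma SumsTo.hasSum {C β : ℝ} {T : ℕ → PowerSeries K} {u : PowerSeries K} (hβ : 0 ≤ β)
    (hβ1 : β < 1) (hT : ∀ d, GaussBound ρ (C * β ^ d) (T d)) (h : SumsTo ρ C β T u) {x : K}
    (hx : ‖x‖ < ρ) : HasSum (fun d => evalSeries x (T d)) (evalSeries x u) := by
  have hlim : Filter.Tendsto (fun N : ℕ => C * β ^ N) Filter.atTop (nhds 0) := by
    simpa using (tendsto_pow_atTop_nhds_zero_of_lt_one hβ hβ1).const_mul C
  have hs : Summable fun d => evalSeries x (T d) := by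
    refine NonarchimedeanAddGroup.summable_of_tendsto_cofinite_zero ?_
    rw [Nat.cofinite_eq_atTop]
    exact squeeze_zero_norm (fun d => (hT d).norm_evalSeries_le hx.le) hlim
  have h1 := hs.hasSum.tendsto_sum_nat
  have h2 : Filter.Tendsto (fun N => ∑ d ∈ Finset.range N, evalSeries x (T d)) Filter.atTop
      (nhds (evalSeries x u)) := by
    rw [tendsto_iff_norm_sub_tendsto_zero]
    refine squeeze_zero (fun _ => norm_nonneg _) (fun N => ?_) hlim
    have hsum := GaussBound.sum (s := Finset.range N) (F := T) ((norm_nonneg x).trans hx.le)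
      (hT 0).nonneg (fun d _ => (hT d).mono (mul_le_mul_of_nonneg_left
        (pow_le_pow_of_le_one hβ hβ1.le (Nat.zero_le d)) (by simpa using (hT 0).nonneg)))
    rw [← evalSeries_sum (fun d _ => hT d) hx, norm_sub_rev,
      ← evalSeries_sub h.gaussBound hsum hx]
    exact (h N).norm_evalSeries_le hx.le
  rw [← tendsto_nhds_unique h1 h2]
  exact hs.hasSum

/-- A recursion satisfied by the partial sums passes to the limit. -/
lemma SumsTo.twS_eq {Fq : Type*} [Field Fq] [Fintype Fq] [Algebra Fq K] {C β C' β' A A' : ℝ}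
    {T T' : ℕ → PowerSeries K} {u u' M B H : PowerSeries K} (hρ : 1 ≤ ρ)
    (hβ : 0 ≤ β) (hβ1 : β < 1) (hβ' : 0 ≤ β') (hβ1' : β' < 1)
    (h : SumsTo ρ C β T u) (h' : SumsTo ρ C' β' T' u')
    (hM : GaussBound ρ A M) (hB : GaussBound ρ A' B)
    (hrec : ∀ N, twS Fq 1 (∑ d ∈ Finset.range N, T d) = M * (∑ d ∈ Finset.range (N + 1), T d -
      B * (∑ d ∈ Finset.range (N + 1), T' d - H))) :
    twS Fq 1 u = M * (u - B * (u' - H)) := by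
  have hρ0 : 0 ≤ ρ := zero_le_one.trans hρ
  rw [← sub_eq_zero]
  set q := Fintype.card Fq with hq
  have hlim : ∀ c b : ℝ, 0 ≤ b → b < 1 →
      Filter.Tendsto (fun N : ℕ => c * b ^ N) Filter.atTop (nhds 0) := fun c b hb hb1 => by
    simpa using (tendsto_pow_atTop_nhds_zero_of_lt_one hb hb1).const_mul c
  have hl1 := hlim C β hβ hβ1
  have hl1' := hlim C' β' hβ' hβ1'
  refine eq_zero_of_gaussBound_tendsto (zero_lt_one.trans_le hρ)
    (δ := fun N => max ((C * β ^ N) ^ q) (A * max (C * β ^ (N + 1)) (A' * (C' * β' ^ (N + 1)))))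
    (fun N => ?_) ?_
  · have e : twS Fq 1 u - M * (u - B * (u' - H)) =
        twS Fq 1 (u - ∑ d ∈ Finset.range N, T d) - M * ((u - ∑ d ∈ Finset.range (N + 1), T d) -
          B * (u' - ∑ d ∈ Finset.range (N + 1), T' d)) := by
      rw [map_sub, hrec]
      ring
    rw [e]
    have h1 : GaussBound ρ ((C * β ^ N) ^ q) (twS Fq 1 (u - ∑ d ∈ Finset.range N, T d)) := by
      have := (h N).twS Fq hρ0 1
      rw [pow_one] at this
      exact this.mono_radius hρ0 (le_self_pow₀ hρ Fintype.card_ne_zero)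
    have h2 := hM.mul hρ0 (((h (N + 1)).mono (le_max_left _ (A' * (C' * β' ^ (N + 1))))).sub hρ0
      ((hB.mul hρ0 (h' (N + 1))).mono (le_max_right (C * β ^ (N + 1)) _)))
    exact (h1.mono (le_max_left _ _)).sub hρ0 (h2.mono (le_max_right _ _))
  · have t1 := hl1.pow q
    have t2 := (((Filter.tendsto_add_atTop_iff_nat 1).2 hl1).max
      (((Filter.tendsto_add_atTop_iff_nat 1).2 hl1').const_mul A')).const_mul A
    have := t1.max t2
    simpa [zero_pow (Fintype.card_ne_zero (α := Fq)), hq] using this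

end Limits

section Terms

variable {Fq : Type*} [Field Fq] [Fintype Fq] {K : Type*} [NormedField K] [Algebra Fq K]
  (φ : Fq[X] →+* K)

/-- The inverse of `∏_{j=1}^d (t - θ^{q^j})`. -/
noncomputable def lser (d : ℕ) : PowerSeries K := ∏ j ∈ Finset.range d, linv (node φ (j + 1))

/-- The deformation of a power sum. -/
noncomputable def term (H : Fq[X][X]) (s d : ℕ) : PowerSeries K :=
  toS φ (twP Fq d H) * lser φ d ^ s

variable {φ}

lemma toS_X_sub_C (a : Fq[X]) :
    toS φ (X - C a) = PowerSeries.X - PowerSeries.C (φ a) := by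
  simp [toS_apply]

lemma node_ne_zero (hφ : Function.Injective φ) (j : ℕ) : node φ j ≠ 0 :=
  pow_ne_zero _ ((map_ne_zero_iff φ hφ).2 X_ne_zero)

lemma mul_lser_succ (hφ : Function.Injective φ) (d : ℕ) :
    toS φ (X - C (X ^ Fintype.card Fq)) * lser φ (d + 1) = twS Fq 1 (lser φ d) := by
  have hn : φ (X ^ Fintype.card Fq) = node φ 1 := by simp [node]
  rw [toS_X_sub_C, hn, lser, lser, Finset.prod_range_succ', map_prod, mul_comm, mul_assoc, zero_add,
    mul_comm (linv _), X_sub_C_mul_linv (node_ne_zero hφ 1), mul_one]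
  refine Finset.prod_congr rfl fun j _ => ?_
  rw [twS_linv, node_pow, add_comm]

lemma mul_term_succ (hφ : Function.Injective φ) (H : Fq[X][X]) (s d : ℕ) :
    toS φ (X - C (X ^ Fintype.card Fq)) ^ s * term φ H s (d + 1) = twS Fq 1 (term φ H s d) := by
  rw [term, term, map_mul, twS_toS, twP_twP, add_comm 1 d, map_pow (twS Fq 1), ← mul_lser_succ hφ]
  ring

lemma term_zero (H : Fq[X][X]) (s : ℕ) : term φ H s 0 = toS φ H := by
  simp [term, lser, twP_zero_left]

variable [IsUltrametricDist K]

lemma injective_of_norm (hφ : ∀ a ≠ 0, ‖φ a‖ = (Fintype.card Fq : ℝ) ^ a.natDegree)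
    : Function.Injective φ := by
  rw [injective_iff_map_eq_zero]
  intro a ha
  by_contra h
  have := hφ a h
  rw [ha, norm_zero] at this
  exact pow_ne_zero _ (Nat.cast_ne_zero.2 Fintype.card_ne_zero) this.symm

lemma norm_node (hφ : ∀ a ≠ 0, ‖φ a‖ = (Fintype.card Fq : ℝ) ^ a.natDegree)
    (j : ℕ) : ‖node φ j‖ = (Fintype.card Fq : ℝ) ^ Fintype.card Fq ^ j := by
  rw [node, norm_pow, hφ X X_ne_zero, natDegree_X, pow_one]

lemma card_pow_le_norm_node (hφ : ∀ a ≠ 0, ‖φ a‖ = (Fintype.card Fq : ℝ) ^ a.natDegree)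
    (j : ℕ) :
    (Fintype.card Fq : ℝ) ^ Fintype.card Fq ≤ ‖node φ (j + 1)‖ := by
  rw [norm_node hφ]
  refine pow_le_pow_right₀ (by exact_mod_cast Fintype.card_pos) ?_
  exact le_self_pow₀ Fintype.card_pos (Nat.succ_ne_zero j)

lemma gaussBound_lser (hφ : ∀ a ≠ 0, ‖φ a‖ = (Fintype.card Fq : ℝ) ^ a.natDegree)
    (d : ℕ) : GaussBound ((Fintype.card Fq : ℝ) ^ Fintype.card Fq)
    (((Fintype.card Fq : ℝ) ^ ∑ j ∈ Finset.range d, Fintype.card Fq ^ (j + 1))⁻¹) (lser φ d) := by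
  induction d with
  | zero => simpa [lser] using GaussBound.one
  | succ d ih =>
    rw [lser, Finset.prod_range_succ, Finset.sum_range_succ, pow_add, mul_inv,
      ← norm_node hφ (d + 1)]
    exact ih.mul (by positivity) (gaussBound_linv (node_ne_zero (injective_of_norm hφ) _)
      (by positivity) (card_pow_le_norm_node hφ d))

/-- The terms decay geometrically. -/
lemma exists_gaussBound_term (hφ : ∀ a ≠ 0, ‖φ a‖ = (Fintype.card Fq : ℝ) ^ a.natDegree)
    {g s : ℕ} {H : Fq[X][X]} (hH : CoeffDeg g H)
    (hg : (Fintype.card Fq - 1) * g < s * Fintype.card Fq) :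
    ∃ C β : ℝ, 0 ≤ C ∧ 0 ≤ β ∧ β < 1 ∧ ∀ d, GaussBound ((Fintype.card Fq : ℝ) ^ Fintype.card Fq)
      (C * β ^ d) (term φ H s d) := by
  set q := Fintype.card Fq with hqdef
  have hq : 1 < q := Fintype.one_lt_card
  have hqR : (1 : ℝ) < q := by exact_mod_cast hq
  set β : ℝ := (q : ℝ) ^ (-(1 : ℝ) / ((q - 1 : ℕ) : ℝ)) with hβdef
  have hβ0 : 0 < β := by positivity
  have hq1 : (0 : ℝ) < ((q - 1 : ℕ) : ℝ) := by exact_mod_cast Nat.sub_pos_of_lt hq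
  have hβ1 : β < 1 := Real.rpow_lt_one_of_one_lt_of_neg hqR
    (div_neg_of_neg_of_pos (by norm_num) hq1)
  have hβq : β ^ (q - 1) = (q : ℝ)⁻¹ := by
    rw [hβdef, ← Real.rpow_natCast, ← Real.rpow_mul (by positivity), div_mul_cancel₀ _ hq1.ne',
      Real.rpow_neg_one]
  refine ⟨((q : ℝ) ^ q) ^ H.natDegree * (β ^ (s * q))⁻¹, β, by positivity, hβ0.le, hβ1,
    fun d => ?_⟩
  have h1 := (hH.twP d).gaussBound hφ (natDegree_twP_le Fq d H)
    (one_le_pow₀ hqR.le : (1 : ℝ) ≤ (q : ℝ) ^ q)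
  have h2 := (gaussBound_lser hφ d).pow (by positivity) s
  refine (h1.mul (by positivity) h2).mono ?_
  rw [← hqdef]
  set δ := ∑ j ∈ Finset.range d, q ^ (j + 1) with hδ
  have hgeo : (q - 1) * δ + q = q ^ (d + 1) := geom_sum_identity q d hq.le
  have hexp : d + (q - 1) * (q ^ d * g) ≤ (q - 1) * (δ * s) + s * q := by
    have e1 : (q - 1) * (δ * s) + s * q = q ^ d * (s * q) := by
      rw [← mul_assoc, mul_comm s q, ← add_mul, hgeo, pow_succ]
      ring
    have e2 : q ^ d * ((q - 1) * g + 1) ≤ q ^ d * (s * q) := Nat.mul_le_mul_left _ hg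
    have e3 : d < q ^ d := Nat.lt_pow_self hq
    rw [e1]
    refine le_trans ?_ e2
    rw [mul_add, mul_left_comm]
    omega
  have hpow : β ^ ((q - 1) * (δ * s) + s * q) ≤ β ^ (d + (q - 1) * (q ^ d * g)) :=
    pow_le_pow_of_le_one hβ0.le hβ1.le hexp
  rw [pow_add, pow_add, pow_mul β (q - 1), pow_mul β (q - 1), hβq, inv_pow, inv_pow, ← inv_pow,
    ← div_eq_mul_inv, le_div_iff₀ (by positivity)] at hpow
  rw [inv_pow, ← pow_mul (q : ℝ) δ s]
  rw [mul_right_comm, mul_comm, mul_assoc (((q : ℝ) ^ q) ^ H.natDegree)]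
  refine mul_le_mul_of_nonneg_left ?_ (by positivity)
  rw [← div_eq_inv_mul, le_div_iff₀ (by positivity)]
  calc _ = (q : ℝ)⁻¹ ^ (δ * s) * β ^ (s * q) * (q : ℝ) ^ (q ^ d * g) := by
        rw [inv_pow]; ring
    _ ≤ _ := hpow

variable [CompleteSpace K]

lemma norm_X_lt (hφ : ∀ a ≠ 0, ‖φ a‖ = (Fintype.card Fq : ℝ) ^ a.natDegree)
    : ‖φ X‖ < (Fintype.card Fq : ℝ) ^ Fintype.card Fq := by
  have hq : 1 < Fintype.card Fq := Fintype.one_lt_card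
  have hqR : (1 : ℝ) < Fintype.card Fq := by exact_mod_cast hq
  rw [hφ X X_ne_zero, natDegree_X]
  exact pow_lt_pow_right₀ hqR hq

lemma evalSeries_lser (hφ : ∀ a ≠ 0, ‖φ a‖ = (Fintype.card Fq : ℝ) ^ a.natDegree)
    (d : ℕ) : evalSeries (φ X) (lser φ d) = (ell φ d)⁻¹ := by
  have hlt := norm_X_lt hφ
  induction d with
  | zero => simpa [lser, ell] using evalSeries_coe (x := φ X) (1 : K[X])
  | succ d ih =>
    have h := gaussBound_lser hφ d
    rw [lser] at h ih ⊢
    rw [Finset.prod_range_succ, evalSeries_mul h (gaussBound_linv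
      (node_ne_zero (injective_of_norm hφ) _) (by positivity) (card_pow_le_norm_node hφ d)) hlt, ih,
      evalSeries_linv (hlt.trans_le (card_pow_le_norm_node hφ d)), ell, ell,
      Finset.prod_range_succ, mul_inv]
    simp [node]

lemma evalSeries_term (hφ : ∀ a ≠ 0, ‖φ a‖ = (Fintype.card Fq : ℝ) ^ a.natDegree)
    (H : Fq[X][X]) (s d : ℕ) :
    evalSeries (φ X) (term φ H s d) = φ ((twP Fq d H).eval X) * (ell φ d ^ s)⁻¹ := by
  have hlt := norm_X_lt hφ
  have hqR : (1 : ℝ) ≤ Fintype.card Fq := by exact_mod_cast Fintype.card_pos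
  obtain ⟨B, hB⟩ := GaussBound.exists_of_polynomial
    (one_le_pow₀ hqR : (1 : ℝ) ≤ (Fintype.card Fq : ℝ) ^ Fintype.card Fq) ((twP Fq d H).map φ)
  rw [← toS_apply] at hB
  have h := gaussBound_lser hφ d
  rw [term, evalSeries_mul hB (h.pow (by positivity) s) hlt, evalSeries_pow h hlt,
    evalSeries_toS, evalSeries_lser hφ, inv_pow]

end Terms


section Deformation

variable {Fq : Type*} [Field Fq] [Fintype Fq] {K : Type*} [NormedField K] [Algebra Fq K]
  [IsUltrametricDist K] [CompleteSpace K] {φ : Fq[X] →+* K}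

lemma one_le_radius (Fq : Type*) [Field Fq] [Fintype Fq] :
    (1 : ℝ) ≤ (Fintype.card Fq : ℝ) ^ Fintype.card Fq :=
  one_le_pow₀ (by exact_mod_cast Fintype.card_pos)

lemma exists_gaussBound_toS (p : Fq[X][X]) :
    ∃ A, GaussBound ((Fintype.card Fq : ℝ) ^ Fintype.card Fq) A (toS φ p) :=
  GaussBound.exists_of_polynomial (one_le_radius Fq) (p.map φ)

lemma twS_sum_term (hφ : Function.Injective φ) (H : Fq[X][X]) (s N : ℕ) :
    twS Fq 1 (∑ d ∈ Finset.range N, term φ H s d) =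
      toS φ (X - C (X ^ Fintype.card Fq)) ^ s *
        (∑ d ∈ Finset.range (N + 1), term φ H s d - toS φ H) := by
  rw [Finset.sum_range_succ', term_zero, add_sub_cancel_right, map_sum, Finset.mul_sum]
  exact Finset.sum_congr rfl fun d _ => (mul_term_succ hφ H s d).symm

lemma twS_zeta_series (hφ : Function.Injective φ) {H : Fq[X][X]} {s : ℕ} {C₁ β : ℝ}
    {u : PowerSeries K} (hβ : 0 ≤ β) (hβ1 : β < 1)
    (hu : SumsTo ((Fintype.card Fq : ℝ) ^ Fintype.card Fq) C₁ β (term φ H s) u) :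
    twS Fq 1 u = toS φ (X - C (X ^ Fintype.card Fq)) ^ s * (u - toS φ H) := by
  obtain ⟨A, hA⟩ := exists_gaussBound_toS (φ := φ) (X - C (X ^ Fintype.card Fq))
  have h := hu.twS_eq (Fq := Fq) (B := 1) (H := -toS φ H) (one_le_radius Fq) hβ hβ1 hβ hβ1
    (SumsTo.zero hu.gaussBound.nonneg hβ) (hA.pow (by positivity) s) GaussBound.one (fun N => by
      rw [twS_sum_term hφ]
      simp)
  simpa using h

/-- The deformation of the `d`-th part of a double zeta value. -/
noncomputable def doubleTerm (φ : Fq[X] →+* K) (H₁ H₂ : Fq[X][X]) (s₁ s₂ d : ℕ) :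
    PowerSeries K :=
  term φ H₁ s₁ d * ∑ e ∈ Finset.range d, term φ H₂ s₂ e

lemma twS_sum_doubleTerm (hφ : Function.Injective φ) (H₁ H₂ : Fq[X][X]) (s₁ s₂ N : ℕ) :
    twS Fq 1 (∑ d ∈ Finset.range N, doubleTerm φ H₁ H₂ s₁ s₂ d) =
      toS φ (X - C (X ^ Fintype.card Fq)) ^ (s₁ + s₂) *
        (∑ d ∈ Finset.range (N + 1), doubleTerm φ H₁ H₂ s₁ s₂ d -
          toS φ H₂ * (∑ d ∈ Finset.range (N + 1), term φ H₁ s₁ d - toS φ H₁)) := by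
  have h0 : doubleTerm φ H₁ H₂ s₁ s₂ 0 = 0 := by simp [doubleTerm]
  rw [Finset.sum_range_succ', Finset.sum_range_succ' (fun d => term φ H₁ s₁ d), term_zero,
    add_sub_cancel_right, h0, add_zero, map_sum, Finset.mul_sum, ← Finset.sum_sub_distrib,
    Finset.mul_sum]
  refine Finset.sum_congr rfl fun d _ => ?_
  rw [doubleTerm, map_mul, twS_sum_term hφ, ← mul_term_succ hφ, doubleTerm, pow_add]
  ring

lemma gaussBound_doubleTerm {H₁ H₂ : Fq[X][X]} {s₁ s₂ : ℕ} {C₁ C₂ β₁ β₂ ρ : ℝ} (hρ : 0 ≤ ρ)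
    (hβ₂ : 0 ≤ β₂) (hβ₂' : β₂ < 1)
    (h₁ : ∀ d, GaussBound ρ (C₁ * β₁ ^ d) (term φ H₁ s₁ d))
    (h₂ : ∀ d, GaussBound ρ (C₂ * β₂ ^ d) (term φ H₂ s₂ d)) (d : ℕ) :
    GaussBound ρ (C₁ * C₂ * β₁ ^ d) (doubleTerm φ H₁ H₂ s₁ s₂ d) := by
  have hC₂ : 0 ≤ C₂ := by simpa using (h₂ 0).nonneg
  have h := (h₁ d).mul hρ (GaussBound.sum (s := Finset.range d) hρ hC₂ fun e _ =>
    (h₂ e).mono (mul_le_of_le_one_right hC₂ (pow_le_one₀ hβ₂ hβ₂'.le)))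
  rw [mul_right_comm] at h
  exact h

lemma exists_double_series (hφ : ∀ a ≠ 0, ‖φ a‖ = (Fintype.card Fq : ℝ) ^ a.natDegree)
    {H₁ H₂ : Fq[X][X]} {s₁ s₂ : ℕ} {C₁ C₂ β₁ β₂ : ℝ} {u : PowerSeries K}
    (hβ₁ : 0 ≤ β₁) (hβ₁' : β₁ < 1) (hβ₂ : 0 ≤ β₂) (hβ₂' : β₂ < 1)
    (h₁ : ∀ d, GaussBound ((Fintype.card Fq : ℝ) ^ Fintype.card Fq) (C₁ * β₁ ^ d)
      (term φ H₁ s₁ d))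
    (h₂ : ∀ d, GaussBound ((Fintype.card Fq : ℝ) ^ Fintype.card Fq) (C₂ * β₂ ^ d)
      (term φ H₂ s₂ d))
    (hu : SumsTo ((Fintype.card Fq : ℝ) ^ Fintype.card Fq) C₁ β₁ (term φ H₁ s₁) u) :
    ∃ v M, GaussBound ((Fintype.card Fq : ℝ) ^ Fintype.card Fq) M v ∧
      twS Fq 1 v = toS φ (X - C (X ^ Fintype.card Fq)) ^ (s₁ + s₂) *
        (v - toS φ H₂ * (u - toS φ H₁)) ∧
      HasSum (fun d => evalSeries (φ X) (term φ H₁ s₁ d) *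
        ∑ e ∈ Finset.range d, evalSeries (φ X) (term φ H₂ s₂ e)) (evalSeries (φ X) v) := by
  have hinj := injective_of_norm hφ
  have hρ1 := one_le_radius Fq
  have hρ0 := zero_lt_one.trans_le hρ1
  have hC₁ : 0 ≤ C₁ := by simpa using (h₁ 0).nonneg
  have hC₂ : 0 ≤ C₂ := by simpa using (h₂ 0).nonneg
  have hb := gaussBound_doubleTerm hρ0.le hβ₂ hβ₂' h₁ h₂
  obtain ⟨v, hv⟩ := exists_sumsTo hρ0 (mul_nonneg hC₁ hC₂) hβ₁ hβ₁' hb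
  obtain ⟨A, hA⟩ := exists_gaussBound_toS (φ := φ) (X - C (X ^ Fintype.card Fq))
  obtain ⟨A', hA'⟩ := exists_gaussBound_toS (φ := φ) H₂
  refine ⟨v, _, hv.gaussBound, hv.twS_eq hρ1 hβ₁ hβ₁' hβ₁ hβ₁' hu (hA.pow hρ0.le _) hA'
    (twS_sum_doubleTerm hinj H₁ H₂ s₁ s₂), ?_⟩
  have hs := hv.hasSum hβ₁ hβ₁' hb (norm_X_lt hφ)
  refine hs.congr_fun fun d => ?_
  rw [doubleTerm, evalSeries_mul (h₁ d) (GaussBound.sum (s := Finset.range d) hρ0.le hC₂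
    fun e _ => (h₂ e).mono (mul_le_of_le_one_right hC₂ (pow_le_one₀ hβ₂ hβ₂'.le))) (norm_X_lt hφ),
    evalSeries_sum (fun e _ => h₂ e) (norm_X_lt hφ)]

lemma powerSum_zero_left (s : ℕ) : powerSum φ 0 s = 1 := by
  have : monics Fq 0 = {1} := by
    ext a
    rw [mem_monics, Finset.mem_singleton]
    constructor
    · rintro ⟨h, h0⟩
      exact h.natDegree_eq_zero.1 h0
    · rintro rfl
      simp
  simp [powerSum, this]

lemma norm_powerSum_le (hφ : ∀ a ≠ 0, ‖φ a‖ = (Fintype.card Fq : ℝ) ^ a.natDegree) (d s : ℕ) :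
    ‖powerSum φ d s‖ ≤ (((Fintype.card Fq : ℝ) ^ d) ^ s)⁻¹ := by
  refine IsUltrametricDist.norm_sum_le_of_forall_le_of_nonneg (by positivity) fun a ha => ?_
  rw [norm_inv, norm_pow, hφ a (ne_zero_of_mem_monics ha), (mem_monics.1 ha).2]

lemma ne_zero_of_hasSum {f : ℕ → K} {a : K} {B : ℝ} (h : HasSum f a) (hB : 0 ≤ B)
    (h0 : B < ‖f 0‖) (hf : ∀ d, ‖f (d + 1)‖ ≤ B) : a ≠ 0 := by
  rintro rfl
  have h1 := (hasSum_nat_add_iff' 1).2 h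
  have h2 := IsUltrametricDist.norm_tsum_le_of_forall_le_of_nonneg hB hf
  rw [h1.tsum_eq] at h2
  simp only [Finset.range_one, Finset.sum_singleton, zero_sub, norm_neg] at h2
  exact absurd h2 (not_le.2 h0)

lemma zeta_ne_zero (hφ : ∀ a ≠ 0, ‖φ a‖ = (Fintype.card Fq : ℝ) ^ a.natDegree) {Γ : Fq[X]}
    (hΓ : Γ ≠ 0) {s : ℕ} (hs : s ≠ 0) {a : K}
    (h : HasSum (fun d => φ Γ * powerSum φ d s) a) : a ≠ 0 := by
  have hΓ' : 0 < ‖φ Γ‖ := norm_pos_iff.2 ((map_ne_zero_iff φ (injective_of_norm hφ)).2 hΓ)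
  have hq : (1 : ℝ) < Fintype.card Fq := by exact_mod_cast Fintype.one_lt_card
  refine ne_zero_of_hasSum (B := ‖φ Γ‖ * (Fintype.card Fq : ℝ)⁻¹) h (by positivity) ?_ fun d => ?_
  · rw [powerSum_zero_left, mul_one]
    exact mul_lt_of_lt_one_right hΓ' (inv_lt_one_of_one_lt₀ hq)
  · rw [norm_mul]
    refine mul_le_mul_of_nonneg_left ((norm_powerSum_le hφ _ _).trans ?_) hΓ'.le
    refine inv_anti₀ (by positivity) ?_
    rw [← pow_mul]
    exact le_self_pow₀ hq.le (by positivity)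

end Deformation


section Omega

variable {K : Type*} [NormedField K]

/-- The inverse of `1 - t / a`. -/
noncomputable def zfac (a : K) : PowerSeries K := PowerSeries.C (-a) * linv a

lemma X_sub_C_mul_zfac {a : K} (ha : a ≠ 0) :
    (PowerSeries.X - PowerSeries.C a) * zfac a = PowerSeries.C (-a) := by
  rw [zfac, mul_left_comm, X_sub_C_mul_linv ha, mul_one]

lemma zfac_sub_one {a : K} (ha : a ≠ 0) : zfac a - 1 = -(PowerSeries.X * linv a) := by
  have h := X_sub_C_mul_linv ha
  rw [zfac, map_neg]
  linear_combination h

lemma gaussBound_X {ρ : ℝ} (hρ : 0 ≤ ρ) : GaussBound ρ ρ (PowerSeries.X : PowerSeries K) :=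
  fun m => by
    rw [PowerSeries.coeff_X]
    split_ifs with h
    · simp [h]
    · simpa using hρ

lemma twS_zfac (Fq : Type*) [Field Fq] [Fintype Fq] [Algebra Fq K] (r : ℕ) (a : K) :
    twS Fq r (zfac a) = zfac (a ^ Fintype.card Fq ^ r) := by
  rw [zfac, zfac, map_mul, twS_linv]
  congr 1
  rw [twS, PowerSeries.map_C, map_neg, frob_apply]

variable [IsUltrametricDist K]

lemma gaussBound_zfac {a : K} (ha : a ≠ 0) {ρ : ℝ} (hρ : 0 ≤ ρ) (hle : ρ ≤ ‖a‖) :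
    GaussBound ρ 1 (zfac a) := by
  have h := (GaussBound.const (ρ := ρ) (-a)).mul hρ (gaussBound_linv ha hρ hle)
  rwa [norm_neg, mul_inv_cancel₀ (norm_ne_zero_iff.2 ha)] at h

lemma gaussBound_zfac_sub_one {a : K} (ha : a ≠ 0) {ρ : ℝ} (hρ : 0 ≤ ρ) (hle : ρ ≤ ‖a‖) :
    GaussBound ρ (ρ * ‖a‖⁻¹) (zfac a - 1) := by
  rw [zfac_sub_one ha]
  exact ((gaussBound_X hρ).mul hρ (gaussBound_linv ha hρ hle)).neg

lemma evalSeries_zfac [CompleteSpace K] {a x : K} (hx : ‖x‖ < ‖a‖) :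
    evalSeries x (zfac a) = (1 - x / a)⁻¹ := by
  have ha : a ≠ 0 := norm_pos_iff.1 ((norm_nonneg x).trans_lt hx)
  have hC : evalSeries x (PowerSeries.C (-a)) = -a := by
    simpa using evalSeries_coe (x := x) (C (-a) : K[X])
  have hxa : x - a ≠ 0 := sub_ne_zero.2 fun h => by simp [h] at hx
  have hxa' : a - x ≠ 0 := sub_ne_zero.2 fun h => by simp [h] at hx
  rw [zfac, evalSeries_mul (GaussBound.const (-a)) (gaussBound_linv ha (norm_nonneg a) le_rfl) hx,
    evalSeries_linv hx, hC, one_sub_div ha, inv_div, ← neg_sub a x, inv_neg, neg_mul_neg,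
    div_eq_mul_inv]

variable {Fq : Type*} [Field Fq] [Fintype Fq] [Algebra Fq K]

/-- The partial products of the Carlitz period. -/
noncomputable def zprod (φ : Fq[X] →+* K) (N : ℕ) : PowerSeries K :=
  ∏ i ∈ Finset.range N, zfac (node φ (i + 1))

variable {φ : Fq[X] →+* K}

lemma mul_zprod_succ (hφ : Function.Injective φ) (N : ℕ) :
    (PowerSeries.X - PowerSeries.C (node φ 1)) * zprod φ (N + 1) =
      PowerSeries.C (-node φ 1) * twS Fq 1 (zprod φ N) := by
  rw [zprod, zprod, Finset.prod_range_succ', zero_add, mul_comm (∏ i ∈ _, _), ← mul_assoc,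
    X_sub_C_mul_zfac (node_ne_zero hφ 1), map_prod]
  congr 1
  refine Finset.prod_congr rfl fun i _ => ?_
  rw [twS_zfac, node_pow, add_comm]

lemma gaussBound_zprod (hφ : ∀ a ≠ 0, ‖φ a‖ = (Fintype.card Fq : ℝ) ^ a.natDegree) (N : ℕ) :
    GaussBound ((Fintype.card Fq : ℝ) ^ Fintype.card Fq) 1 (zprod φ N) := by
  induction N with
  | zero => simpa [zprod] using GaussBound.one
  | succ N ih =>
    rw [zprod, Finset.prod_range_succ, ← zprod]
    simpa using ih.mul (by positivity) (gaussBound_zfac (node_ne_zero (injective_of_norm hφ) _)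
      (by positivity) (card_pow_le_norm_node hφ N))

lemma gaussBound_zprod_sub (hφ : ∀ a ≠ 0, ‖φ a‖ = (Fintype.card Fq : ℝ) ^ a.natDegree) (N : ℕ) :
    GaussBound ((Fintype.card Fq : ℝ) ^ Fintype.card Fq) ((Fintype.card Fq : ℝ)⁻¹ ^ N)
      (zprod φ (N + 1) - zprod φ N) := by
  have hq : 1 < Fintype.card Fq := Fintype.one_lt_card
  have hqR : (1 : ℝ) ≤ Fintype.card Fq := by exact_mod_cast hq.le
  have e : zprod φ (N + 1) - zprod φ N = zprod φ N * (zfac (node φ (N + 1)) - 1) := by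
    rw [zprod, Finset.prod_range_succ, ← zprod]
    ring
  rw [e]
  refine ((gaussBound_zprod hφ N).mul (by positivity) (gaussBound_zfac_sub_one
    (node_ne_zero (injective_of_norm hφ) _) (by positivity) (card_pow_le_norm_node hφ N))).mono ?_
  rw [one_mul, norm_node hφ, ← div_eq_mul_inv, div_le_iff₀ (by positivity), inv_pow,
    ← div_eq_inv_mul, le_div_iff₀ (by positivity), ← pow_add]
  refine pow_le_pow_right₀ hqR ?_
  have h1 : N + 1 ≤ Fintype.card Fq ^ N := Nat.lt_pow_self hq
  calc Fintype.card Fq + N ≤ Fintype.card Fq * (N + 1) := by nlinarith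
    _ ≤ Fintype.card Fq * Fintype.card Fq ^ N := Nat.mul_le_mul_left _ h1
    _ = _ := by rw [pow_succ, mul_comm]

variable [CompleteSpace K]

lemma exists_period_series (hφ : ∀ a ≠ 0, ‖φ a‖ = (Fintype.card Fq : ℝ) ^ a.natDegree) :
    ∃ z : PowerSeries K, GaussBound ((Fintype.card Fq : ℝ) ^ Fintype.card Fq) 1 z ∧
      (PowerSeries.X - PowerSeries.C (node φ 1)) * z =
        PowerSeries.C (-node φ 1) * twS Fq 1 z ∧
      Filter.Tendsto (fun N => ∏ i ∈ Finset.range N, (1 - φ X / node φ (i + 1))⁻¹) Filter.atTop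
        (nhds (evalSeries (φ X) z)) := by
  set q := Fintype.card Fq with hqdef
  have hqR : (1 : ℝ) < q := by exact_mod_cast Fintype.one_lt_card
  have hinj := injective_of_norm hφ
  have hρ1 := one_le_radius Fq
  have hρ0 := zero_lt_one.trans_le hρ1
  have hlim : Filter.Tendsto (fun N : ℕ => (q : ℝ)⁻¹ ^ N) Filter.atTop (nhds 0) :=
    tendsto_pow_atTop_nhds_zero_of_lt_one (by positivity) (inv_lt_one_of_one_lt₀ hqR)
  obtain ⟨z, hz⟩ := exists_limit hρ0 (gaussBound_zprod_sub hφ)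
    (fun a b hab => pow_le_pow_of_le_one (by positivity) (inv_lt_one_of_one_lt₀ hqR).le hab) hlim
  have hz1 : GaussBound ((q : ℝ) ^ q) 1 z := by
    have h := (hz 0).add hρ0.le (by simpa using gaussBound_zprod hφ 0)
    simpa using h
  refine ⟨z, hz1, ?_, ?_⟩
  · rw [← sub_eq_zero]
    obtain ⟨A, hA⟩ := exists_gaussBound_toS (φ := φ) (X - C (X ^ q))
    have hn : φ (X ^ q) = node φ 1 := by simp [node, hqdef]
    rw [toS_X_sub_C, hn] at hA
    refine eq_zero_of_gaussBound_tendsto hρ0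
      (δ := fun N => max (A * (q : ℝ)⁻¹ ^ (N + 1)) (‖-node φ 1‖ * ((q : ℝ)⁻¹ ^ N) ^ q))
      (fun N => ?_) ?_
    · have e : (PowerSeries.X - PowerSeries.C (node φ 1)) * z -
          PowerSeries.C (-node φ 1) * twS Fq 1 z =
          (PowerSeries.X - PowerSeries.C (node φ 1)) * (z - zprod φ (N + 1)) -
            PowerSeries.C (-node φ 1) * twS Fq 1 (z - zprod φ N) := by
        rw [map_sub, mul_sub, mul_sub, mul_zprod_succ hinj]
        ring
      rw [e]
      have h1 : GaussBound ((q : ℝ) ^ q) (((q : ℝ)⁻¹ ^ N) ^ q) (twS Fq 1 (z - zprod φ N)) := by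
        have := (hz N).twS Fq hρ0.le 1
        rw [pow_one] at this
        exact this.mono_radius hρ0.le (le_self_pow₀ hρ1 Fintype.card_ne_zero)
      exact ((hA.mul hρ0.le (hz (N + 1))).mono (le_max_left _ _)).sub hρ0.le
        (((GaussBound.const _).mul hρ0.le h1).mono (le_max_right _ _))
    · have t1 := ((Filter.tendsto_add_atTop_iff_nat 1).2 hlim).const_mul A
      have t2 := (hlim.pow q).const_mul ‖-node φ 1‖
      simpa [zero_pow (Fintype.card_ne_zero (α := Fq)), hqdef] using t1.max t2
  · have hlt := norm_X_lt hφ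
    have hev : ∀ N, evalSeries (φ X) (zprod φ N) =
        ∏ i ∈ Finset.range N, (1 - φ X / node φ (i + 1))⁻¹ := by
      intro N
      induction N with
      | zero => simpa [zprod] using evalSeries_coe (x := φ X) (1 : K[X])
      | succ N ih =>
        have h := gaussBound_zprod hφ N
        rw [Finset.prod_range_succ, ← ih]
        rw [zprod] at h ⊢
        rw [Finset.prod_range_succ, evalSeries_mul h (gaussBound_zfac (node_ne_zero hinj _)
          hρ0.le (card_pow_le_norm_node hφ N)) hlt,
          evalSeries_zfac (hlt.trans_le (card_pow_le_norm_node hφ N)), zprod]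
    simp only [← hev]
    rw [tendsto_iff_norm_sub_tendsto_zero]
    refine squeeze_zero (fun _ => norm_nonneg _) (fun N => ?_) hlim
    rw [norm_sub_rev, ← evalSeries_sub hz1 (gaussBound_zprod hφ N) hlt]
    exact (hz N).norm_evalSeries_le hlt.le

lemma multipliable_period_factor
    (hφ : ∀ a ≠ 0, ‖φ a‖ = (Fintype.card Fq : ℝ) ^ a.natDegree) :
    Multipliable fun i : ℕ => (1 - φ X / node φ (i + 1))⁻¹ := by
  have hq : 1 < Fintype.card Fq := Fintype.one_lt_card
  have hqR : (1 : ℝ) < Fintype.card Fq := by exact_mod_cast hq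
  have hx : ∀ i, ‖φ X / node φ (i + 1)‖ ≤ (Fintype.card Fq : ℝ)⁻¹ ^ (i + 1) := fun i => by
    rw [norm_div, norm_node hφ, hφ X X_ne_zero, natDegree_X, div_le_iff₀ (by positivity), inv_pow,
      ← div_eq_inv_mul, le_div_iff₀ (by positivity), ← pow_add]
    refine pow_le_pow_right₀ hqR.le ?_
    have : i + 1 < Fintype.card Fq ^ (i + 1) := Nat.lt_pow_self hq
    omega
  have hx1 : ∀ i, ‖φ X / node φ (i + 1)‖ < 1 := fun i => (hx i).trans_lt
    (pow_lt_one₀ (by positivity) (inv_lt_one_of_one_lt₀ hqR) (Nat.succ_ne_zero i))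
  have h1 : ∀ i, ‖1 - φ X / node φ (i + 1)‖ = 1 := fun i => by
    rw [sub_eq_add_neg, IsUltrametricDist.norm_add_eq_max_of_norm_ne_norm (by
      rw [norm_neg, norm_one]
      exact (hx1 i).ne'), norm_neg, norm_one, max_eq_left (hx1 i).le]
  have hm := multipliable_one_add_of_summable
    (f := fun i : ℕ => (1 - φ X / node φ (i + 1))⁻¹ - 1) (by
      refine Summable.of_nonneg_of_le (fun _ => norm_nonneg _) (fun i => ?_)
        ((summable_nat_add_iff 1).2 (summable_geometric_of_lt_one (by positivity)
          (inv_lt_one_of_one_lt₀ hqR)))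
      have hne : 1 - φ X / node φ (i + 1) ≠ 0 := norm_ne_zero_iff.1 (by rw [h1]; exact one_ne_zero)
      have e : (1 - φ X / node φ (i + 1))⁻¹ - 1 =
          φ X / node φ (i + 1) * (1 - φ X / node φ (i + 1))⁻¹ := by
        field_simp
        ring
      rw [e, norm_mul, norm_inv, h1, inv_one, mul_one]
      exact hx i)
  simpa using hm

/-- The power series deforming the powers of the Carlitz period that lie in `k_∞`. -/
lemma exists_omega (hφ : ∀ a ≠ 0, ‖φ a‖ = (Fintype.card Fq : ℝ) ^ a.natDegree) (m : ℕ) :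
    ∃ (ω : PowerSeries K) (B : ℝ), GaussBound ((Fintype.card Fq : ℝ) ^ Fintype.card Fq) B ω ∧
      twS Fq 1 ω = toS φ (X - C (X ^ Fintype.card Fq)) ^ ((Fintype.card Fq - 1) * m) * ω ∧
      evalSeries (φ X) ω = (-(φ X ^ Fintype.card Fq) *
        ∏' i : ℕ, ((1 - φ X ^ ((1 : ℤ) - (Fintype.card Fq : ℤ) ^ (i + 1)))⁻¹) ^
          (Fintype.card Fq - 1)) ^ m := by
  obtain ⟨z, hz, htw, hlim⟩ := exists_period_series hφ
  have hinj := injective_of_norm hφ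
  have hX : φ X ≠ 0 := (map_ne_zero_iff φ hinj).2 X_ne_zero
  set q := Fintype.card Fq with hqdef
  have hq : 1 < q := Fintype.one_lt_card
  have hn : φ (X ^ q) = node φ 1 := by simp [node, hqdef]
  have hn' : node φ 1 = φ X ^ q := by simp [node, hqdef]
  have hρ0 := zero_lt_one.trans_le (one_le_radius Fq)
  refine ⟨PowerSeries.C ((-node φ 1) ^ m) * z ^ ((q - 1) * m), _,
    (GaussBound.const _).mul hρ0.le (hz.pow hρ0.le _), ?_, ?_⟩
  · rw [map_mul, map_pow (twS Fq 1) z, toS_X_sub_C, hn, mul_left_comm, ← mul_pow, htw, mul_pow,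
      ← mul_assoc, ← map_pow PowerSeries.C, ← map_mul, ← pow_add]
    congr 1
    rw [twS, PowerSeries.map_C, frob_apply, pow_one, ← hqdef, ← pow_mul]
    congr 2
    obtain ⟨r, hr⟩ := Nat.exists_eq_add_of_lt hq
    rw [hr]
    simp
    ring
  · have hC : evalSeries (φ X) (PowerSeries.C ((-node φ 1) ^ m)) = (-node φ 1) ^ m := by
      simpa using evalSeries_coe (x := φ X) (C ((-node φ 1) ^ m) : K[X])
    have hmul := multipliable_period_factor hφ
    have hz' := tendsto_nhds_unique hlim hmul.hasProd.tendsto_prod_nat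
    rw [evalSeries_mul (GaussBound.const _) (hz.pow hρ0.le _) (norm_X_lt hφ), hC,
      evalSeries_pow hz (norm_X_lt hφ), hz', pow_mul, ← mul_pow, hn']
    congr 2
    have hmap := hmul.map_tprod (powMonoidHom (q - 1)) (continuous_pow (q - 1))
    rw [powMonoidHom_apply] at hmap
    rw [hmap]
    refine tprod_congr fun i => ?_
    rw [powMonoidHom_apply, zpow_sub₀ hX, zpow_one, node]
    norm_cast

end Omega


section Independence

variable {Fq : Type*} [Field Fq] [Fintype Fq] {k : Type*} [Field k] [Algebra Fq k]
  [Algebra Fq[X] k] {F : Type*} [Field F] [Algebra k[X] F] [IsFractionRing k[X] F] {σ : F →+* F}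
  {K : Type*} [NormedField K] [CompleteSpace K] [IsUltrametricDist K] [Algebra Fq K]
  {φ : k →+* K}

/-- Elements of suitable absolute value are not `(q-1)`-th powers. -/
lemma pow_card_sub_one_ne
    (hval : ∀ y : K, y ≠ 0 → ∃ z : ℤ, ‖y‖ = (Fintype.card Fq : ℝ) ^ z) {a : K} {e i : ℕ}
    (ha : ‖a‖ = (Fintype.card Fq : ℝ) ^ Fintype.card Fq ^ e)
    (hi : ¬ (Fintype.card Fq - 1) ∣ i) {y : K} (hy : y ≠ 0) :
    y ^ (Fintype.card Fq - 1) ≠ a ^ i := by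
  intro h
  have hq : 1 < Fintype.card Fq := Fintype.one_lt_card
  have hqR : (1 : ℝ) < Fintype.card Fq := by exact_mod_cast hq
  obtain ⟨z, hz⟩ := hval y hy
  have h1 := congrArg norm h
  rw [norm_pow, norm_pow, hz, ha, ← pow_mul, ← zpow_natCast, ← zpow_natCast, ← zpow_mul] at h1
  have h2 := zpow_right_injective₀ (by positivity) hqR.ne' h1
  have h3 : ((Fintype.card Fq - 1 : ℕ) : ℤ) ∣ ((Fintype.card Fq ^ e * i : ℕ) : ℤ) :=
    ⟨z, by rw [← h2, mul_comm]⟩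
  rw [Int.natCast_dvd_natCast] at h3
  have hcop : (Fintype.card Fq - 1).Coprime (Fintype.card Fq) := by
    have := (Nat.coprime_self_add_right (m := Fintype.card Fq - 1) (n := 1)).2 (by simp)
    rwa [Nat.sub_add_cancel hq.le] at this
  exact hi ((hcop.pow_right e).dvd_of_dvd_mul_left h3)

lemma twP_X_sub_C_pow (r : ℕ) : twP Fq r (X - C (X ^ Fintype.card Fq) : Fq[X][X]) =
    X - C (X ^ Fintype.card Fq ^ (r + 1)) := by
  rw [map_sub, twP_X, twP_C, ← pow_mul, ← pow_succ']

lemma frobenius_ne_of_zeta_series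
    (hφ : ∀ a ≠ 0, ‖φ (algebraMap Fq[X] k a)‖ = (Fintype.card Fq : ℝ) ^ a.natDegree)
    (hval : ∀ y : K, y ≠ 0 → ∃ z : ℤ, ‖y‖ = (Fintype.card Fq : ℝ) ^ z)
    (hσ : ∀ p, σ (algebraMap k[X] F p) = algebraMap k[X] F (twP Fq 1 p))
    {i : ℕ} (hi : ¬ (Fintype.card Fq - 1) ∣ i) {c : Fq[X]} (hc : c ≠ 0) {H : Fq[X][X]}
    {u : PowerSeries K} {M : ℝ}
    (hu : GaussBound ((Fintype.card Fq : ℝ) ^ Fintype.card Fq) M u)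
    (hrel : twS Fq 1 u = toS (φ.comp (algebraMap Fq[X] k)) (X - C (X ^ Fintype.card Fq)) ^ i *
      (u - toS (φ.comp (algebraMap Fq[X] k)) H))
    (hev : evalSeries (φ (algebraMap Fq[X] k X)) u ≠ 0) (r : ℕ) (f : F) :
    σ f ≠ algebraMap k[X] F (embP Fq k (X - C (X ^ Fintype.card Fq ^ (r + 1)))) ^ i *
      (f - algebraMap k[X] F (embP Fq k (twP Fq r (c.map C * H)))) := by
  have hinj := algebraMap_injective_of_norm hφ
  have hρ1 := one_le_radius Fq
  have hϑ : (algebraMap Fq[X] k X ^ Fintype.card Fq ^ r) ^ Fintype.card Fq =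
      algebraMap Fq[X] k (X ^ Fintype.card Fq ^ (r + 1)) := by
    rw [← pow_mul, ← pow_succ, map_pow]
  have hϑS : toS φ (X - C ((algebraMap Fq[X] k X ^ Fintype.card Fq ^ r) ^ Fintype.card Fq)) =
      toS (φ.comp (algebraMap Fq[X] k)) (X - C (X ^ Fintype.card Fq ^ (r + 1))) := by
    rw [hϑ, ← embP_X_sub_C, toS_embP]
  have hXlt : ‖φ (algebraMap Fq[X] k X)‖ < (Fintype.card Fq : ℝ) ^ Fintype.card Fq :=
    norm_X_lt (φ := φ.comp (algebraMap Fq[X] k)) hφ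
  have key := frobenius_ne_of_evalSeries_ne_zero (Fq := Fq) hσ φ
    (ϑ := algebraMap Fq[X] k X ^ Fintype.card Fq ^ r) (i := i) (b := embP Fq k (c.map C))
    (H := embP Fq k (twP Fq r H)) (u := twS Fq r u)
    (ρ := ((Fintype.card Fq : ℝ) ^ Fintype.card Fq) ^ Fintype.card Fq ^ r) ?_ ?_ ?_ ?_ ?_
    (hu.twS Fq (by positivity) r) ?_ (one_le_pow₀ hρ1) ?_ ?_ f
  · rw [map_mul (twP Fq r), twP_map_C, map_mul (embP Fq k), embP_X_sub_C, ← hϑ]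
    exact key
  · intro a b hab
    have h : (algebraMap Fq[X] k X) ^ Fintype.card Fq ^ (r + a) =
        (algebraMap Fq[X] k X) ^ Fintype.card Fq ^ (r + b) := by
      simpa only [← pow_mul, ← pow_add] using hab
    have := pow_card_injective_algebraMap hinj (by simp : 0 < (X : Fq[X]).natDegree) h
    omega
  · rintro rfl
    exact hi (dvd_zero _)
  · intro y hy
    refine pow_card_sub_one_ne (e := r + 1) hval ?_ hi hy
    rw [norm_neg, hϑ, hφ _ (pow_ne_zero _ X_ne_zero), natDegree_X_pow]
  · rw [Ne, map_eq_zero_iff _ (embP_injective Fq k hinj)]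
    exact (Polynomial.map_ne_zero_iff C_injective).2 hc
  · rw [← embP_twP, twP_map_C]
  · rw [map_pow, norm_pow]
    exact pow_lt_pow_left₀ hXlt (norm_nonneg _) (card_pow_ne_zero Fq r)
  · rw [hϑS, twS_twS, add_comm, ← twS_twS, hrel, map_mul, map_pow,
      map_sub (twS Fq r), twS_toS, twS_toS, twP_X_sub_C_pow, toS_embP]
  · rw [map_pow, evalSeries_twS Fq hu hXlt]
    exact pow_ne_zero _ hev

lemma exists_twist (Fq : Type*) [Field Fq] [Fintype Fq] (k : Type*) [Field k] [Algebra Fq k] :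
    ∃ σ : FractionRing k[X] →+* FractionRing k[X], ∀ p,
      σ (algebraMap k[X] (FractionRing k[X]) p) =
        algebraMap k[X] (FractionRing k[X]) (twP Fq 1 p) := by
  have hinj : Function.Injective
      ((algebraMap k[X] (FractionRing k[X])).comp (twP Fq 1)) :=
    (IsFractionRing.injective k[X] (FractionRing k[X])).comp
      (Polynomial.map_injective _ (frob Fq 1 : k →+* k).injective)
  exact ⟨IsFractionRing.lift hinj, fun p => IsFractionRing.lift_algebraMap hinj p⟩

/-- The linear independence of the period power and the double zeta values. -/
theorem coefficients_eq_zero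
    (hφ : ∀ a ≠ 0, ‖φ (algebraMap Fq[X] k a)‖ = (Fintype.card Fq : ℝ) ^ a.natDegree)
    (hval : ∀ y : K, y ≠ 0 → ∃ z : ℤ, ‖y‖ = (Fintype.card Fq : ℝ) ^ z) {n : ℕ} {J : Finset ℕ}
    (hJ : ∀ j ∈ J, j < n ∧ ¬ (Fintype.card Fq - 1) ∣ j) {D : ℕ → K}
    (hD : ∀ j ∈ J, HasSum (fun d => powerSum (φ.comp (algebraMap Fq[X] k)) d (n - j) *
      ∑ e ∈ Finset.range d, powerSum (φ.comp (algebraMap Fq[X] k)) e j) (D j)) {ϖ : K}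
    (hϖ : ϖ = -(φ (algebraMap Fq[X] k X) ^ Fintype.card Fq) * ∏' i : ℕ,
      ((1 - φ (algebraMap Fq[X] k X) ^ ((1 : ℤ) - (Fintype.card Fq : ℤ) ^ (i + 1)))⁻¹) ^
        (Fintype.card Fq - 1))
    {b : Fq[X]} {c : ℕ → Fq[X]} (hb : ¬ (Fintype.card Fq - 1) ∣ n → b = 0)
    (hrel : φ (algebraMap Fq[X] k b) * ϖ ^ (n / (Fintype.card Fq - 1)) +
      ∑ j ∈ J, φ (algebraMap Fq[X] k (c j)) * D j = 0) : ∀ j ∈ J, c j = 0 := by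
  classical
  set ψ : Fq[X] →+* K := φ.comp (algebraMap Fq[X] k) with hψ
  have hψn : ∀ a ≠ 0, ‖ψ a‖ = (Fintype.card Fq : ℝ) ^ a.natDegree := hφ
  have hinj := injective_of_norm hψn
  have hρ1 := one_le_radius Fq
  have hρ0 := zero_lt_one.trans_le hρ1
  have hXlt := norm_X_lt hψn
  obtain ⟨σ, hσ⟩ := exists_twist Fq k
  obtain ⟨Γ, hΓ, hrep⟩ := exists_common_repBy hinj n
  have hseries : ∀ s ≠ 0, s < n → ∃ (H : Fq[X][X]) (C₁ β : ℝ) (u : PowerSeries K),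
      0 ≤ β ∧ β < 1 ∧ (∀ d, GaussBound ((Fintype.card Fq : ℝ) ^ Fintype.card Fq) (C₁ * β ^ d)
        (term ψ H s d)) ∧ SumsTo ((Fintype.card Fq : ℝ) ^ Fintype.card Fq) C₁ β (term ψ H s) u ∧
        ∀ d, evalSeries (ψ X) (term ψ H s d) = ψ Γ * powerSum ψ d s := by
    intro s hs hsn
    obtain ⟨g, H, hH, hg, hHd⟩ := hrep s hs hsn
    obtain ⟨C₁, β, hC, hβ, hβ1, hT⟩ := exists_gaussBound_term hψn hH hg
    obtain ⟨u, hu⟩ := exists_sumsTo hρ0 hC hβ hβ1 hT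
    refine ⟨H, C₁, β, u, hβ, hβ1, hT, hu, fun d => ?_⟩
    rw [evalSeries_term hψn, ← hHd, mul_inv_cancel_right₀ (pow_ne_zero _ (ell_ne_zero hinj d))]
  choose! H C₁ β u hβ hβ1 hT hu hev using hseries
  by_contra! hex
  obtain ⟨j₀, hj₀, hcj₀⟩ := hex
  set J' := J.filter (fun j => c j ≠ 0) with hJ'
  have hne : Nonempty J' := ⟨⟨j₀, Finset.mem_filter.2 ⟨hj₀, hcj₀⟩⟩⟩
  have hJJ : ∀ j : J', (j : ℕ) ∈ J := fun j => (Finset.mem_filter.1 j.2).1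
  have hcJ : ∀ j : J', c j ≠ 0 := fun j => (Finset.mem_filter.1 j.2).2
  have hjn : ∀ j : J', (j : ℕ) < n := fun j => (hJ j (hJJ j)).1
  have hjd : ∀ j : J', ¬ (Fintype.card Fq - 1) ∣ (j : ℕ) := fun j => (hJ j (hJJ j)).2
  have hj0 : ∀ j : J', (j : ℕ) ≠ 0 := fun j h => hjd j (h ▸ dvd_zero _)
  have hnj0 : ∀ j : J', n - (j : ℕ) ≠ 0 := fun j => by
    have := hjn j
    omega
  have hnjn : ∀ j : J', n - (j : ℕ) < n := fun j => by
    have := hj0 j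
    have := hjn j
    omega
  have hune : ∀ s ≠ 0, s < n → evalSeries (ψ X) (u s) ≠ 0 := fun s hs hsn =>
    zeta_ne_zero hψn hΓ hs (((hu s hs hsn).hasSum (hβ s hs hsn) (hβ1 s hs hsn) (hT s hs hsn)
      hXlt).congr_fun fun d => (hev s hs hsn d).symm)
  have hurel : ∀ s ≠ 0, s < n → twS Fq 1 (u s) =
      toS ψ (X - C (X ^ Fintype.card Fq)) ^ s * (u s - toS ψ (H s)) := fun s hs hsn =>
    twS_zeta_series hinj (hβ s hs hsn) (hβ1 s hs hsn) (hu s hs hsn)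
  have hdouble : ∀ j : J', ∃ v M, GaussBound ((Fintype.card Fq : ℝ) ^ Fintype.card Fq) M v ∧
      twS Fq 1 v = toS ψ (X - C (X ^ Fintype.card Fq)) ^ n *
        (v - toS ψ (H j) * (u (n - j) - toS ψ (H (n - j)))) ∧
      evalSeries (ψ X) v = ψ Γ ^ 2 * D j := by
    intro j
    obtain ⟨v, M, hM, hv, hs⟩ := exists_double_series hψn (hβ _ (hnj0 j) (hnjn j))
      (hβ1 _ (hnj0 j) (hnjn j)) (hβ _ (hj0 j) (hjn j)) (hβ1 _ (hj0 j) (hjn j))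
      (hT _ (hnj0 j) (hnjn j)) (hT _ (hj0 j) (hjn j)) (hu _ (hnj0 j) (hnjn j))
    rw [Nat.sub_add_cancel (hjn j).le] at hv
    refine ⟨v, M, hM, hv, hs.unique (((hD j (hJJ j)).mul_left (ψ Γ ^ 2)).congr_fun fun d => ?_)⟩
    simp only [hev _ (hnj0 j) (hnjn j), hev _ (hj0 j) (hjn j), ← Finset.mul_sum]
    ring
  choose v Mv hMv hv hvev using hdouble
  obtain ⟨W, MW, hMW, hW, hWev⟩ : ∃ W MW,
      GaussBound ((Fintype.card Fq : ℝ) ^ Fintype.card Fq) MW W ∧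
      twS Fq 1 W = toS ψ (X - C (X ^ Fintype.card Fq)) ^ n * W ∧
      evalSeries (ψ X) W = ψ Γ ^ 2 * (ψ b * ϖ ^ (n / (Fintype.card Fq - 1))) := by
    by_cases hdvd : (Fintype.card Fq - 1) ∣ n
    · obtain ⟨ω, B, hB, hω, hωev⟩ := exists_omega hψn (n / (Fintype.card Fq - 1))
      rw [Nat.mul_div_cancel' hdvd] at hω
      obtain ⟨A, hA⟩ := exists_gaussBound_toS (φ := ψ) ((Γ ^ 2 * b).map C)
      refine ⟨toS ψ ((Γ ^ 2 * b).map C) * ω, _, hA.mul hρ0.le hB, ?_, ?_⟩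
      · rw [map_mul, twS_toS, twP_map_C, hω, mul_left_comm]
      · rw [evalSeries_mul hA hB hXlt, hωev, evalSeries_toS, eval_X_map_C, hϖ, map_mul, map_pow,
          mul_assoc]
        rfl
    · refine ⟨0, 0, GaussBound.zero le_rfl, by simp, ?_⟩
      rw [evalSeries_zero, hb hdvd]
      simp
  have hcb : ∀ j : J', ∃ A, GaussBound ((Fintype.card Fq : ℝ) ^ Fintype.card Fq) A
      (toS ψ ((c j).map C)) := fun j => exists_gaussBound_toS _
  choose A hA using hcb
  have hterm : ∀ j : J', GaussBound ((Fintype.card Fq : ℝ) ^ Fintype.card Fq) (A j * Mv j)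
      (toS ψ ((c j).map C) * v j) := fun j => (hA j).mul hρ0.le (hMv j)
  have hsumb := GaussBound.sum (s := Finset.univ) hρ0.le
    (Finset.sum_nonneg fun j _ => (hterm j).nonneg) fun j hj =>
      (hterm j).mono (Finset.single_le_sum (f := fun j => A j * Mv j)
        (fun j _ => (hterm j).nonneg) hj)
  set MS := ∑ j : J', A j * Mv j with hMS
  have hub : ∀ j : J', GaussBound ((Fintype.card Fq : ℝ) ^ Fintype.card Fq) (C₁ (n - j))
      (u (n - j)) := fun j => (hu _ (hnj0 j) (hnjn j)).gaussBound
  set Mu := ∑ j : J', C₁ (n - j) with hMu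
  have hMu0 : 0 ≤ Mu := Finset.sum_nonneg fun j _ => (hub j).nonneg
  have hMS0 : 0 ≤ MS := hsumb.nonneg
  have hMW0 : 0 ≤ MW := hMW.nonneg
  refine false_of_inhomogeneous_system (S := J') (M := MW + MS + Mu) hφ hσ (ϑ := X) (by simp)
    (n := n) (wt := fun j => n - j) (B := fun j => (c j).map C * H j) (H := fun j => H (n - j))
    (U := W + ∑ j : J', toS ψ ((c j).map C) * v j) (u := fun j => u (n - j)) ?_ hnj0 hnjn ?_ ?_ ?_
    hXlt ?_ ?_ ?_ ?_
  · intro i j hij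
    have := hjn i
    have := hjn j
    simp only at hij
    exact Subtype.ext (by omega)
  · intro r j f
    rw [Nat.sub_sub_self (hjn j).le]
    exact frobenius_ne_of_zeta_series hφ hval hσ (hjd j) (hcJ j)
      (hu _ (hj0 j) (hjn j)).gaussBound (hurel _ (hj0 j) (hjn j)) (hune _ (hj0 j) (hjn j)) r f
  · exact (hMW.mono (by linarith)).add hρ0.le (hsumb.mono (by linarith))
  · intro j
    refine (hub j).mono ?_
    have := Finset.single_le_sum (f := fun j : J' => C₁ (n - j)) (fun j _ => (hub j).nonneg)
      (Finset.mem_univ j)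
    linarith
  · simp only [toS_embP]
    rw [map_add, hW, map_sum]
    simp only [map_mul, twS_toS, twP_map_C, hv]
    rw [mul_sub, mul_add, Finset.mul_sum, Finset.mul_sum, add_sub_assoc, ← Finset.sum_sub_distrib]
    congr 1
    refine Finset.sum_congr rfl fun j _ => ?_
    ring
  · intro j
    simp only [toS_embP]
    exact hurel _ (hnj0 j) (hnjn j)
  · change evalSeries (ψ X) _ = 0
    rw [evalSeries_add hMW hsumb hXlt, evalSeries_sum (fun j _ => hterm j) hXlt, hWev]
    have hsum : ∑ j : J', evalSeries (ψ X) (toS ψ ((c j).map C) * v j) =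
        ψ Γ ^ 2 * ∑ j ∈ J, ψ (c j) * D j := by
      have h1 : ∑ j ∈ J, ψ (c j) * D j = ∑ j ∈ J', ψ (c j) * D j := by
        refine (Finset.sum_filter_of_ne fun j _ hj => ?_).symm
        rintro h0
        exact hj (by rw [h0, map_zero, zero_mul])
      rw [h1, ← Finset.sum_coe_sort J', Finset.mul_sum]
      refine Finset.sum_congr rfl fun j _ => ?_
      rw [evalSeries_mul (hA j) (hMv j) hXlt, evalSeries_toS, eval_X_map_C, hvev]
      ring
    rw [hsum, ← mul_add]
    exact mul_eq_zero_of_right _ hrel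
  · intro j
    exact hune _ (hnj0 j) (hnjn j)

end Independence


section DoubleSum

variable {Fq : Type*} [Field Fq] [Fintype Fq] {K : Type*} [NormedField K] [CompleteSpace K]
  [IsUltrametricDist K] [Algebra Fq K] {φ : Fq[X] →+* K}

lemma summable_indicator_double
    (hφ : ∀ a ≠ 0, ‖φ a‖ = (Fintype.card Fq : ℝ) ^ a.natDegree) {s₁ s₂ : ℕ} (h₁ : s₁ ≠ 0) :
    Summable (Set.indicator {g : Fq[X] × Fq[X] | g.1.Monic ∧ g.2.Monic ∧ g.2.degree < g.1.degree}
      fun g => (φ g.1 ^ s₁)⁻¹ * (φ g.2 ^ s₂)⁻¹) := by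
  classical
  have hqR : (1 : ℝ) < Fintype.card Fq := by exact_mod_cast Fintype.one_lt_card
  refine NonarchimedeanAddGroup.summable_of_tendsto_cofinite_zero ?_
  rw [Metric.tendsto_nhds]
  intro ε hε
  obtain ⟨N, hN⟩ := exists_pow_lt_of_lt_one hε (inv_lt_one_of_one_lt₀ hqR)
  rw [Filter.eventually_cofinite]
  refine Set.Finite.subset (Finset.finite_toSet (((Finset.range N).biUnion (monics Fq)) ×ˢ
    ((Finset.range N).biUnion (monics Fq)))) fun g hg => ?_
  simp only [Set.mem_ofPred_eq, dist_zero_right, not_lt] at hg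
  by_cases hS : g.1.Monic ∧ g.2.Monic ∧ g.2.degree < g.1.degree
  · rw [Set.indicator_of_mem (by exact hS), norm_mul, norm_inv, norm_inv, norm_pow, norm_pow,
      hφ _ hS.1.ne_zero, hφ _ hS.2.1.ne_zero] at hg
    have hlt : g.2.natDegree < g.1.natDegree := natDegree_lt_natDegree hS.2.1.ne_zero hS.2.2
    have h1 : (((Fintype.card Fq : ℝ) ^ g.1.natDegree) ^ s₁)⁻¹ ≤
        (Fintype.card Fq : ℝ)⁻¹ ^ g.1.natDegree := by
      rw [inv_pow]
      exact inv_anti₀ (by positivity) (le_self_pow₀ (one_le_pow₀ hqR.le) h₁)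
    have h2 : (((Fintype.card Fq : ℝ) ^ g.2.natDegree) ^ s₂)⁻¹ ≤ 1 :=
      inv_le_one_of_one_le₀ (one_le_pow₀ (one_le_pow₀ hqR.le))
    have h3 := (hN.trans_le hg).trans_le (mul_le_mul h1 h2 (by positivity) (by positivity))
    rw [mul_one, pow_lt_pow_iff_right_of_lt_one₀ (by positivity)
      (inv_lt_one_of_one_lt₀ hqR)] at h3
    simp only [Finset.coe_product, Set.mem_prod, Finset.mem_coe, Finset.mem_biUnion,
      Finset.mem_range, mem_monics]
    exact ⟨⟨_, h3, hS.1, rfl⟩, ⟨_, hlt.trans h3, hS.2.1, rfl⟩⟩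
  · rw [Set.indicator_of_notMem (by exact hS), norm_zero] at hg
    exact absurd hε hg.not_gt

/-- Summation of the double zeta series by the degree of the first variable. -/
lemma hasSum_double (hφ : ∀ a ≠ 0, ‖φ a‖ = (Fintype.card Fq : ℝ) ^ a.natDegree) {s₁ s₂ : ℕ}
    (h₁ : s₁ ≠ 0) :
    HasSum (fun d => powerSum φ d s₁ * ∑ e ∈ Finset.range d, powerSum φ e s₂)
      (∑' a : {g : Fq[X] × Fq[X] // g.1.Monic ∧ g.2.Monic ∧ g.2.degree < g.1.degree},
        (φ a.1.1 ^ s₁)⁻¹ * (φ a.1.2 ^ s₂)⁻¹) := by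
  classical
  set S : Set (Fq[X] × Fq[X]) := {g | g.1.Monic ∧ g.2.Monic ∧ g.2.degree < g.1.degree} with hS
  set f : Fq[X] × Fq[X] → K := fun g => (φ g.1 ^ s₁)⁻¹ * (φ g.2 ^ s₂)⁻¹ with hf
  have hsum := (summable_indicator_double hφ (s₂ := s₂) h₁).hasSum
  have htot : ∑' a : S, f a = ∑' g, S.indicator f g := tsum_subtype S f
  change HasSum _ (∑' a : S, f a)
  rw [htot]
  suffices h : ∀ d, (∑' b : (fun g : Fq[X] × Fq[X] => g.1.natDegree) ⁻¹' {d}, S.indicator f b) =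
      powerSum φ d s₁ * ∑ e ∈ Finset.range d, powerSum φ e s₂ by
    rw [← funext h]
    exact hsum.tsum_fiberwise _
  intro d
  have hdis : (↑(Finset.range d) : Set ℕ).PairwiseDisjoint (monics Fq) := by
    intro a _ b _ hab
    rw [Function.onFun, Finset.disjoint_left]
    intro x hx hx'
    exact hab ((mem_monics.1 hx).2.symm.trans (mem_monics.1 hx').2)
  rw [tsum_subtype ((fun g : Fq[X] × Fq[X] => g.1.natDegree) ⁻¹' {d}) (S.indicator f),
    tsum_eq_sum (s := monics Fq d ×ˢ (Finset.range d).biUnion (monics Fq)), Finset.sum_product,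
    powerSum, Finset.sum_mul]
  · refine Finset.sum_congr rfl fun a ha => ?_
    rw [Finset.sum_biUnion hdis, Finset.mul_sum]
    refine Finset.sum_congr rfl fun e he => ?_
    rw [powerSum, Finset.mul_sum]
    refine Finset.sum_congr rfl fun b hb => ?_
    rw [mem_monics] at ha hb
    rw [Set.indicator_of_mem (by exact ha.2), Set.indicator_of_mem]
    refine ⟨ha.1, hb.1, degree_lt_degree ?_⟩
    rw [ha.2, hb.2]
    exact Finset.mem_range.1 he
  · intro g hg
    by_contra hne
    refine hg ?_
    have hd : g.1.natDegree = d := by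
      by_contra hd
      exact hne (Set.indicator_of_notMem (by exact hd) _)
    rw [Set.indicator_of_mem (by exact hd)] at hne
    have hgS : g.1.Monic ∧ g.2.Monic ∧ g.2.degree < g.1.degree := by
      by_contra hgS
      exact hne (Set.indicator_of_notMem (by exact hgS) _)
    simp only [Finset.mem_product, Finset.mem_biUnion, Finset.mem_range, mem_monics]
    exact ⟨⟨hgS.1, hd⟩, _, hd ▸ natDegree_lt_natDegree hgS.2.1.ne_zero hgS.2.2, hgS.2.1, rfl⟩

lemma norm_tprod_eq_one {f : ℕ → K} (hf : ∀ i, ‖f i‖ = 1) : ‖∏' i, f i‖ = 1 := by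
  by_cases h : Multipliable f
  · rw [h.norm_tprod, tprod_congr hf, tprod_one]
  · rw [tprod_eq_one_of_not_multipliable h, norm_one]

lemma norm_period (hφ : ∀ a ≠ 0, ‖φ a‖ = (Fintype.card Fq : ℝ) ^ a.natDegree) :
    ‖-(φ X ^ Fintype.card Fq) * ∏' i : ℕ,
      ((1 - φ X ^ ((1 : ℤ) - (Fintype.card Fq : ℤ) ^ (i + 1)))⁻¹) ^ (Fintype.card Fq - 1)‖ =
        (Fintype.card Fq : ℝ) ^ Fintype.card Fq ^ 1 := by
  have hq : 1 < Fintype.card Fq := Fintype.one_lt_card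
  have hqR : (1 : ℝ) < Fintype.card Fq := by exact_mod_cast hq
  rw [norm_mul, norm_neg, norm_pow, hφ X X_ne_zero, natDegree_X, pow_one, pow_one,
    norm_tprod_eq_one, mul_one]
  intro i
  have hlt : ‖φ X ^ ((1 : ℤ) - (Fintype.card Fq : ℤ) ^ (i + 1))‖ < 1 := by
    rw [norm_zpow, hφ X X_ne_zero, natDegree_X, pow_one]
    refine zpow_lt_one_of_neg₀ hqR ?_
    have : (1 : ℤ) < (Fintype.card Fq : ℤ) ^ (i + 1) :=
      one_lt_pow₀ (by exact_mod_cast hq) (Nat.succ_ne_zero i)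
    omega
  have h1 : ‖(1 : K) - φ X ^ ((1 : ℤ) - (Fintype.card Fq : ℤ) ^ (i + 1))‖ = 1 := by
    rw [sub_eq_add_neg, IsUltrametricDist.norm_add_eq_max_of_norm_ne_norm, norm_one, norm_neg,
      max_eq_left hlt.le]
    rw [norm_one, norm_neg]
    exact hlt.ne'
  rw [norm_pow, norm_inv, h1, inv_one, one_pow]

end DoubleSum

section Span

variable {Fq : Type*} [Field Fq] [Fintype Fq] {k : Type*} [Field k] [Algebra Fq k]
  [Algebra Fq[X] k] [IsFractionRing Fq[X] k]
  {K : Type*} [NormedField K] [CompleteSpace K] [IsUltrametricDist K] [Algebra Fq K]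
  {φ : k →+* K} {L : Type*} [Field L] [Algebra k L] {ι : K →+* L}

theorem linearIndependent_period_double
    (hφ : ∀ a ≠ 0, ‖φ (algebraMap Fq[X] k a)‖ = (Fintype.card Fq : ℝ) ^ a.natDegree)
    (hval : ∀ y : K, y ≠ 0 → ∃ z : ℤ, ‖y‖ = (Fintype.card Fq : ℝ) ^ z)
    (hcompat : ∀ x, algebraMap k L x = ι (φ x)) {n : ℕ} {J : Finset ℕ}
    (hJ : ∀ j ∈ J, j < n ∧ ¬ (Fintype.card Fq - 1) ∣ j) {D : ℕ → K}
    (hD : ∀ j ∈ J, HasSum (fun d => powerSum (φ.comp (algebraMap Fq[X] k)) d (n - j) *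
      ∑ e ∈ Finset.range d, powerSum (φ.comp (algebraMap Fq[X] k)) e j) (D j)) {ϖ : K}
    (hϖ : ϖ = -(φ (algebraMap Fq[X] k X) ^ Fintype.card Fq) * ∏' i : ℕ,
      ((1 - φ (algebraMap Fq[X] k X) ^ ((1 : ℤ) - (Fintype.card Fq : ℤ) ^ (i + 1)))⁻¹) ^
        (Fintype.card Fq - 1))
    {π : L} (hπ : π ^ (Fintype.card Fq - 1) = ι ϖ) :
    LinearIndependent k (fun i : Option J => i.elim (π ^ n) fun j => ι (D j)) := by
  classical
  have hq : 1 < Fintype.card Fq := Fintype.one_lt_card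
  have hϖn : ‖ϖ‖ = (Fintype.card Fq : ℝ) ^ Fintype.card Fq ^ 1 := by
    rw [hϖ]
    exact norm_period (φ := φ.comp (algebraMap Fq[X] k)) hφ
  have hϖ0 : ϖ ≠ 0 := by
    rw [← norm_ne_zero_iff, hϖn]
    have : 0 < Fintype.card Fq := hq.pos
    positivity
  have hπ0 : π ≠ 0 := by
    rintro rfl
    rw [zero_pow (Nat.sub_ne_zero_of_lt hq)] at hπ
    exact hϖ0 ((map_eq_zero ι).1 hπ.symm)
  let : Algebra Fq[X] L := ((algebraMap k L).comp (algebraMap Fq[X] k)).toAlgebra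
  have : IsScalarTower Fq[X] k L := IsScalarTower.of_algebraMap_eq' rfl
  have hsmul : ∀ (a : Fq[X]) (x : L), a • x = ι (φ (algebraMap Fq[X] k a)) * x := fun a x => by
    rw [Algebra.smul_def, IsScalarTower.algebraMap_apply Fq[X] k L, hcompat]
  have hinj : ∀ {a : Fq[X]}, φ (algebraMap Fq[X] k a) = 0 → a = 0 := fun {a} h =>
    (map_eq_zero_iff _ (IsFractionRing.injective Fq[X] k)).1 ((map_eq_zero φ).1 h)
  rw [← LinearIndependent.iff_fractionRing Fq[X] k, Fintype.linearIndependent_iff]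
  intro c hc
  set c' : ℕ → Fq[X] := fun j => if h : j ∈ J then c (some ⟨j, h⟩) else 0 with hc'
  have hc'J : ∀ j : J, c' j = c (some j) := fun j => by simp [hc']
  have hsum : ∑ j : J, c (some j) • ι (D j) =
      ι (∑ j ∈ J, φ (algebraMap Fq[X] k (c' j)) * D j) := by
    rw [map_sum, ← Finset.sum_coe_sort J]
    exact Finset.sum_congr rfl fun j _ => by rw [hsmul, map_mul, hc'J]
  rw [Fintype.sum_option] at hc
  change c none • π ^ n + ∑ j : J, c (some j) • ι (D j) = 0 at hc
  rw [hsum, hsmul] at hc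
  have hb : ¬ (Fintype.card Fq - 1) ∣ n → c none = 0 := by
    intro hn
    by_contra h0
    have hb0 : φ (algebraMap Fq[X] k (c none)) ≠ 0 := fun h => h0 (hinj h)
    set y : K := -(∑ j ∈ J, φ (algebraMap Fq[X] k (c' j)) * D j) /
      φ (algebraMap Fq[X] k (c none)) with hy
    have hyπ : ι y = π ^ n := by
      rw [hy, map_div₀, div_eq_iff ((map_ne_zero ι).2 hb0), map_neg]
      linear_combination -hc
    have hy0 : y ≠ 0 := by
      rintro h
      rw [h, map_zero] at hyπ
      exact pow_ne_zero n hπ0 hyπ.symm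
    refine pow_card_sub_one_ne hval hϖn hn hy0 (ι.injective ?_)
    rw [map_pow, map_pow, hyπ, ← hπ, ← pow_mul, ← pow_mul, mul_comm]
  have hrel : φ (algebraMap Fq[X] k (c none)) * ϖ ^ (n / (Fintype.card Fq - 1)) +
      ∑ j ∈ J, φ (algebraMap Fq[X] k (c' j)) * D j = 0 := by
    refine ι.injective ?_
    rw [map_add, map_mul, map_pow, map_zero, ← hπ, ← pow_mul, ← hc]
    by_cases hn : (Fintype.card Fq - 1) ∣ n
    · rw [Nat.mul_div_cancel' hn]
    · rw [hb hn]
      simp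
  have hzero := coefficients_eq_zero hφ hval hJ hD hϖ hb hrel
  rintro (_ | j)
  · rw [Finset.sum_eq_zero fun j hj => by rw [hzero j hj, map_zero, map_zero, zero_mul], map_zero,
      add_zero] at hc
    exact hinj ((map_eq_zero ι).1 ((mul_eq_zero.1 hc).resolve_right (pow_ne_zero n hπ0)))
  · rw [← hc'J]
    exact hzero j j.2

/-- The lower bound for the dimension of the span of the period power and the double sums. -/
theorem le_finrank_span_period_double
    (hφ : ∀ a ≠ 0, ‖φ (algebraMap Fq[X] k a)‖ = (Fintype.card Fq : ℝ) ^ a.natDegree)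
    (hval : ∀ y : K, y ≠ 0 → ∃ z : ℤ, ‖y‖ = (Fintype.card Fq : ℝ) ^ z)
    (hcompat : ∀ x, algebraMap k L x = ι (φ x)) {n : ℕ} (hn : 2 ≤ n) {D : ℕ → K}
    (hD : ∀ j < n, HasSum (fun d => powerSum (φ.comp (algebraMap Fq[X] k)) d (n - j) *
      ∑ e ∈ Finset.range d, powerSum (φ.comp (algebraMap Fq[X] k)) e j) (D j)) {ϖ : K}
    (hϖ : ϖ = -(φ (algebraMap Fq[X] k X) ^ Fintype.card Fq) * ∏' i : ℕ,
      ((1 - φ (algebraMap Fq[X] k X) ^ ((1 : ℤ) - (Fintype.card Fq : ℤ) ^ (i + 1)))⁻¹) ^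
        (Fintype.card Fq - 1))
    {π : L} (hπ : π ^ (Fintype.card Fq - 1) = ι ϖ) :
    n - (n - 1) / (Fintype.card Fq - 1) ≤ Module.finrank k
      (Submodule.span k (insert (π ^ n) ((fun j => ι (D j)) '' Set.Ioo 0 n))) := by
  classical
  set S : Set L := insert (π ^ n) ((fun j => ι (D j)) '' Set.Ioo 0 n) with hS
  have hfin : S.Finite := ((Set.finite_Ioo 0 n).image _).insert _
  set J : Finset ℕ := (Finset.Ioc 0 (n - 1)).filter fun j => ¬ (Fintype.card Fq - 1) ∣ j with hJdef
  have hmem : ∀ {j}, j ∈ J ↔ (0 < j ∧ j < n) ∧ ¬ (Fintype.card Fq - 1) ∣ j := fun {j} => by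
    rw [hJdef, Finset.mem_filter, Finset.mem_Ioc]
    have : j ≤ n - 1 ↔ j < n := by omega
    rw [this]
  have hcard : J.card + (n - 1) / (Fintype.card Fq - 1) = n - 1 := by
    rw [← Nat.Ioc_filter_dvd_card_eq_div, hJdef, add_comm,
      Finset.card_filter_add_card_filter_not, Nat.card_Ioc, Nat.sub_zero]
  have hli := linearIndependent_period_double hφ hval hcompat
    (fun j hj => ⟨(hmem.1 hj).1.2, (hmem.1 hj).2⟩) (fun j hj => hD j (hmem.1 hj).1.2) hϖ hπ
  have hsub : Set.range (fun i : Option J => i.elim (π ^ n) fun j => ι (D j)) ⊆ S := by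
    rintro _ ⟨_ | j, rfl⟩
    · exact Set.mem_insert _ _
    · exact Set.mem_insert_of_mem _ ⟨j, (hmem.1 j.2).1, rfl⟩
  have : FiniteDimensional k (Submodule.span k S) := FiniteDimensional.span_of_finite k hfin
  have h := Submodule.finrank_mono (Submodule.span_mono (R := k) hsub)
  rw [finrank_span_eq_card hli, Fintype.card_option, Fintype.card_coe] at h
  omega

end Span


section Completion

open scoped NNReal

variable (Fq : Type) [Field Fq] [Fintype Fq] [DecidableEq (RatFunc Fq)]

lemma one_lt_card_nnreal (Fq : Type) [Field Fq] [Fintype Fq] : (1 : ℝ≥0) < Fintype.card Fq := by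
  exact_mod_cast Fintype.one_lt_card

lemma v_toKinfty (x : RatFunc Fq) :
    (Valued.v (toKinfty Fq x) : WithZero (Multiplicative ℤ)) = RatFunc.inftyValuation Fq x := by
  let := RatFunc.inftyValued Fq
  exact Valued.valuedCompletion_apply x

/-- The rank one structure of base `q` on the valuation of the completion at infinity. -/
@[reducible]
noncomputable def rankOneInfty :
    (Valued.v : Valuation (RatFunc.CompletionAtInfty Fq)
      (WithZero (Multiplicative ℤ))).RankOne where
  hom' := (WithZeroMulInt.toNNReal (one_lt_card_nnreal Fq).ne_zero).comp
    MonoidWithZeroHom.ValueGroup₀.embedding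
  strictMono' := (WithZeroMulInt.toNNReal_strictMono (one_lt_card_nnreal Fq)).comp
    MonoidWithZeroHom.ValueGroup₀.embedding_strictMono
  exists_val_nontrivial := ⟨toKinfty Fq RatFunc.X, by simp [v_toKinfty]⟩

/-- The normalized absolute value on the completion at infinity. -/
@[reducible]
noncomputable def normedFieldInfty : NormedField (RatFunc.CompletionAtInfty Fq) :=
  letI := rankOneInfty Fq
  Valued.toNormedField _ (WithZero (Multiplicative ℤ))

lemma isUltrametricDist_infty :
    letI := normedFieldInfty Fq
    IsUltrametricDist (RatFunc.CompletionAtInfty Fq) :=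
  letI := rankOneInfty Fq
  inferInstance

lemma norm_infty (x : RatFunc.CompletionAtInfty Fq) :
    (normedFieldInfty Fq).norm x =
      WithZeroMulInt.toNNReal (one_lt_card_nnreal Fq).ne_zero (Valued.v x) := by
  let := rankOneInfty Fq
  change ((WithZeroMulInt.toNNReal (one_lt_card_nnreal Fq).ne_zero
    (MonoidWithZeroHom.ValueGroup₀.embedding
      (Valuation.restrict Valued.v x)) : ℝ≥0) : ℝ) = _
  rw [Valuation.restrict_def, MonoidWithZeroHom.ValueGroup₀.embedding_restrict₀]
  rfl

lemma toNNReal_exp {e : ℝ≥0} (he : e ≠ 0) (z : ℤ) :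
    WithZeroMulInt.toNNReal he (WithZero.exp z) = e ^ z := by
  rw [WithZeroMulInt.toNNReal_neg_apply he WithZero.exp_ne_zero]
  rfl

lemma norm_toKinfty_algebraMap (a : Fq[X]) (ha : a ≠ 0) :
    (normedFieldInfty Fq).norm (toKinfty Fq (algebraMap Fq[X] (RatFunc Fq) a)) =
      (Fintype.card Fq : ℝ) ^ a.natDegree := by
  rw [norm_infty, v_toKinfty, RatFunc.inftyValuation_apply,
    RatFunc.inftyValuation.polynomial Fq ha, toNNReal_exp]
  simp

lemma exists_norm_eq_zpow (y : RatFunc.CompletionAtInfty Fq) (hy : y ≠ 0) :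
    ∃ z : ℤ, (normedFieldInfty Fq).norm y = (Fintype.card Fq : ℝ) ^ z := by
  have hv : (Valued.v y : WithZero (Multiplicative ℤ)) ≠ 0 := (Valuation.ne_zero_iff _).2 hy
  have h := toNNReal_exp (one_lt_card_nnreal Fq).ne_zero (WithZero.log (Valued.v y))
  rw [WithZero.exp_log hv] at h
  refine ⟨WithZero.log (Valued.v y), ?_⟩
  rw [norm_infty, h]
  simp

lemma completeSpace_infty : CompleteSpace (RatFunc.CompletionAtInfty Fq) :=
  inferInstanceAs (CompleteSpace (@UniformSpace.Completion (RatFunc Fq)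
    (RatFunc.inftyValued Fq).toUniformSpace))

end Completion

end DoubleZeta

/-- For every integer `n ≥ 2`, the `k`-vector subspace of `L`
spanned by `{π^n, ζ_A(1, n-1), ζ_A(2, n-2), …, ζ_A(n-1, 1)}` has dimension at least
`n - ⌊(n-1)/(q-1)⌋`.  Here `L` is a field which is a `k = 𝔽_q(θ)`-algebra containing
`k_∞` via an injective ring homomorphism `ι` compatible with the `k`-algebra
structure, and `π ∈ L` satisfies `π^{q-1} = ϖ`.  The double zeta value
`ζ_A(s₁, s₂)` of weight `n` is written as `ζ_A(n - j, j)` for `j ∈ (0, n)`. -/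
theorem double_zeta_span_dimension_lower_bound
    (Fq : Type) [Field Fq] [Fintype Fq] [DecidableEq (RatFunc Fq)]
    (L : Type) [Field L] [Algebra (RatFunc Fq) L]
    (ι : RatFunc.CompletionAtInfty Fq →+* L) (hι : Function.Injective ι)
    (hcompat : ∀ x : RatFunc Fq, algebraMap (RatFunc Fq) L x = ι (toKinfty Fq x))
    (π : L) (hπ : π ^ (Fintype.card Fq - 1) = ι (varpi Fq))
    (n : ℕ) (hn : 2 ≤ n) :
    n - (n - 1) / (Fintype.card Fq - 1) ≤
      Module.finrank (RatFunc Fq)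
        (Submodule.span (RatFunc Fq)
          (insert (π ^ n)
            ((fun j => ι (doubleZeta Fq (n - j) j)) '' Set.Ioo 0 n))) := by
  let := DoubleZeta.normedFieldInfty Fq
  have : IsUltrametricDist (RatFunc.CompletionAtInfty Fq) := DoubleZeta.isUltrametricDist_infty Fq
  have : CompleteSpace (RatFunc.CompletionAtInfty Fq) := DoubleZeta.completeSpace_infty Fq
  let : Algebra Fq (RatFunc.CompletionAtInfty Fq) := ((toKinfty Fq).comp RatFunc.C).toAlgebra
  have hφ : ∀ a ≠ 0, ‖toKinfty Fq (algebraMap Fq[X] (RatFunc Fq) a)‖ =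
      (Fintype.card Fq : ℝ) ^ a.natDegree := DoubleZeta.norm_toKinfty_algebraMap Fq
  refine DoubleZeta.le_finrank_span_period_double (ι := ι) (φ := toKinfty Fq)
    (D := fun j => doubleZeta Fq (n - j) j) (ϖ := varpi Fq) hφ
    (DoubleZeta.exists_norm_eq_zpow Fq) hcompat hn (fun j hj => ?_) rfl hπ
  have h := DoubleZeta.hasSum_double (φ := (toKinfty Fq).comp (algebraMap Fq[X] (RatFunc Fq))) hφ
    (s₁ := n - j) (s₂ := j) (Nat.sub_ne_zero_of_lt hj)
  convert h using 1
  unfold doubleZeta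
  refine tsum_congr fun a => ?_
  simp only [map_mul, map_inv₀, map_pow, RingHom.comp_apply]
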